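/- arXiv:math/0007008 — 2 statements merged into one kernel-verified Lean document; each statement's English description precedes it below -/
import Mathlib

section
/- Let W be a weight. Then the following are equivalent: (1) the polynomials are dense in C(W); (2) M_W(z) = +∞ for some z ∈ ℂ∖ℝ; (3) M_W(z) = +∞ for every z ∈ ℂ∖ℝ. -/
open Complex Filter Set MeasureTheory
open scoped ENNReal

noncomputable def logPlus (t : ℝ) : ℝ := max (Real.log t) 0

/-- `W` is a weight: lower semicontinuous, `≥ 1`, dominating all powers,
and finite on a set with a finite accumulation point. -/
def IsWeight (W : ℝ → ℝ≥0∞) : Prop :=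
  LowerSemicontinuous W ∧ (∀ x, 1 ≤ W x) ∧
  (∀ n : ℕ, Tendsto (fun x : ℝ => ENNReal.ofReal (|x| ^ n) / W x)
    (comap (fun x : ℝ => |x|) atTop) (nhds 0)) ∧
  ∃ x₀ : ℝ, AccPt x₀ (Filter.principal {x | W x ≠ ⊤})

/-- Membership in the space `C(W)`. -/
def MemCW (W : ℝ → ℝ≥0∞) (f : ℝ → ℂ) : Prop :=
  Continuous f ∧
  Tendsto (fun x : ℝ => ENNReal.ofReal ‖f x‖ / W x)
    (comap (fun x : ℝ => |x|) atTop) (nhds 0)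

/-- The norm of `C(W)`. -/
noncomputable def normCW (W : ℝ → ℝ≥0∞) (f : ℝ → ℂ) : ℝ≥0∞ :=
  ⨆ x : ℝ, ENNReal.ofReal ‖f x‖ / W x

/-- The polynomials are dense in `C(W)`. -/
def PolyDense (W : ℝ → ℝ≥0∞) : Prop :=
  ∀ f : ℝ → ℂ, MemCW W f → ∀ ε : ℝ, 0 < ε →
    ∃ P : Polynomial ℂ, normCW W (fun x => f x - P.eval (x : ℂ)) < ENNReal.ofReal ε

/-- The unit ball `X_W`: polynomials bounded by `W` on `ℝ`. -/
def XW (W : ℝ → ℝ≥0∞) : Set (Polynomial ℂ) :=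
  {P | ∀ x : ℝ, ENNReal.ofReal ‖P.eval (x : ℂ)‖ ≤ W x}

/-- The Hall majorant `M_W`. -/
noncomputable def MW (W : ℝ → ℝ≥0∞) (z : ℂ) : ℝ≥0∞ :=
  ⨆ P ∈ XW W, ENNReal.ofReal ‖P.eval z‖

/-- Logarithm on `[1,+∞]`, with `elog ⊤ = ⊤`. -/
noncomputable def elog (w : ℝ≥0∞) : ℝ≥0∞ :=
  if w = ⊤ then ⊤ else ENNReal.ofReal (Real.log w.toReal)



lemma harnack_aux {E : ℂ → ℂ} (hE : Differentiable ℂ E) {c : ℂ} {R m : ℝ} (hR : 0 < R)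
    (hm : 0 < m) (hm1 : m < 1) (h1 : E c = 1)
    (hlow : ∀ z ∈ Metric.ball c R, m ≤ ‖E z‖) {w : ℂ} (hw : ‖w - c‖ < R) :
    ‖E w‖ ≤ Real.exp (2 * Real.log (1 / m) * ‖w - c‖ / (R - ‖w - c‖)) := by
  set G : ℂ → ℂ := fun z => E (z + c) with hG
  have hGd : Differentiable ℂ G := by fun_prop
  have hGl : ∀ z ∈ Metric.ball (0:ℂ) R, m ≤ ‖G z‖ := by
    intro z hz
    apply hlow
    simpa using hz
  have hG0 : ∀ z ∈ Metric.ball (0:ℂ) R, G z ≠ 0 := by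
    intro z hz h
    have := hGl z hz
    rw [h, norm_zero] at this
    linarith
  have hd : DifferentiableOn ℂ (fun z => deriv G z / G z) (Metric.ball (0:ℂ) R) := by
    apply DifferentiableOn.div _ hGd.differentiableOn hG0
    exact (hGd.differentiableOn.deriv isOpen_univ).mono (subset_univ _)
  obtain ⟨F, hF⟩ := hd.isExactOn_ball
  have h0 : (0:ℂ) ∈ Metric.ball (0:ℂ) R := by simpa using hR
  set H : ℂ → ℂ := fun z => G z * exp (-(F z - F 0)) with hH
  have hHd : ∀ z ∈ Metric.ball (0:ℂ) R, HasDerivAt H 0 z := by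
    intro z hz
    have h2 := (hGd z).hasDerivAt.mul (((hF z hz).sub_const (F 0)).neg.cexp)
    have h3 : deriv G z * exp (-(F z - F 0)) +
      G z * (exp (-(F z - F 0)) * -(deriv G z / G z)) = 0 := by
      have := hG0 z hz
      field_simp
      ring
    exact h2.congr_deriv h3
  have hHc : ∀ z ∈ Metric.ball (0:ℂ) R, H z = 1 := by
    intro z hz
    have := Metric.isOpen_ball.is_const_of_deriv_eq_zero (𝕜 := ℂ) (f := H)
      (convex_ball (0:ℂ) R).isPreconnected
      (fun z hz => (hHd z hz).differentiableAt.differentiableWithinAt)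
      (fun z hz => (hHd z hz).deriv) hz h0
    rw [this]
    simp [hH, hG, h1]
  have hGe : ∀ z ∈ Metric.ball (0:ℂ) R, G z = exp (F z - F 0) := by
    intro z hz
    have := hHc z hz
    simp only [hH, exp_neg] at this
    field_simp at this
    exact this
  have hA : 0 < Real.log (1 / m) := Real.log_pos (by rw [lt_div_iff₀ hm]; linarith)
  have hwm : w - c ∈ Metric.ball (0:ℂ) R := by simpa using hw
  have key := borelCaratheodory_zero (f := fun z => -(F z - F 0)) hA
    (fun z hz => (((hF z hz).sub_const (F 0)).neg).differentiableAt.differentiableWithinAt)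
    (by
      intro z hz
      have h3 := hGl z hz
      rw [hGe z hz, norm_exp] at h3
      simp only [Set.mem_ofPred_eq, neg_re]
      rw [one_div, Real.log_inv]
      have := Real.log_le_log hm h3
      rw [Real.log_exp] at this
      linarith) hR hwm (by simp)
  have h4 : E w = exp (F (w - c) - F 0) := by
    rw [← hGe _ hwm]; simp [hG]
  rw [h4, norm_exp]
  apply Real.exp_le_exp.2
  refine le_trans (le_trans (re_le_norm _) ?_) key
  rw [norm_neg]

lemma mem_XW_iff {W : ℝ → ℝ≥0∞} {P : Polynomial ℂ} :
    P ∈ XW W ↔ ∀ x : ℝ, W x ≠ ⊤ → ‖P.eval (x : ℂ)‖ ≤ (W x).toReal := by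
  constructor
  · intro h x hx
    exact (ENNReal.ofReal_le_iff_le_toReal hx).1 (h x)
  · intro h x
    by_cases hx : W x = ⊤
    · rw [hx]; exact le_top
    · exact (ENNReal.ofReal_le_iff_le_toReal hx).2 (h x hx)

lemma one_le_toReal {W : ℝ → ℝ≥0∞} (hW : IsWeight W) {x : ℝ} (hx : W x ≠ ⊤) :
    1 ≤ (W x).toReal := by
  have := ENNReal.toReal_mono hx (hW.2.1 x)
  simpa using this

def Apx (W : ℝ → ℝ≥0∞) (f : ℝ → ℂ) : Prop :=
  ∀ ε : ℝ, 0 < ε → ∃ P : Polynomial ℂ, ∀ x : ℝ, W x ≠ ⊤ →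
    ‖f x - P.eval (x : ℂ)‖ ≤ ε * (W x).toReal

lemma polyDense_iff {W : ℝ → ℝ≥0∞} (hW : IsWeight W) :
    PolyDense W ↔ ∀ f, MemCW W f → Apx W f := by
  constructor
  · intro h f hf ε hε
    obtain ⟨P, hP⟩ := h f hf ε hε
    refine ⟨P, fun x hx => ?_⟩
    have h1 := (le_iSup (fun x : ℝ => ENNReal.ofReal ‖f x - P.eval (x : ℂ)‖ / W x) x).trans hP.le
    have h0 : W x ≠ 0 := (lt_of_lt_of_le one_pos (hW.2.1 x)).ne'
    rw [ENNReal.div_le_iff_le_mul (Or.inl h0) (Or.inl hx), ← ENNReal.ofReal_toReal hx,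
      ← ENNReal.ofReal_mul hε.le] at h1
    rwa [ENNReal.ofReal_le_ofReal_iff (by positivity)] at h1
  · intro h f hf ε hε
    obtain ⟨P, hP⟩ := h f hf (ε / 2) (by positivity)
    refine ⟨P, lt_of_le_of_lt (iSup_le (a := ENNReal.ofReal (ε / 2)) fun x => ?_) ?_⟩
    · apply ENNReal.div_le_of_le_mul
      by_cases hx : W x = ⊤
      · rw [hx, ENNReal.mul_top]
        · exact le_top
        · simpa using hε
      · rw [← ENNReal.ofReal_toReal hx, ← ENNReal.ofReal_mul (by positivity)]
        exact ENNReal.ofReal_le_ofReal (hP x hx)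
    · rw [ENNReal.ofReal_lt_ofReal_iff hε]; linarith

lemma memCW_bdd {W : ℝ → ℝ≥0∞} (hW : IsWeight W) {f : ℝ → ℂ} (hf : Continuous f) {C : ℝ}
    (hC : ∀ x, ‖f x‖ ≤ C) : MemCW W f := by
  refine ⟨hf, ?_⟩
  have h := hW.2.2.1 0
  have h2 := ENNReal.Tendsto.const_mul (a := ENNReal.ofReal C) h (Or.inr ENNReal.ofReal_ne_top)
  rw [mul_zero] at h2
  refine tendsto_of_tendsto_of_tendsto_of_le_of_le tendsto_const_nhds h2 (fun _ => zero_le) ?_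
  intro x
  simp only [pow_zero, ENNReal.ofReal_one]
  rw [ENNReal.div_eq_inv_mul, ENNReal.div_eq_inv_mul, mul_one, mul_comm]
  gcongr
  exact hC x

lemma MW_lt_top_iff {W : ℝ → ℝ≥0∞} {z : ℂ} :
    MW W z ≠ ⊤ ↔ ∃ M : ℝ, 1 ≤ M ∧ ∀ P ∈ XW W, ‖P.eval z‖ ≤ M := by
  constructor
  · intro h
    refine ⟨max 1 (MW W z).toReal, le_max_left _ _, fun P hP => le_max_of_le_right ?_⟩
    rw [← ENNReal.ofReal_le_iff_le_toReal h]
    exact le_iSup₂ (f := fun (P : Polynomial ℂ) (_ : P ∈ XW W) => ENNReal.ofReal ‖P.eval z‖) P hP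
  · rintro ⟨M, -, hM⟩
    refine ne_top_of_le_ne_top (b := ENNReal.ofReal M) ENNReal.ofReal_ne_top ?_
    exact iSup₂_le fun P hP => ENNReal.ofReal_le_ofReal (hM P hP)

lemma eval_conj_map (P : Polynomial ℂ) (z : ℂ) :
    (P.map (starRingEnd ℂ)).eval z = (starRingEnd ℂ) (P.eval ((starRingEnd ℂ) z)) := by
  have := Polynomial.eval₂_at_apply (p := P) (starRingEnd ℂ) ((starRingEnd ℂ) z)
  rw [← this, Polynomial.eval_map, Complex.conj_conj]

lemma conj_mem_XW {W : ℝ → ℝ≥0∞} {P : Polynomial ℂ} (hP : P ∈ XW W) :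
    P.map (starRingEnd ℂ) ∈ XW W := by
  intro x
  have := hP x
  rw [eval_conj_map, Complex.conj_ofReal, RCLike.norm_conj]
  exact this

lemma abs_im_le_norm_sub (x : ℝ) (z : ℂ) : |z.im| ≤ ‖(x : ℂ) - z‖ := by
  have := abs_im_le_norm ((x : ℂ) - z)
  simpa using this

lemma exists_divX (P : Polynomial ℂ) (w : ℂ) (h : P.eval w = 0) :
    ∃ S : Polynomial ℂ, ∀ z, P.eval z = (z - w) * S.eval z := by
  obtain ⟨S, hS⟩ := Polynomial.dvd_iff_isRoot.2 h
  exact ⟨S, fun z => by rw [hS]; simp⟩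

lemma eval_le_scaled {W : ℝ → ℝ≥0∞} {z : ℂ} {M : ℝ} (hM1 : 1 ≤ M)
    (hM : ∀ P ∈ XW W, ‖P.eval z‖ ≤ M) {P : Polynomial ℂ} {C : ℝ} (hC : 0 ≤ C)
    (hP : ∀ x : ℝ, W x ≠ ⊤ → ‖P.eval (x : ℂ)‖ ≤ C * (W x).toReal) : ‖P.eval z‖ ≤ C * M := by
  apply le_of_forall_pos_le_add
  intro δ hδ
  have hM0 : 0 < M := by linarith
  set D := C + δ / M with hD
  have hD0 : 0 < D := by positivity
  have hmem : Polynomial.C ((D : ℂ)⁻¹) * P ∈ XW W := by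
    rw [mem_XW_iff]
    intro x hx
    have h1 := hP x hx
    have h2 : C ≤ D := by rw [hD]; have : 0 < δ / M := by positivity
                          linarith
    rw [Polynomial.eval_mul, Polynomial.eval_C, norm_mul, norm_inv, Complex.norm_real,
      Real.norm_of_nonneg hD0.le, inv_mul_le_iff₀ hD0]
    exact h1.trans (mul_le_mul_of_nonneg_right h2 ENNReal.toReal_nonneg)
  have := hM _ hmem
  rw [Polynomial.eval_mul, Polynomial.eval_C, norm_mul, norm_inv, Complex.norm_real,
      Real.norm_of_nonneg hD0.le, inv_mul_le_iff₀ hD0] at this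
  calc _ ≤ D * M := this
    _ = _ := by rw [hD]; field_simp

lemma core_ineq {W : ℝ → ℝ≥0∞} {z w : ℂ} {M ε η : ℝ} (hM1 : 1 ≤ M)
    (hM : ∀ P ∈ XW W, ‖P.eval z‖ ≤ M) (hε : 0 ≤ ε) (hη : 0 < η) (hw : η ≤ w.im)
    {E : Polynomial ℂ} (hE1 : E.eval z = 1)
    (hE : ∀ x : ℝ, W x ≠ ⊤ → ‖E.eval (x : ℂ)‖ ≤ ε * ‖(x : ℂ) - z‖ * (W x).toReal)
    {P : Polynomial ℂ} (hP : P ∈ XW W) :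
    ‖P.eval z * E.eval w - P.eval w‖ ≤
      ‖w - z‖ * ((‖E.eval w‖ / η + ε * ‖P.eval w‖ * (1 + ‖w - z‖ / η)) * M) := by
  rw [mem_XW_iff] at hP
  obtain ⟨S, hS⟩ := exists_divX (P * Polynomial.C (E.eval w) - E * Polynomial.C (P.eval w)) w
    (by simp; ring)
  simp only [Polynomial.eval_sub, Polynomial.eval_mul, Polynomial.eval_C] at hS
  have hSz := hS z
  rw [hE1, one_mul] at hSz
  rw [hSz, norm_mul, norm_sub_rev]
  refine mul_le_mul_of_nonneg_left ?_ (norm_nonneg _)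
  apply eval_le_scaled hM1 hM (by positivity)
  intro x hx
  have h1 := hS x
  have him : η ≤ ‖(x : ℂ) - w‖ := by
    have := abs_im_le_norm_sub x w
    rw [abs_of_pos (by linarith)] at this
    linarith
  have hpos : 0 < ‖(x : ℂ) - w‖ := by linarith
  have h2 : ‖(x : ℂ) - z‖ ≤ ‖(x : ℂ) - w‖ + ‖w - z‖ := by
    simpa using norm_add_le ((x : ℂ) - w) (w - z)
  have h3 : ‖(x : ℂ) - w‖ * ‖S.eval (x : ℂ)‖ ≤ (W x).toReal * ‖E.eval w‖ +
      ε * (‖(x : ℂ) - w‖ + ‖w - z‖) * (W x).toReal * ‖P.eval w‖ := by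
    rw [← norm_mul, ← h1]
    refine (norm_sub_le _ _).trans ?_
    rw [norm_mul, norm_mul]
    gcongr
    · exact hP x hx
    · refine (hE x hx).trans ?_
      gcongr
  have hWn : 0 ≤ (W x).toReal := ENNReal.toReal_nonneg
  calc ‖S.eval (x : ℂ)‖ ≤ ((W x).toReal * ‖E.eval w‖ +
      ε * (‖(x : ℂ) - w‖ + ‖w - z‖) * (W x).toReal * ‖P.eval w‖) / ‖(x : ℂ) - w‖ := by
        rw [le_div_iff₀ hpos, mul_comm]; exact h3
    _ = (‖E.eval w‖ / ‖(x : ℂ) - w‖ + ε * ‖P.eval w‖ * (1 + ‖w - z‖ / ‖(x : ℂ) - w‖))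
        * (W x).toReal := by field_simp
    _ ≤ _ := by gcongr

lemma exists_E {W : ℝ → ℝ≥0∞} (hW : IsWeight W) (hd : ∀ f, MemCW W f → Apx W f) {z : ℂ}
    (hz : 0 < z.im) {ε : ℝ} (hε : 0 < ε) : ∃ E : Polynomial ℂ, E.eval z = 1 ∧
      ∀ x : ℝ, W x ≠ ⊤ → ‖E.eval (x : ℂ)‖ ≤ ε * ‖(x : ℂ) - z‖ * (W x).toReal := by
  have hne : ∀ x : ℝ, (x : ℂ) - z ≠ 0 := by
    intro x h
    have := abs_im_le_norm_sub x z
    rw [h, norm_zero, abs_of_pos hz] at this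
    linarith
  have hmem : MemCW W (fun x : ℝ => ((x : ℂ) - z)⁻¹) := by
    apply memCW_bdd hW (C := (z.im)⁻¹)
    · exact Continuous.inv₀ (by fun_prop) hne
    · intro x
      rw [norm_inv]
      have := abs_im_le_norm_sub x z
      rw [abs_of_pos hz] at this
      gcongr
  obtain ⟨Q, hQ⟩ := hd _ hmem ε hε
  refine ⟨1 - (Polynomial.X - Polynomial.C z) * Q, by simp, fun x hx => ?_⟩
  have h1 := hQ x hx
  have h2 : (1 - (Polynomial.X - Polynomial.C z) * Q).eval (x : ℂ) =
      ((x : ℂ) - z) * (((x : ℂ) - z)⁻¹ - Q.eval (x : ℂ)) := by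
    have := hne x
    simp
    field_simp
  rw [h2, norm_mul]
  calc _ ≤ ‖(x : ℂ) - z‖ * (ε * (W x).toReal) := by gcongr
    _ = _ := by ring

lemma hop {W : ℝ → ℝ≥0∞} (hW : IsWeight W) (hd : ∀ f, MemCW W f → Apx W f) {z w : ℂ}
    {M R : ℝ} (hM1 : 1 ≤ M) (hM : ∀ P ∈ XW W, ‖P.eval z‖ ≤ M) (hRz : R < z.im)
    (hw : ‖w - z‖ < R) {P : Polynomial ℂ} (hP : P ∈ XW W) :
    ‖P.eval w‖ ≤ M * (1 + ‖w - z‖ / (z.im - R)) *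
      Real.exp (2 * Real.log (2 * (1 + R * M / (z.im - R))) * ‖w - z‖ / (R - ‖w - z‖)) := by
  set η := z.im - R with hη
  have hη0 : 0 < η := by linarith
  have hR0 : 0 < R := lt_of_le_of_lt (norm_nonneg _) hw
  have hz : 0 < z.im := by linarith
  have him : ∀ u : ℂ, ‖u - z‖ < R → η ≤ u.im := by
    intro u hu
    have h1 := abs_im_le_norm (u - z)
    rw [sub_im] at h1
    have := (abs_le.1 (h1.trans hu.le)).1
    linarith
  set r := ‖w - z‖ with hr
  have hr0 : 0 ≤ r := norm_nonneg _
  set B := Real.exp (2 * Real.log (2 * (1 + R * M / η)) * r / (R - r)) with hB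
  have h1mem : (1 : Polynomial ℂ) ∈ XW W := by
    rw [mem_XW_iff]; intro x hx; simpa using one_le_toReal hW hx
  have hm0 : 0 < 2 * (1 + R * M / η) := by positivity
  -- for every small ε
  have key : ∀ ε : ℝ, 0 < ε → ε ≤ 1 / (2 * (R * ((1 + R / η) * M))) →
      ‖P.eval w‖ ≤ M * (1 + r / η) * B + ε * (r * ‖P.eval w‖ * (1 + r / η) * M) := by
    intro ε hε hε2
    obtain ⟨E, hE1, hE⟩ := exists_E hW hd hz hε
    have hlow : ∀ u ∈ Metric.ball z R, 1 / (2 * (1 + R * M / η)) ≤ ‖E.eval u‖ := by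
      intro u hu
      rw [mem_ball_iff_norm] at hu
      have h2 := core_ineq hM1 hM hε.le hη0 (him u hu) hE1 hE h1mem
      simp only [Polynomial.eval_one, one_mul, norm_one, mul_one] at h2
      have h3 : ‖u - z‖ * ((‖E.eval u‖ / η + ε * (1 + ‖u - z‖ / η)) * M) ≤
          R * ((‖E.eval u‖ / η + ε * (1 + R / η)) * M) := by gcongr
      have h4 : R * (ε * (1 + R / η) * M) ≤ 1 / 2 := by
        rw [le_div_iff₀ (by positivity)] at hε2
        linarith
      have h5 : 1 - ‖E.eval u‖ ≤ ‖E.eval u - 1‖ := by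
        have := norm_sub_norm_le 1 (E.eval u)
        rw [norm_one, norm_sub_rev] at this
        exact this
      have h6 : R * ((‖E.eval u‖ / η + ε * (1 + R / η)) * M) =
        ‖E.eval u‖ * (R * M / η) + R * (ε * (1 + R / η) * M) := by ring
      rw [div_le_iff₀ hm0]
      linarith
    have hEw : ‖E.eval w‖ ≤ B := by
      have := harnack_aux (E := fun u => E.eval u) E.differentiable hR0 (by positivity)
        (by
          rw [div_lt_one hm0]
          have : 0 < R * M / η := by positivity
          linarith) hE1 hlow hw
      rwa [one_div_one_div] at this
    have h2 := core_ineq hM1 hM hε.le hη0 (him w hw) hE1 hE hP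
    have h3 : ‖P.eval w‖ ≤ ‖P.eval z * E.eval w‖ + ‖P.eval z * E.eval w - P.eval w‖ := by
      have := norm_sub_le (P.eval z * E.eval w) (P.eval z * E.eval w - P.eval w)
      simpa using this
    rw [norm_mul] at h3
    have h4 : ‖P.eval z‖ * ‖E.eval w‖ ≤ M * B := by
      gcongr
      exact hM P hP
    have h5 : r * ((‖E.eval w‖ / η + ε * ‖P.eval w‖ * (1 + r / η)) * M) ≤
       r * ((B / η + ε * ‖P.eval w‖ * (1 + r / η)) * M) := by gcongr
    have h6 : r * ((B / η + ε * ‖P.eval w‖ * (1 + r / η)) * M) =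
      M * (r / η) * B + ε * (r * ‖P.eval w‖ * (1 + r / η) * M) := by ring
    linarith
  set K := r * ‖P.eval w‖ * (1 + r / η) * M with hK
  have hK0 : 0 ≤ K := by positivity
  apply le_of_forall_pos_le_add
  intro δ hδ
  set ε := min (δ / (K + 1)) (1 / (2 * (R * ((1 + R / η) * M)))) with hεd
  have h1 := key ε (by positivity) (min_le_right _ _)
  have h2 : ε * K ≤ δ := by
    calc ε * K ≤ δ / (K + 1) * K := by gcongr; exact min_le_left _ _
      _ ≤ δ := by rw [div_mul_eq_mul_div, div_le_iff₀ (by positivity)]; nlinarith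
  linarith

def Fin' (W : ℝ → ℝ≥0∞) (z : ℂ) : Prop := ∃ M : ℝ, 1 ≤ M ∧ ∀ P ∈ XW W, ‖P.eval z‖ ≤ M

lemma hop_fin {W : ℝ → ℝ≥0∞} (hW : IsWeight W) (hd : ∀ f, MemCW W f → Apx W f) {z w : ℂ}
    (hz : Fin' W z) (hw : ‖w - z‖ < z.im) : Fin' W w := by
  obtain ⟨M, hM1, hM⟩ := hz
  obtain ⟨R, hR1, hR2⟩ := exists_between hw
  refine ⟨max 1 _, le_max_left _ _, fun P hP => le_max_of_le_right (hop hW hd hM1 hM hR2 hR1 hP)⟩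

lemma fin_conj {W : ℝ → ℝ≥0∞} {z : ℂ} (hz : Fin' W z) : Fin' W ((starRingEnd ℂ) z) := by
  obtain ⟨M, hM1, hM⟩ := hz
  refine ⟨M, hM1, fun P hP => ?_⟩
  have := hM _ (conj_mem_XW hP)
  rwa [eval_conj_map, RCLike.norm_conj] at this

lemma fin_all {W : ℝ → ℝ≥0∞} (hW : IsWeight W) (hd : ∀ f, MemCW W f → Apx W f) {z w : ℂ}
    (hz : Fin' W z) (hz0 : 0 < z.im) (hw : 0 < w.im) : Fin' W w := by
  have hpc : IsPreconnected {u : ℂ | 0 < u.im} := (convex_halfSpace_im_gt 0).isPreconnected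
  by_contra hcon
  -- hop criterion is locally symmetric
  have hloc : ∀ u v : ℂ, 0 < u.im → ‖v - u‖ < u.im / 2 → (Fin' W u ↔ Fin' W v) := by
    intro u v hu huv
    have h1 := abs_im_le_norm (v - u)
    rw [sub_im] at h1
    have h2 := (abs_le.1 (h1.trans huv.le)).1
    constructor
    · intro h
      exact hop_fin hW hd h (by linarith)
    · intro h
      refine hop_fin hW hd h ?_
      rw [norm_sub_rev]
      linarith
  have hopen : ∀ (p : ℂ → Prop), (∀ u v : ℂ, 0 < u.im → ‖v - u‖ < u.im / 2 → p u → p v) →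
      IsOpen {u : ℂ | 0 < u.im ∧ p u} := by
    intro p hp
    rw [Metric.isOpen_iff]
    rintro u ⟨hu, hpu⟩
    refine ⟨u.im / 2, by positivity, fun v hv => ?_⟩
    rw [mem_ball_iff_norm] at hv
    have h1 := abs_im_le_norm (v - u)
    rw [sub_im] at h1
    have h2 := (abs_le.1 (h1.trans hv.le)).1
    exact ⟨by linarith, hp u v hu hv hpu⟩
  obtain ⟨u, -, hu1, hu2⟩ := hpc _ _ (hopen (Fin' W) fun u v hu huv => (hloc u v hu huv).1)
    (hopen (fun u => ¬ Fin' W u) fun u v hu huv h => fun h' => h ((hloc u v hu huv).2 h'))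
    (by
      intro u hu
      by_cases h : Fin' W u
      · exact Or.inl ⟨hu, h⟩
      · exact Or.inr ⟨hu, h⟩) ⟨z, hz0, hz0, hz⟩ ⟨w, hw, hw, hcon⟩
  exact hu2.2 hu1.2

lemma edge_bound {W : ℝ → ℝ≥0∞} (hW : IsWeight W) (hd : ∀ f, MemCW W f → Apx W f) (b : ℝ)
    (hb : Fin' W ⟨b, 5⟩) : ∃ C : ℝ, 0 < C ∧ ∀ P ∈ XW W, ∀ u v : ℝ, 0 < v → v ≤ 1 → |u| = 2 * v →
      ‖P.eval ⟨b + u, v⟩‖ ≤ Real.exp (C / v ^ 2) := by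
  obtain ⟨M, hM1, hM⟩ := hb
  refine ⟨1701 * M, by positivity, fun P hP u v hv hv1 hu => ?_⟩
  have hM0 : 0 < M := by linarith
  set w : ℂ := ⟨b + u, v⟩ with hw
  set z : ℂ := ⟨b, 5⟩ with hz
  have hr : ‖w - z‖ ≤ 5 - v / 2 := by
    refine (sq_le_sq₀ (norm_nonneg _) (by linarith)).1 ?_
    rw [← Complex.normSq_eq_norm_sq, Complex.normSq_apply]
    have hu2 : u ^ 2 = 4 * v ^ 2 := by rw [← sq_abs, hu]; ring
    simp [hw, hz]
    nlinarith
  have h := hop hW hd (R := 5 - v / 4) (w := w) hM1 hM (by simp [hz]; linarith) (by linarith) hP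
  have hzim : z.im - (5 - v / 4) = v / 4 := by simp [hz]
  rw [hzim] at h
  set r := ‖w - z‖ with hrdef
  have hr0 : 0 ≤ r := norm_nonneg _
  have hv2 : 1 ≤ 1 / v := by rw [le_div_iff₀ hv]; linarith
  have hlog : Real.log (2 * (1 + (5 - v / 4) * M / (v / 4))) ≤ 42 * M / v := by
    refine (Real.log_le_self ?_).trans ?_
    · have : 0 ≤ 5 - v / 4 := by linarith
      positivity
    · have h1 : (5 - v / 4) * M / (v / 4) ≤ 20 * M / v := by
        rw [div_le_div_iff₀ (by positivity) hv]
        have : 0 < M * v := by positivity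
        nlinarith
      have h2 : 1 ≤ M / v := by rw [le_div_iff₀ hv]; linarith
      have h3 : 42 * M / v = 2 * (M / v) + 2 * (20 * M / v) := by ring
      linarith
  have hlog0 : 0 ≤ Real.log (2 * (1 + (5 - v / 4) * M / (v / 4))) := by
    apply Real.log_nonneg
    have : 0 ≤ 5 - v / 4 := by linarith
    have : 0 ≤ (5 - v / 4) * M / (v / 4) := by positivity
    linarith
  have hexp : 2 * Real.log (2 * (1 + (5 - v / 4) * M / (v / 4))) * r / (5 - v / 4 - r)
      ≤ 1680 * M / v ^ 2 := by
    calc _ ≤ 2 * (42 * M / v) * 5 / (v / 4) := by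
          gcongr
          · linarith
          · linarith
      _ = _ := by field_simp; norm_num
  have hpre : M * (1 + r / (v / 4)) ≤ Real.exp (21 * M / v ^ 2) := by
    have h1 : r / (v / 4) ≤ 20 / v := by
      rw [div_le_div_iff₀ (by positivity) hv]
      nlinarith
    have h2 : 1 + r / (v / 4) ≤ 21 / v ^ 2 := by
      have h3 : 1 + 20 / v ≤ 21 / v ^ 2 := by
        rw [le_div_iff₀ (by positivity)]
        have : (1 + 20 / v) * v ^ 2 = v ^ 2 + 20 * v := by field_simp
        nlinarith
      linarith
    calc _ ≤ M * (21 / v ^ 2) := by gcongr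
      _ = 21 * M / v ^ 2 := by ring
      _ ≤ 21 * M / v ^ 2 + 1 := by linarith
      _ ≤ _ := Real.add_one_le_exp _
  calc _ ≤ _ := h
    _ ≤ Real.exp (21 * M / v ^ 2) * Real.exp (1680 * M / v ^ 2) := by gcongr
    _ = _ := by rw [← Real.exp_add]; congr 1; ring

noncomputable def phi (K : ℝ) (ζ : ℂ) : ℂ := if ζ = 0 then 0 else exp (-(K / ζ ^ 2))

lemma re_div_sq (K : ℝ) (ζ : ℂ) :
    ((K : ℂ) / ζ ^ 2).re = K * (ζ.re ^ 2 - ζ.im ^ 2) / (‖ζ‖ ^ 2) ^ 2 := by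
  rw [Complex.div_re, ← Complex.normSq_eq_norm_sq]
  simp only [map_pow, ofReal_re, ofReal_im, zero_mul, zero_div, add_zero]
  have : (ζ ^ 2).re = ζ.re ^ 2 - ζ.im ^ 2 := by
    rw [sq ζ]; simp; ring
  rw [this]

lemma norm_phi_le {K : ℝ} (hK : 0 < K) {ζ : ℂ} (h : ζ ≠ 0) (hc : 2 * |ζ.im| ≤ |ζ.re|) :
    ‖phi K ζ‖ ≤ Real.exp (-(3 * K / 5 / ‖ζ‖ ^ 2)) := by
  rw [phi, if_neg h, norm_exp, neg_re, re_div_sq K ζ]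
  apply Real.exp_le_exp.2
  apply neg_le_neg
  have hn : 0 < ‖ζ‖ ^ 2 := by positivity
  rw [div_le_div_iff₀ hn (by positivity)]
  have h1 : ‖ζ‖ ^ 2 = ζ.re ^ 2 + ζ.im ^ 2 := by
    rw [← Complex.normSq_eq_norm_sq, Complex.normSq_apply]; ring
  have h2 : 4 * ζ.im ^ 2 ≤ ζ.re ^ 2 := by
    rw [← sq_abs ζ.im, ← sq_abs ζ.re]
    nlinarith [abs_nonneg ζ.im]
  have h3 : 3 / 5 * ‖ζ‖ ^ 2 ≤ ζ.re ^ 2 - ζ.im ^ 2 := by rw [h1]; linarith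
  calc 3 * K / 5 * (‖ζ‖ ^ 2) ^ 2 = K * (3 / 5 * ‖ζ‖ ^ 2) * ‖ζ‖ ^ 2 := by ring
    _ ≤ _ := by gcongr

lemma norm_phi_le_one {K : ℝ} (hK : 0 < K) {ζ : ℂ} (hc : 2 * |ζ.im| ≤ |ζ.re|) :
    ‖phi K ζ‖ ≤ 1 := by
  by_cases h : ζ = 0
  · simp [phi, h]
  · refine (norm_phi_le hK h hc).trans ?_
    rw [Real.exp_le_one_iff, neg_nonpos]
    positivity

lemma phi_diff (K : ℝ) {ζ : ℂ} (h : ζ ≠ 0) : DifferentiableAt ℂ (phi K) ζ := by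
  have h1 : DifferentiableAt ℂ (fun ζ : ℂ => exp (-((K : ℂ) / ζ ^ 2))) ζ := by
    have : ζ ^ 2 ≠ 0 := pow_ne_zero _ h
    fun_prop (disch := assumption)
  refine h1.congr_of_eventuallyEq ?_
  filter_upwards [isOpen_ne.mem_nhds h] with u hu
  simp only [phi]
  rw [if_neg hu]

lemma phi_cont {K : ℝ} (hK : 0 < K) : ContinuousOn (phi K) {ζ | 2 * |ζ.im| ≤ |ζ.re|} := by
  intro ζ hζ
  by_cases h : ζ = 0
  · subst h
    rw [ContinuousWithinAt]
    have h0 : phi K 0 = 0 := by simp [phi]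
    rw [h0]
    -- crude bound : exp (-(a / t)) ≤ t / a
    refine squeeze_zero_norm' (a := fun ζ : ℂ => ‖ζ‖ ^ 2 / (3 * K / 5)) ?_ ?_
    · filter_upwards [self_mem_nhdsWithin] with u hu
      by_cases hu0 : u = 0
      · simp [hu0, phi]
      refine (norm_phi_le hK hu0 hu).trans ?_
      have hn : 0 < ‖u‖ ^ 2 := by positivity
      rw [Real.exp_neg, ← inv_div (3 * K / 5)]
      apply inv_anti₀ (by positivity)
      have := Real.add_one_le_exp (3 * K / 5 / ‖u‖ ^ 2)
      linarith
    · have : Continuous (fun ζ : ℂ => ‖ζ‖ ^ 2 / (3 * K / 5)) := by fun_prop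
      have := this.tendsto 0
      simp only [norm_zero, ne_eq, OfNat.ofNat_ne_zero, not_false_eq_true, zero_pow, zero_div] at this
      exact this.mono_left nhdsWithin_le_nhds
  · exact (phi_diff K h).continuousAt.continuousWithinAt

lemma diamond {x₀ C : ℝ} (hC : 0 < C) {P : Polynomial ℂ}
    (hP : ∀ z : ℂ, |z.re - x₀| + 2 * |z.im| = 2 → z.im ≠ 0 → ‖P.eval z‖ ≤ Real.exp (C / z.im ^ 2))
    {z : ℂ} (hz : ‖z - x₀‖ ≤ 1 / 2) : ‖P.eval z‖ ≤ Real.exp (2 * (25 * C / 3)) := by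
  set K := 25 * C / 3 with hKd
  have hK : 0 < K := by positivity
  set a : ℂ := ((x₀ - 2 : ℝ) : ℂ) with ha
  set b : ℂ := ((x₀ + 2 : ℝ) : ℂ) with hb
  set U : Set ℂ := {z | |z.re - x₀| + 2 * |z.im| < 2} with hU
  have hcont : Continuous (fun z : ℂ => |z.re - x₀| + 2 * |z.im|) := by fun_prop
  have hUo : IsOpen U := isOpen_lt hcont continuous_const
  have hcl : closure U ⊆ {z | |z.re - x₀| + 2 * |z.im| ≤ 2} :=
    closure_minimal (fun z hz => by
      simp only [hU, mem_ofPred_eq] at hz ⊢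
      exact hz.le) (isClosed_le hcont continuous_const)
  have hfr : frontier U ⊆ {z | |z.re - x₀| + 2 * |z.im| = 2} := by
    intro z hz
    have h1 := hcl hz.1
    have h2 : z ∉ U := by rw [← hUo.interior_eq]; exact hz.2
    simp only [hU, mem_ofPred_eq, not_lt] at h1 h2
    exact le_antisymm h1 h2
  have hconea : ∀ z : ℂ, |z.re - x₀| + 2 * |z.im| ≤ 2 → 2 * |(z - a).im| ≤ |(z - a).re| := by
    intro z hz
    simp only [ha, sub_im, ofReal_im, sub_zero, sub_re, ofReal_re]
    have := neg_abs_le (z.re - x₀)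
    refine le_trans ?_ (le_abs_self _)
    linarith
  have hconeb : ∀ z : ℂ, |z.re - x₀| + 2 * |z.im| ≤ 2 → 2 * |(z - b).im| ≤ |(z - b).re| := by
    intro z hz
    simp only [hb, sub_im, ofReal_im, sub_zero, sub_re, ofReal_re]
    have := le_abs_self (z.re - x₀)
    refine le_trans ?_ (neg_le_abs _)
    linarith
  have hUa : ∀ z ∈ U, z - a ≠ 0 := by
    intro z hz h
    have : z = a := sub_eq_zero.1 h
    simp [this, hU, ha] at hz
  have hUb : ∀ z ∈ U, z - b ≠ 0 := by
    intro z hz h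
    have : z = b := sub_eq_zero.1 h
    simp [this, hU, hb] at hz
  set G : ℂ → ℂ := fun z => P.eval z * (phi K (z - a) * phi K (z - b)) with hG
  have hGd : DiffContOnCl ℂ G U := by
    constructor
    · intro z hz
      apply DifferentiableAt.differentiableWithinAt
      apply P.differentiableAt.mul
      apply DifferentiableAt.mul
      · exact DifferentiableAt.comp (g := phi K) (f := fun z => z - a) z (phi_diff K (hUa z hz)) (by fun_prop)
      · exact DifferentiableAt.comp (g := phi K) (f := fun z => z - b) z (phi_diff K (hUb z hz)) (by fun_prop)
    · apply P.continuous.continuousOn.mul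
      apply ContinuousOn.mul
      · exact (phi_cont hK).comp (by fun_prop) (fun z hz => hconea z (hcl hz))
      · exact (phi_cont hK).comp (by fun_prop) (fun z hz => hconeb z (hcl hz))
  have hUb' : Bornology.IsBounded U := by
    refine (Metric.isBounded_ball (x := (x₀ : ℂ)) (r := 4)).subset fun z hz => ?_
    rw [mem_ball_iff_norm]
    have h1 := norm_le_abs_re_add_abs_im (z - x₀)
    simp only [sub_re, ofReal_re, sub_im, ofReal_im, sub_zero] at h1
    have : |z.re - x₀| + 2 * |z.im| < 2 := hz
    linarith [abs_nonneg z.im]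
  have hedge : ∀ z : ℂ, z.im ≠ 0 → ∀ p : ℂ, p.im = 0 → |(z - p).re| = 2 * |z.im| → 
      ‖P.eval z‖ ≤ Real.exp (C / z.im ^ 2) → ‖P.eval z‖ * ‖phi K (z - p)‖ ≤ 1 := by
    intro z hz p hp hzp hPz
    have him : (z - p).im = z.im := by simp [hp]
    have hne : z - p ≠ 0 := by
      intro h; rw [h] at him; simp at him; exact hz him.symm
    have h1 := norm_phi_le hK hne (by rw [him, hzp])
    have h2 : ‖z - p‖ ^ 2 = 5 * z.im ^ 2 := by
      rw [← Complex.normSq_eq_norm_sq, Complex.normSq_apply, him, ← sq, ← sq_abs, hzp, mul_pow,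
        sq_abs]; ring
    rw [h2] at h1
    have h3 : 3 * K / 5 / (5 * z.im ^ 2) = C / z.im ^ 2 := by rw [hKd]; field_simp; norm_num
    rw [h3] at h1
    calc _ ≤ Real.exp (C / z.im ^ 2) * Real.exp (-(C / z.im ^ 2)) := by gcongr
      _ = 1 := by rw [← Real.exp_add]; simp
  have hGfr : ∀ z ∈ frontier U, ‖G z‖ ≤ 1 := by
    intro z hz
    have hz2 := hfr hz
    simp only [mem_ofPred_eq] at hz2
    have ca := norm_phi_le_one hK (hconea z hz2.le)
    have cb := norm_phi_le_one hK (hconeb z hz2.le)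
    simp only [hG, norm_mul]
    by_cases him : z.im = 0
    · rw [him] at hz2
      simp only [abs_zero, mul_zero, add_zero] at hz2
      rcases (abs_eq (by norm_num)).1 hz2 with h | h
      · have : z - b = 0 := by
          apply Complex.ext
          · simp [hb]; linarith
          · simp [hb, him]
        simp [this, phi]
      · have : z - a = 0 := by
          apply Complex.ext
          · simp [ha]; linarith
          · simp [ha, him]
        simp [this, phi]
    · have hPz := hP z hz2 him
      rcases le_total 0 (z.re - x₀) with h | h
      · have h5 : |(z - b).re| = 2 * |z.im| := by
          rw [abs_of_nonneg h] at hz2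
          have : (z - b).re = - (2 * |z.im|) := by simp [hb]; linarith
          rw [this, abs_neg, abs_of_nonneg (by positivity)]
        have := hedge z him b (by simp [hb]) h5 hPz
        calc _ = (‖P.eval z‖ * ‖phi K (z - b)‖) * ‖phi K (z - a)‖ := by ring
          _ ≤ 1 * 1 := by gcongr
          _ = 1 := by norm_num
      · have h5 : |(z - a).re| = 2 * |z.im| := by
          rw [abs_of_nonpos h] at hz2
          have : (z - a).re = (2 * |z.im|) := by simp [ha]; linarith
          rw [this, abs_of_nonneg (by positivity)]
        have := hedge z him a (by simp [ha]) h5 hPz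
        calc _ = (‖P.eval z‖ * ‖phi K (z - a)‖) * ‖phi K (z - b)‖ := by ring
          _ ≤ 1 * 1 := by gcongr
          _ = 1 := by norm_num
  have h1 : |z.re - x₀| ≤ 1 / 2 := by
    have := (abs_re_le_norm (z - x₀)).trans hz
    simpa using this
  have h2 : |z.im| ≤ 1 / 2 := by
    have := (abs_im_le_norm (z - x₀)).trans hz
    simpa using this
  have hzU : z ∈ U := by
    simp only [hU, mem_ofPred_eq]; linarith
  have hfin := norm_le_of_forall_mem_frontier_norm_le hUb' hGd hGfr (subset_closure hzU)
  have hlow : ∀ p : ℂ, 1 ≤ ‖z - p‖ → Real.exp (-K) ≤ ‖phi K (z - p)‖ := by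
    intro p hp
    have hne : z - p ≠ 0 := by intro h; rw [h, norm_zero] at hp; linarith
    rw [phi, if_neg hne, norm_exp, neg_re]
    apply Real.exp_le_exp.2
    apply neg_le_neg
    refine (re_le_norm _).trans ?_
    rw [norm_div, norm_pow, norm_real, Real.norm_of_nonneg hK.le]
    apply div_le_self hK.le
    nlinarith
  have hza : 1 ≤ ‖z - a‖ := by
    refine le_trans ?_ (abs_re_le_norm _)
    refine le_trans ?_ (le_abs_self _)
    have := (abs_le.1 h1).1
    simp [ha]; linarith
  have hzb : 1 ≤ ‖z - b‖ := by
    refine le_trans ?_ (abs_re_le_norm _)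
    refine le_trans ?_ (neg_le_abs _)
    have := (abs_le.1 h1).2
    simp [hb]; linarith
  have l1 := hlow a hza
  have l2 := hlow b hzb
  simp only [hG, norm_mul] at hfin
  have l3 : ‖P.eval z‖ * (Real.exp (-K) * Real.exp (-K)) ≤ 1 := by
    refine le_trans ?_ hfin
    gcongr
  rw [← Real.exp_add] at l3
  have l4 : Real.exp (2 * K) = (Real.exp (-K + -K))⁻¹ := by rw [← Real.exp_neg]; congr 1; ring
  rw [l4, ← one_div, le_div_iff₀ (Real.exp_pos _)]
  exact l3

lemma local_bdd {W : ℝ → ℝ≥0∞} (hW : IsWeight W) (hd : ∀ f, MemCW W f → Apx W f) {z : ℂ}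
    (hz : Fin' W z) (hz0 : z.im ≠ 0) (x₀ : ℝ) :
    ∃ B : ℝ, 0 < B ∧ ∀ P ∈ XW W, ∀ u : ℂ, ‖u - x₀‖ ≤ 1 / 2 → ‖P.eval u‖ ≤ B := by
  have hall : ∀ w : ℂ, 0 < w.im → Fin' W w := by
    intro w hw
    rcases lt_or_gt_of_ne hz0 with h | h
    · exact fin_all hW hd (fin_conj hz) (by simpa using h) hw
    · exact fin_all hW hd hz h hw
  obtain ⟨C1, hC1, h1⟩ := edge_bound hW hd (x₀ - 2) (hall _ (by norm_num))
  obtain ⟨C2, hC2, h2⟩ := edge_bound hW hd (x₀ + 2) (hall _ (by norm_num))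
  have hC : 0 < max C1 C2 := lt_max_of_lt_left hC1
  refine ⟨Real.exp (2 * (25 * (max C1 C2) / 3)), Real.exp_pos _, fun P hP u hu => ?_⟩
  refine diamond hC ?_ hu
  have hup : ∀ Q ∈ XW W, ∀ z : ℂ, |z.re - x₀| + 2 * |z.im| = 2 → 0 < z.im →
      ‖Q.eval z‖ ≤ Real.exp (max C1 C2 / z.im ^ 2) := by
    intro Q hQ z hz him
    rw [abs_of_pos him] at hz
    have him1 : z.im ≤ 1 := by linarith [abs_nonneg (z.re - x₀)]
    rcases le_total 0 (z.re - x₀) with h | h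
    · rw [abs_of_nonneg h] at hz
      have := h2 Q hQ (z.re - x₀ - 2) z.im him him1 (by
        rw [abs_of_nonpos (by linarith)]; linarith)
      rw [show (⟨x₀ + 2 + (z.re - x₀ - 2), z.im⟩ : ℂ) = z from by
        apply Complex.ext <;> simp] at this
      refine this.trans ?_
      gcongr
      exact le_max_right _ _
    · rw [abs_of_nonpos h] at hz
      have := h1 Q hQ (z.re - x₀ + 2) z.im him him1 (by
        rw [abs_of_nonneg (by linarith)]; linarith)
      rw [show (⟨x₀ - 2 + (z.re - x₀ + 2), z.im⟩ : ℂ) = z from by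
        apply Complex.ext <;> simp] at this
      refine this.trans ?_
      gcongr
      exact le_max_left _ _
  intro z hz him
  rcases lt_or_gt_of_ne him with h | h
  · have := hup _ (conj_mem_XW hP) ((starRingEnd ℂ) z) (by simpa using hz) (by simpa using h)
    rw [eval_conj_map, RCLike.norm_conj, Complex.conj_conj] at this
    simpa using this
  · exact hup P hP z hz h

lemma not_fin {W : ℝ → ℝ≥0∞} (hW : IsWeight W) (hd : ∀ f, MemCW W f → Apx W f) {z : ℂ}
    (hz0 : z.im ≠ 0) : ¬ Fin' W z := by
  intro hz
  obtain ⟨x₀, hx₀⟩ := hW.2.2.2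
  obtain ⟨B, hB, hbd⟩ := local_bdd hW hd hz hz0 x₀
  set f : ℝ → ℂ := fun x => ((min (Real.sqrt |x - x₀|) 1 : ℝ) : ℂ) with hf
  have hfc : Continuous f := by fun_prop
  have hf1 : ∀ x, ‖f x‖ ≤ 1 := by
    intro x
    simp only [hf, norm_real]
    rw [Real.norm_of_nonneg (by positivity)]
    exact min_le_right _ _
  have hfm := memCW_bdd hW hfc hf1
  -- Lipschitz estimate
  have hLip : ∀ x y : ℝ, W x ≠ ⊤ → W y ≠ ⊤ → |x - x₀| < 1 / 4 → |y - x₀| < 1 / 4 →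
      ‖f x - f y‖ ≤ 8 * B * |x - y| := by
    intro x y hx hy hx4 hy4
    apply le_of_forall_pos_le_add
    intro δ hδ
    have hw : 0 < (W x).toReal + (W y).toReal + 1 := by positivity
    set ε := min 1 (δ / ((W x).toReal + (W y).toReal + 1)) with hε
    have hε0 : 0 < ε := by positivity
    obtain ⟨Q, hQ⟩ := hd f hfm ε hε0
    have hQb : ∀ u : ℂ, ‖u - x₀‖ ≤ 1 / 2 → ‖Q.eval u‖ ≤ 2 * B := by
      intro u hu
      have hmem : ∀ P ∈ XW W, ‖P.eval u‖ ≤ B + 1 := fun P hP => by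
        linarith [hbd P hP u hu]
      have hmem2 : Polynomial.C (2⁻¹ : ℂ) * Q ∈ XW W := by
        rw [mem_XW_iff]
        intro t ht
        have h1 := hQ t ht
        have h2 := one_le_toReal hW ht
        have h3 := hf1 t
        have h4 : ‖Q.eval (t : ℂ)‖ ≤ ‖f t‖ + ‖f t - Q.eval (t : ℂ)‖ := by
          have := norm_sub_le (f t) (f t - Q.eval (t : ℂ))
          simpa using this
        have h5 : ε ≤ 1 := min_le_left _ _
        have h6 : ε * (W t).toReal ≤ 1 * (W t).toReal := by gcongr
        simp only [Polynomial.eval_mul, Polynomial.eval_C, norm_mul, norm_inv, norm_ofNat]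
        linarith
      have := hbd _ hmem2 u hu
      simp only [Polynomial.eval_mul, Polynomial.eval_C, norm_mul, norm_inv, norm_ofNat] at this
      linarith
    have hder : ∀ u ∈ Metric.ball (x₀ : ℂ) (1 / 4), ‖deriv (fun u => Q.eval u) u‖ ≤ 8 * B := by
      intro u hu
      rw [mem_ball_iff_norm] at hu
      have := norm_deriv_le_of_forall_mem_sphere_norm_le (c := u) (R := 1 / 4) (C := 2 * B)
        (f := fun u => Q.eval u) (by norm_num) (Q.differentiable.diffContOnCl) (by
          intro v hv
          rw [mem_sphere_iff_norm] at hv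
          apply hQb
          have : ‖v - x₀‖ ≤ ‖v - u‖ + ‖u - x₀‖ := by
            simpa using norm_add_le (v - u) (u - x₀)
          linarith)
      linarith
    have hb : ∀ t : ℝ, |t - x₀| < 1 / 4 → (t : ℂ) ∈ Metric.ball (x₀ : ℂ) (1 / 4) := by
      intro t ht
      rw [mem_ball_iff_norm, ← ofReal_sub, norm_real]
      exact ht
    have hmv := (convex_ball (x₀ : ℂ) (1 / 4)).norm_image_sub_le_of_norm_deriv_le (𝕜 := ℂ)
      (f := fun u => Q.eval u) (fun u _ => Q.differentiableAt) hder (hb y hy4) (hb x hx4)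
    rw [← ofReal_sub, norm_real, Real.norm_eq_abs] at hmv
    have e1 := hQ x hx
    have e2 := hQ y hy
    have e3 : ‖f x - f y‖ ≤ ‖f x - Q.eval (x : ℂ)‖ + ‖Q.eval (x : ℂ) - Q.eval (y : ℂ)‖
        + ‖f y - Q.eval (y : ℂ)‖ := by
      have : f x - f y = (f x - Q.eval (x : ℂ)) + (Q.eval (x : ℂ) - Q.eval (y : ℂ))
        - (f y - Q.eval (y : ℂ)) := by ring
      rw [this]
      exact (norm_sub_le _ _).trans (by gcongr; exact norm_add_le _ _)
    have e4 : ε * ((W x).toReal + (W y).toReal) ≤ δ := by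
      calc _ ≤ δ / ((W x).toReal + (W y).toReal + 1) * ((W x).toReal + (W y).toReal + 1) := by
            refine mul_le_mul (min_le_right _ _) (by linarith) (by positivity) (by positivity)
        _ = δ := by field_simp
    linarith
  -- choose points
  have hpts : ∀ r : ℝ, 0 < r → ∃ y : ℝ, W y ≠ ⊤ ∧ y ≠ x₀ ∧ |y - x₀| < r := by
    intro r hr
    rw [accPt_iff_nhds] at hx₀
    obtain ⟨y, ⟨hy1, hy2⟩, hy3⟩ := hx₀ _ (Metric.ball_mem_nhds x₀ hr)
    exact ⟨y, hy2, hy3, by simpa [Real.dist_eq] using hy1⟩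
  -- limit estimate
  have hlim : ∀ x : ℝ, W x ≠ ⊤ → |x - x₀| < 1 / 4 → ‖f x - f x₀‖ ≤ 8 * B * |x - x₀| := by
    intro x hx hx4
    apply le_of_forall_pos_le_add
    intro δ hδ
    have hc : Continuous (fun y : ℝ => 8 * B * |x - y| + ‖f y - f x₀‖) := by fun_prop
    have hev := (hc.tendsto x₀).eventually_lt_const (u := 8 * B * |x - x₀| + δ) (by simp [hδ])
    obtain ⟨r, hr, hr2⟩ := Metric.eventually_nhds_iff.1 hev
    obtain ⟨y, hy1, -, hy3⟩ := hpts (min r (1 / 4)) (by positivity)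
    have h1 := hLip x y hx hy1 hx4 (hy3.trans_le (min_le_right _ _))
    have h2 := hr2 (y := y) (by rw [Real.dist_eq]; exact hy3.trans_le (min_le_left _ _))
    have h3 : ‖f x - f x₀‖ ≤ ‖f x - f y‖ + ‖f y - f x₀‖ := by
      simpa using norm_add_le (f x - f y) (f y - f x₀)
    linarith
  obtain ⟨x, hx1, hx2, hx3⟩ := hpts (min (1 / 4) (1 / (8 * B) ^ 2)) (by positivity)
  have hx4 : |x - x₀| < 1 / 4 := hx3.trans_le (min_le_left _ _)
  have hx5 : |x - x₀| < 1 / (8 * B) ^ 2 := hx3.trans_le (min_le_right _ _)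
  have h1 := hlim x hx1 hx4
  set t := |x - x₀| with ht
  have ht0 : 0 < t := abs_pos.2 (sub_ne_zero.2 hx2)
  have hs0 : 0 < Real.sqrt t := Real.sqrt_pos.2 ht0
  have hs1 : Real.sqrt t ≤ 1 := by
    rw [Real.sqrt_le_left (by norm_num)]; linarith
  have h2 : ‖f x - f x₀‖ = Real.sqrt t := by
    simp only [hf, ← ht, sub_self, abs_zero, Real.sqrt_zero]
    rw [min_eq_left hs1, min_eq_left (by norm_num), ofReal_zero, sub_zero, norm_real,
      Real.norm_of_nonneg hs0.le]
  rw [h2] at h1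
  have h3 : Real.sqrt t * Real.sqrt t = t := Real.mul_self_sqrt ht0.le
  have h4 : 1 ≤ 8 * B * Real.sqrt t := by
    have h5 : Real.sqrt t ≤ 8 * B * Real.sqrt t * Real.sqrt t := by
      rw [mul_assoc, h3]; exact h1
    by_contra hcon
    push Not at hcon
    nlinarith
  rw [lt_div_iff₀ (by positivity)] at hx5
  nlinarith

lemma apx_closed {W : ℝ → ℝ≥0∞} {f : ℝ → ℂ}
    (hfg : ∀ ε : ℝ, 0 < ε → ∃ g', Apx W g' ∧ ∀ x, W x ≠ ⊤ → ‖f x - g' x‖ ≤ ε * (W x).toReal) :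
    Apx W f := by
  intro ε hε
  obtain ⟨g', hg', hfg'⟩ := hfg (ε / 2) (by positivity)
  obtain ⟨P, hP⟩ := hg' (ε / 2) (by positivity)
  refine ⟨P, fun x hx => ?_⟩
  have h1 := hfg' x hx
  have h2 := hP x hx
  have h3 : ‖f x - P.eval (x : ℂ)‖ ≤ ‖f x - g' x‖ + ‖g' x - P.eval (x : ℂ)‖ := by
    simpa using norm_add_le (f x - g' x) (g' x - P.eval (x : ℂ))
  linarith

lemma apx_poly {W : ℝ → ℝ≥0∞} (P : Polynomial ℂ) : Apx W (fun x => P.eval (x : ℂ)) := by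
  intro ε hε
  refine ⟨P, fun x hx => ?_⟩
  simp only [sub_self, norm_zero]
  positivity

lemma apx_add {W : ℝ → ℝ≥0∞} {f g : ℝ → ℂ} (hf : Apx W f) (hg : Apx W g) :
    Apx W (fun x => f x + g x) := by
  intro ε hε
  obtain ⟨P, hP⟩ := hf (ε / 2) (by positivity)
  obtain ⟨Q, hQ⟩ := hg (ε / 2) (by positivity)
  refine ⟨P + Q, fun x hx => ?_⟩
  have h1 := hP x hx
  have h2 := hQ x hx
  rw [Polynomial.eval_add, add_sub_add_comm]
  refine (norm_add_le _ _).trans ?_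
  linarith

lemma apx_smul {W : ℝ → ℝ≥0∞} {f : ℝ → ℂ} (hf : Apx W f) (c : ℂ) :
    Apx W (fun x => c * f x) := by
  intro ε hε
  obtain ⟨P, hP⟩ := hf (ε / (‖c‖ + 1)) (by positivity)
  refine ⟨Polynomial.C c * P, fun x hx => ?_⟩
  have h1 := hP x hx
  rw [Polynomial.eval_mul, Polynomial.eval_C, ← mul_sub, norm_mul]
  calc _ ≤ (‖c‖ + 1) * (ε / (‖c‖ + 1) * (W x).toReal) := by gcongr; linarith
    _ = _ := by field_simp

lemma apx_r {W : ℝ → ℝ≥0∞} {z : ℂ} (hz0 : z.im ≠ 0) (hz : ¬ Fin' W z) :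
    Apx W (fun x => ((x : ℂ) - z)⁻¹) := by
  intro ε hε
  have him : 0 < |z.im| := abs_pos.2 hz0
  simp only [Fin', not_exists, not_and, not_forall, not_le] at hz
  obtain ⟨P, hP, hPz⟩ := hz (max 1 (1 / (|z.im| * ε))) (le_max_left _ _)
  have hPz1 := (le_max_left _ _).trans_lt hPz
  have hPz2 := (le_max_right _ _).trans_lt hPz
  rw [mem_XW_iff] at hP
  obtain ⟨S, hS⟩ := exists_divX (P - Polynomial.C (P.eval z)) z (by simp)
  simp only [Polynomial.eval_sub, Polynomial.eval_C] at hS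
  refine ⟨Polynomial.C (-(P.eval z)⁻¹) * S, fun x hx => ?_⟩
  have hxz := abs_im_le_norm_sub x z
  have hne : (x : ℂ) - z ≠ 0 := by
    intro h; rw [h, norm_zero] at hxz; linarith
  have hne2 : P.eval z ≠ 0 := by intro h; rw [h, norm_zero] at hPz1; linarith
  have h1 := hS x
  have h2 : ((x : ℂ) - z)⁻¹ - (Polynomial.C (-(P.eval z)⁻¹) * S).eval (x : ℂ) =
      P.eval (x : ℂ) / (((x : ℂ) - z) * P.eval z) := by
    rw [Polynomial.eval_mul, Polynomial.eval_C]
    have : S.eval (x : ℂ) = (P.eval (x : ℂ) - P.eval z) / ((x : ℂ) - z) := by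
      rw [h1]; field_simp
    rw [this]
    field_simp
    ring
  rw [h2, norm_div, norm_mul]
  have h3 : 1 / ε ≤ ‖(x : ℂ) - z‖ * ‖P.eval z‖ := by
    calc 1 / ε = |z.im| * (1 / (|z.im| * ε)) := by field_simp
      _ ≤ _ := by gcongr
  rw [div_le_iff₀ (by positivity)]
  have h4 := hP x hx
  calc _ ≤ (W x).toReal := h4
    _ = ε * (W x).toReal * (1 / ε) := by field_simp
    _ ≤ _ := by gcongr

lemma apx_mul_r {W : ℝ → ℝ≥0∞} {z : ℂ} (hz0 : z.im ≠ 0) (hz : ¬ Fin' W z) {f : ℝ → ℂ}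
    (hf : Apx W f) : Apx W (fun x => ((x : ℂ) - z)⁻¹ * f x) := by
  apply apx_closed
  intro ε hε
  have him : 0 < |z.im| := abs_pos.2 hz0
  obtain ⟨P, hP⟩ := hf (ε * |z.im|) (by positivity)
  refine ⟨fun x => ((x : ℂ) - z)⁻¹ * P.eval (x : ℂ), ?_, fun x hx => ?_⟩
  · obtain ⟨S, hS⟩ := exists_divX (P - Polynomial.C (P.eval z)) z (by simp)
    simp only [Polynomial.eval_sub, Polynomial.eval_C] at hS
    convert apx_add (apx_poly S) (apx_smul (apx_r hz0 hz) (P.eval z)) using 2 with x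
    have hxz := abs_im_le_norm_sub x z
    have hne : (x : ℂ) - z ≠ 0 := by
      intro h; rw [h, norm_zero] at hxz; linarith
    have : P.eval (x : ℂ) = (x - z) * S.eval (x : ℂ) + P.eval z := by rw [← hS]; ring
    rw [this]
    field_simp
  · have hxz := abs_im_le_norm_sub x z
    have h1 := hP x hx
    rw [← mul_sub, norm_mul, norm_inv, inv_mul_le_iff₀ (by linarith)]
    calc _ ≤ _ := h1
      _ = |z.im| * (ε * (W x).toReal) := by ring
      _ ≤ _ := by gcongr

noncomputable def rMap (z : ℂ) (hz : z.im ≠ 0) : C(OnePoint ℝ, ℂ) :=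
  OnePoint.continuousMapMk ⟨fun x : ℝ => ((x : ℂ) - z)⁻¹, by
    refine Continuous.inv₀ (by fun_prop) fun x h => ?_
    have hxz := abs_im_le_norm_sub x z
    rw [h, norm_zero] at hxz
    exact hz (abs_eq_zero.1 (le_antisymm hxz (abs_nonneg _)))⟩ 0 (by
    rw [coclosedCompact_eq_cocompact]
    refine tendsto_inv₀_cobounded.comp ?_
    rw [← tendsto_norm_atTop_iff_cobounded]
    refine tendsto_atTop_mono (f := fun x : ℝ => ‖x‖ - ‖z‖) ?_ ?_
    · intro x
      have := norm_sub_norm_le (x : ℂ) z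
      simpa using this
    · exact tendsto_atTop_add_const_right _ _ (tendsto_norm_cocompact_atTop (E := ℝ)))

def multAlg (W : ℝ → ℝ≥0∞) : Subalgebra ℂ C(OnePoint ℝ, ℂ) where
  carrier := {g | ∀ f : ℝ → ℂ, Apx W f → Apx W (fun x => g (x : OnePoint ℝ) * f x)}
  mul_mem' := by
    intro a b ha hb f hf
    have := ha _ (hb f hf)
    simpa [mul_assoc] using this
  add_mem' := by
    intro a b ha hb f hf
    have := apx_add (ha f hf) (hb f hf)
    simpa [add_mul] using this
  algebraMap_mem' := by
    intro c f hf
    have := apx_smul hf c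
    simpa using this

lemma apx_c0 {W : ℝ → ℝ≥0∞} (hW : IsWeight W) {z : ℂ} (hz0 : z.im ≠ 0) (hz : ¬ Fin' W z)
    (g : C(OnePoint ℝ, ℂ)) : Apx W (fun x => g (x : OnePoint ℝ)) := by
  have hzc0 : ((starRingEnd ℂ) z).im ≠ 0 := by simpa using hz0
  have hzc : ¬ Fin' W ((starRingEnd ℂ) z) := by
    intro h; apply hz; simpa using fin_conj h
  have hne : ∀ x : ℝ, (x : ℂ) - z ≠ 0 := by
    intro x h
    have hxz := abs_im_le_norm_sub x z
    rw [h, norm_zero] at hxz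
    exact hz0 (abs_eq_zero.1 (le_antisymm hxz (abs_nonneg _)))
  set r := rMap z hz0 with hr
  have hr1 : r ∈ multAlg W := fun f hf => apx_mul_r hz0 hz hf
  have hr2 : star r ∈ multAlg W := by
    intro f hf
    have := apx_mul_r hzc0 hzc hf
    convert this using 3 with x
    simp [hr, rMap, OnePoint.continuousMapMk]
  set A := StarAlgebra.adjoin ℂ {r} with hA
  have hAle : ∀ a ∈ A, a ∈ multAlg W := by
    intro a ha
    have h1 : a ∈ Algebra.adjoin ℂ ({r} ∪ star {r}) := ha
    refine Algebra.adjoin_le ?_ h1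
    rintro b (hb | hb)
    · rw [mem_singleton_iff] at hb; rw [hb]; exact hr1
    · rw [Set.mem_star, mem_singleton_iff] at hb
      rw [← star_star b, hb]; exact hr2
  have hsep : A.SeparatesPoints := by
    intro p q hpq
    refine ⟨r, ⟨r, StarAlgebra.subset_adjoin ℂ {r} rfl, rfl⟩, ?_⟩
    induction p using OnePoint.rec with
    | infty =>
      induction q using OnePoint.rec with
      | infty => exact absurd rfl hpq
      | coe y =>
        intro h
        have h' : (0 : ℂ) = ((y : ℂ) - z)⁻¹ := h
        exact inv_ne_zero (hne y) h'.symm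
    | coe x =>
      induction q using OnePoint.rec with
      | infty =>
        intro h
        have h' : ((x : ℂ) - z)⁻¹ = 0 := h
        exact inv_ne_zero (hne x) h'
      | coe y =>
        intro h
        have h' : ((x : ℂ) - z)⁻¹ = ((y : ℂ) - z)⁻¹ := h
        have h2 := inv_injective h'
        apply hpq
        have h3 : (x : ℂ) = y := by simpa using h2
        rw [ofReal_inj.1 h3]
  have htop := ContinuousMap.starSubalgebra_topologicalClosure_eq_top_of_separatesPoints A hsep
  have hg : g ∈ A.topologicalClosure := by rw [htop]; trivial
  apply apx_closed
  intro ε hε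
  obtain ⟨a, ha, hga⟩ := Metric.mem_closure_iff.1 hg ε hε
  refine ⟨fun x => a (x : OnePoint ℝ), ?_, fun x hx => ?_⟩
  · have := hAle a ha _ (apx_poly (W := W) 1)
    simpa using this
  · have h1 := (ContinuousMap.dist_apply_le_dist (f := g) (g := a) (x : OnePoint ℝ)).trans hga.le
    rw [dist_eq_norm] at h1
    have := one_le_toReal hW hx
    nlinarith

lemma apx_all {W : ℝ → ℝ≥0∞} (hW : IsWeight W) {z : ℂ} (hz0 : z.im ≠ 0) (hz : ¬ Fin' W z)
    (f : ℝ → ℂ) (hf : MemCW W f) : Apx W f := by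
  apply apx_closed
  intro ε hε
  have h1 := hf.2.eventually_lt_const (u := ENNReal.ofReal ε) (by simpa using hε)
  rw [eventually_comap] at h1
  obtain ⟨N, hN⟩ := eventually_atTop.1 h1
  have hNf : ∀ x : ℝ, N ≤ |x| → W x ≠ ⊤ → ‖f x‖ ≤ ε * (W x).toReal := by
    intro x hx hWx
    have h2 := (hN _ hx x rfl).le
    have h0 : W x ≠ 0 := (lt_of_lt_of_le one_pos (hW.2.1 x)).ne'
    rw [ENNReal.div_le_iff_le_mul (Or.inl h0) (Or.inl hWx), ← ENNReal.ofReal_toReal hWx,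
      ← ENNReal.ofReal_mul hε.le] at h2
    rwa [ENNReal.ofReal_le_ofReal_iff (by positivity)] at h2
  set φ : ℝ → ℝ := fun x => max 0 (min 1 (N + 1 - |x|)) with hφ
  have hφ0 : ∀ x, 0 ≤ φ x := fun x => le_max_left _ _
  have hφ1 : ∀ x, φ x ≤ 1 := fun x => max_le zero_le_one (min_le_left _ _)
  have hφc : Continuous φ := by fun_prop
  have hfc := hf.1
  have htend : Tendsto (fun x : ℝ => (φ x : ℂ) * f x) (coclosedCompact ℝ) (nhds 0) := by
    rw [coclosedCompact_eq_cocompact]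
    apply tendsto_nhds_of_eventually_eq
    have := (tendsto_norm_cocompact_atTop (E := ℝ)).eventually (eventually_ge_atTop (N + 1))
    filter_upwards [this] with x hx
    have : φ x = 0 := by
      rw [hφ]
      apply max_eq_left
      refine (min_le_right _ _).trans ?_
      rw [Real.norm_eq_abs] at hx
      linarith
    simp [this]
  refine ⟨_, apx_c0 hW hz0 hz (OnePoint.continuousMapMk ⟨fun x : ℝ => (φ x : ℂ) * f x,
    by fun_prop⟩ 0 htend), fun x hx => ?_⟩
  change ‖f x - φ x * f x‖ ≤ _
  have e1 : f x - φ x * f x = ((1 - φ x : ℝ) : ℂ) * f x := by push_cast; ring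
  rw [e1, norm_mul, norm_real, Real.norm_of_nonneg (by linarith [hφ1 x])]
  rcases le_total N |x| with h | h
  · have := hNf x h hx
    nlinarith [hφ0 x, norm_nonneg (f x), hφ1 x]
  · have : φ x = 1 := by
      rw [hφ]
      simp only
      rw [min_eq_left (by linarith)]
      simp
    rw [this]
    simp only [sub_self, zero_mul]
    positivity

theorem stmt14 (W : ℝ → ℝ≥0∞) (hW : IsWeight W) :
    List.TFAE [PolyDense W,
      ∃ z : ℂ, z.im ≠ 0 ∧ MW W z = ⊤,
      ∀ z : ℂ, z.im ≠ 0 → MW W z = ⊤] := by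
  tfae_have 1 → 3 := by
    intro h z hz
    by_contra hcon
    exact not_fin hW ((polyDense_iff hW).1 h) hz (MW_lt_top_iff.1 hcon)
  tfae_have 3 → 2 := fun h => ⟨I, by simp, h I (by simp)⟩
  tfae_have 2 → 1 := by
    rintro ⟨z, hz, h⟩
    rw [polyDense_iff hW]
    intro f hf
    exact apx_all hW hz (fun hfin => (MW_lt_top_iff.2 hfin) h) f hf
  tfae_finish
end

section
/- Let E = ⋃_m I_m, where I_m = [a_m, b_m] (a_m < b_m) are pairwise disjoint closed intervals in ℝ with dist(0, I_m) → ∞ as m → ∞, and suppose there are constants c > 0 and M < ∞ such that |I_m| ≥ c(1 + dist(0, I_m))^{-M} for every m. Let W be a weight with W(x) = +∞ for every x ∈ ℝ∖E. Then the polynomials are NOT dense in C(W) if and only if there exists a positive harmonic function h on ℂ∖E such that log M_W(z) ≤ h(z) for all z ∈ ℂ∖E. -/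
open Complex Filter Set MeasureTheory
open scoped ENNReal

/-- `h` is harmonic on `U`: real-valued, `C²` on `U`, with vanishing Laplacian. -/
def HarmonicOn (h : ℂ → ℝ) (U : Set ℂ) : Prop :=
  ContDiffOn ℝ 2 h U ∧ ∀ z ∈ U,
    iteratedFDerivWithin ℝ 2 h U z ![1, 1] +
      iteratedFDerivWithin ℝ 2 h U z ![Complex.I, Complex.I] = 0

/-- The subset of `ℂ` corresponding to a subset of `ℝ`. -/
def cplx (E : Set ℝ) : Set ℂ := (fun x : ℝ => (x : ℂ)) '' E

lemma harmonicOn_iff {h : ℂ → ℝ} {U : Set ℂ} (hU : IsOpen U) :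
    HarmonicOn h U ↔ InnerProductSpace.HarmonicOnNhd h U := by
  have key : ∀ z ∈ U, iteratedFDerivWithin ℝ 2 h U z ![1, 1] +
      iteratedFDerivWithin ℝ 2 h U z ![Complex.I, Complex.I] = Laplacian.laplacian h z := by
    intro z hz
    rw [InnerProductSpace.laplacian_eq_iteratedFDeriv_complexPlane,
      iteratedFDerivWithin_of_isOpen 2 hU hz]
  constructor
  · rintro ⟨h1, h2⟩ z hz
    refine ⟨h1.contDiffAt (hU.mem_nhds hz), ?_⟩
    filter_upwards [hU.mem_nhds hz] with w hw
    rw [← key w hw, h2 w hw]; rfl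
  · intro H
    refine ⟨H.contDiffOn, fun z hz => ?_⟩
    rw [key z hz]
    exact (H z hz).2.self_of_nhds

lemma harnack {h : ℂ → ℝ} {c z : ℂ} {R : ℝ} (hh : InnerProductSpace.HarmonicOnNhd h (Metric.ball c R))
    (hpos : ∀ w ∈ Metric.ball c R, 0 < h w) (hz : z ∈ Metric.ball c R) :
    h z ≤ 4 * R / (R - dist z c) * h c := by
  have hzR : dist z c < R := hz
  have hR : 0 < R := lt_of_le_of_lt dist_nonneg hzR
  obtain ⟨F, hF, hFe⟩ := hh.exists_analyticOnNhd_ball_re_eq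
  have hcb : c ∈ Metric.ball c R := Metric.mem_ball_self hR
  have hc := hpos c hcb
  let f : ℂ → ℂ := fun w => -(F (c + w) - (F c).im * I)
  have hmem : ∀ w ∈ Metric.ball (0:ℂ) R, c + w ∈ Metric.ball c R := by
    intro w hw; simpa [dist_eq_norm] using hw
  have hre : ∀ w ∈ Metric.ball (0:ℂ) R, (f w).re = - h (c + w) := by
    intro w hw
    have := hFe (hmem w hw)
    simp only [] at this
    simp [f, ← this]
  have hd : DifferentiableOn ℂ f (Metric.ball 0 R) := by
    intro w hw
    have h1 : DifferentiableAt ℂ F (c + w) := (hF _ (hmem w hw)).differentiableAt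
    have h2 : DifferentiableAt ℂ (fun w => F (c + w)) w :=
      DifferentiableAt.comp w h1 (by fun_prop)
    exact ((h2.sub_const _).neg).differentiableWithinAt
  have hz0 : z - c ∈ Metric.ball (0:ℂ) R := by simpa [dist_eq_norm] using hz
  have hB := Complex.borelCaratheodory (M := h c) hc hd (fun w hw => by
    have h1 := hpos _ (hmem w hw)
    have h2 := hre w hw
    simp only [Set.mem_ofPred_eq]
    linarith) hR hz0
  have hf0 : ‖f 0‖ = h c := by
    have h1 := hre 0 (by simpa using hR)
    have h2 : f 0 = ((-(h c) : ℝ) : ℂ) := by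
      apply Complex.ext
      · rw [h1]; simp
      · simp [f]
    rw [h2, Complex.norm_real, Real.norm_eq_abs, abs_neg, abs_of_pos hc]
  rw [hf0, ← dist_eq_norm] at hB
  have h3 : h z ≤ ‖f (z - c)‖ := by
    have h4 := hre _ hz0
    have h5 := Complex.abs_re_le_norm (f (z - c))
    rw [h4, abs_neg] at h5
    have h6 : c + (z - c) = z := by ring
    rw [h6] at h5
    exact (le_abs_self _).trans h5
  have hden : 0 < R - dist z c := by linarith
  refine h3.trans (hB.trans ?_)
  rw [← add_div, div_mul_eq_mul_div]
  gcongr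
  nlinarith [dist_nonneg (x := z) (y := c)]

lemma rhombus (x₀ C : ℝ) (hC : 0 < C) : ∃ B : ℝ, 0 < B ∧ ∀ P : Polynomial ℂ,
    (∀ z : ℂ, |z.re| ≤ 1 → 0 < |z.im| → |z.im| ≤ 1 →
      ‖P.eval ((x₀ : ℂ) + z)‖ ≤ Real.exp (C / z.im ^ 2)) →
    ∀ z : ℂ, ‖z‖ < 1 / 4 → ‖P.eval ((x₀ : ℂ) + z)‖ ≤ B := by
  set K := 9 * C with hK
  refine ⟨Real.exp (4 * K), Real.exp_pos _, fun P hP z hz => ?_⟩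
  -- bound for P on compact
  obtain ⟨m, hm⟩ : ∃ m : ℝ, ∀ z : ℂ, ‖z‖ ≤ 2 → ‖P.eval ((x₀ : ℂ) + z)‖ ≤ m := by
    have hc : ContinuousOn (fun z : ℂ => P.eval ((x₀ : ℂ) + z)) (Metric.closedBall 0 2) := by fun_prop
    obtain ⟨m, hm⟩ := (isCompact_closedBall (0:ℂ) 2).exists_bound_of_continuousOn hc
    exact ⟨m, fun z hz => hm z (by simpa using hz)⟩
  obtain ⟨δ, hδ0, hδ1, hδ⟩ : ∃ δ : ℝ, 0 < δ ∧ δ < 1 / 2 ∧ m ≤ Real.exp (K * (12 / (25 * δ ^ 2))) := by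
    set m' := max m 1
    refine ⟨min (1/4) (K / (3 * m')), ?_, ?_, ?_⟩
    · have : 0 < m' := lt_of_lt_of_le one_pos (le_max_right _ _)
      positivity
    · exact lt_of_le_of_lt (min_le_left _ _) (by norm_num)
    · have hm' : 0 < m' := lt_of_lt_of_le one_pos (le_max_right _ _)
      set δ := min (1/4) (K / (3 * m')) with hd
      have hδ : 0 < δ := by positivity
      have h1 : δ ≤ 1/4 := min_le_left _ _
      have h2 : δ ≤ K / (3 * m') := min_le_right _ _
      have h3 : δ * (3 * m') ≤ K := by rwa [le_div_iff₀ (by positivity)] at h2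
      have h4 : m' ≤ K * (12 / (25 * δ ^ 2)) := by
        rw [mul_div_assoc', le_div_iff₀ (by positivity)]
        nlinarith [mul_pos hδ hm', mul_nonneg hδ.le hδ.le]
      calc m ≤ m' := le_max_left _ _
        _ ≤ _ := h4
        _ ≤ _ := by linarith [Real.add_one_le_exp (K * (12 / (25 * δ ^ 2)))]
  let φ : ℂ → ℝ := fun z => max (|z.im| - (1 - |z.re|) / 2) (|z.re| - (1 - δ))
  have hφ : Continuous φ := by
    have h1 := Complex.continuous_im
    have h2 := Complex.continuous_re
    fun_prop
  let U : Set ℂ := {z | φ z < 0}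
  have hcl : closure U ⊆ {z | φ z ≤ 0} := closure_lt_subset_le hφ continuous_const
  have hfr : frontier U ⊆ {z | φ z = 0} := frontier_lt_subset_eq hφ continuous_const
  -- real part estimate
  have hre1 : ∀ w : ℂ, 0 < w.re → |w.im| ≤ w.re / 2 → 12 / (25 * w.re ^ 2) ≤ ((w ^ 2)⁻¹).re := by
    intro w h1 h2
    have h3 : w.im ^ 2 ≤ w.re ^ 2 / 4 := by
      have := sq_abs w.im
      nlinarith [abs_nonneg w.im]
    have h4 : ((w ^ 2)⁻¹).re = (w.re ^ 2 - w.im ^ 2) / (w.re ^ 2 + w.im ^ 2) ^ 2 := by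
      rw [Complex.inv_re, Complex.normSq_apply]
      simp [pow_two]
      congr 1
      ring
    rw [h4, div_le_div_iff₀ (by positivity) (by positivity)]
    have ha : 0 ≤ w.im ^ 2 := sq_nonneg _
    have hb : 0 < w.re ^ 2 := by positivity
    nlinarith [mul_nonneg ha hb.le, mul_nonneg ha ha, mul_nonneg ha (sub_nonneg.2 h3), mul_nonneg hb.le (sub_nonneg.2 h3)]
  let g : ℂ → ℂ := fun z => K * (((1 - z) ^ 2)⁻¹ + ((1 + z) ^ 2)⁻¹)
  have hg : ∀ z : ℂ, φ z ≤ 0 → K * (12 / (25 * (1 - |z.re|) ^ 2)) ≤ (g z).re := by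
    intro z hz
    have h1 : |z.im| ≤ (1 - |z.re|) / 2 := by linarith [le_max_left (|z.im| - (1 - |z.re|) / 2) (|z.re| - (1 - δ)), hz]
    have h2 : |z.re| ≤ 1 - δ := by linarith [le_max_right (|z.im| - (1 - |z.re|) / 2) (|z.re| - (1 - δ)), hz]
    have e1 := hre1 (1 - z) (by simp; linarith [le_abs_self z.re]) (by simp; linarith [le_abs_self z.re])
    have e2 := hre1 (1 + z) (by simp; linarith [neg_abs_le z.re]) (by simp; linarith [neg_abs_le z.re])
    have e3 : (g z).re = K * ((((1 - z) ^ 2)⁻¹).re + (((1 + z) ^ 2)⁻¹).re) := by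
      simp only [g, Complex.re_ofReal_mul, Complex.add_re]
    rw [e3]
    have hK0 : 0 < K := by positivity
    refine mul_le_mul_of_nonneg_left ?_ hK0.le
    simp only [Complex.sub_re, Complex.add_re, Complex.one_re] at e1 e2
    have p1 : 0 ≤ 12 / (25 * (1 - z.re) ^ 2) := by positivity
    have p2 : 0 ≤ 12 / (25 * (1 + z.re) ^ 2) := by positivity
    rcases le_total 0 z.re with h | h
    · rw [abs_of_nonneg h]; linarith
    · rw [abs_of_nonpos h, sub_neg_eq_add]; linarith
  have hne : ∀ z : ℂ, φ z ≤ 0 → (1 - z ≠ 0 ∧ 1 + z ≠ 0) := by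
    intro z hz
    have h2 : |z.re| ≤ 1 - δ := by linarith [le_max_right (|z.im| - (1 - |z.re|) / 2) (|z.re| - (1 - δ)), hz]
    constructor
    · intro h
      have := congrArg Complex.re h
      simp at this
      linarith [le_abs_self z.re]
    · intro h
      have := congrArg Complex.re h
      simp at this
      linarith [neg_abs_le z.re]
  let f : ℂ → ℂ := fun z => P.eval ((x₀ : ℂ) + z) * Complex.exp (- g z)
  have hfd : DifferentiableOn ℂ f (closure U) := by
    intro z hz
    obtain ⟨n1, n2⟩ := hne z (hcl hz)
    have n1' := pow_ne_zero 2 n1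
    have n2' := pow_ne_zero 2 n2
    have hPd : DifferentiableAt ℂ (fun z : ℂ => P.eval ((x₀ : ℂ) + z)) z :=
      (P.differentiable _).comp z (by fun_prop)
    have hgd : DifferentiableAt ℂ g z := by
      have d1 : DifferentiableAt ℂ (fun z : ℂ => (1 - z) ^ 2) z := by fun_prop
      have d2 : DifferentiableAt ℂ (fun z : ℂ => (1 + z) ^ 2) z := by fun_prop
      exact ((d1.fun_inv n1').fun_add (d2.fun_inv n2')).const_mul _
    exact (hPd.mul hgd.neg.cexp).differentiableWithinAt
  have hbd : Bornology.IsBounded U := by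
    refine (Metric.isBounded_closedBall (x := (0:ℂ)) (r := 2)).subset ?_
    intro z hz
    have hz' : φ z < 0 := hz
    have h1 : |z.im| ≤ (1 - |z.re|) / 2 := by linarith [le_max_left (|z.im| - (1 - |z.re|) / 2) (|z.re| - (1 - δ))]
    have h2 : |z.re| ≤ 1 - δ := by linarith [le_max_right (|z.im| - (1 - |z.re|) / 2) (|z.re| - (1 - δ))]
    have := Complex.norm_le_abs_re_add_abs_im z
    simp
    linarith [abs_nonneg z.re]
  have hnormf : ∀ z, ‖f z‖ = ‖P.eval ((x₀ : ℂ) + z)‖ * Real.exp (- (g z).re) := by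
    intro z; simp [f, Complex.norm_exp]
  have hfrle : ∀ z ∈ frontier U, ‖f z‖ ≤ 1 := by
    intro z hz
    have hz0 : φ z = 0 := hfr hz
    have h1 : |z.im| ≤ (1 - |z.re|) / 2 := by linarith [le_max_left (|z.im| - (1 - |z.re|) / 2) (|z.re| - (1 - δ))]
    have h2 : |z.re| ≤ 1 - δ := by linarith [le_max_right (|z.im| - (1 - |z.re|) / 2) (|z.re| - (1 - δ))]
    have hgz := hg z hz0.le
    have hK0 : 0 < K := by positivity
    suffices h : ‖P.eval ((x₀ : ℂ) + z)‖ ≤ Real.exp ((g z).re) by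
      rw [hnormf, Real.exp_neg, ← div_eq_mul_inv, div_le_one (Real.exp_pos _)]
      exact h
    rcases max_choice (|z.im| - (1 - |z.re|) / 2) (|z.re| - (1 - δ)) with h | h
    · have h3 : |z.im| = (1 - |z.re|) / 2 := by
        have : φ z = |z.im| - (1 - |z.re|) / 2 := h
        linarith
      have hu : 0 < 1 - |z.re| := by linarith
      refine (hP z (by linarith) (by linarith) (by linarith [abs_nonneg z.re])).trans ?_
      refine Real.exp_le_exp.2 (le_trans ?_ hgz)
      rw [← sq_abs z.im, h3, hK, mul_div_assoc', div_le_div_iff₀ (by positivity) (by positivity)]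
      nlinarith [mul_pos hC (pow_pos hu 2)]
    · have h3 : |z.re| = 1 - δ := by
        have : φ z = |z.re| - (1 - δ) := h
        linarith
      have h4 : 1 - |z.re| = δ := by linarith
      rw [h4] at hgz
      refine (hm z ?_).trans (hδ.trans (Real.exp_le_exp.2 hgz))
      have := Complex.norm_le_abs_re_add_abs_im z
      linarith [abs_nonneg z.re]
  have hzr := (Complex.abs_re_le_norm z).trans_lt hz
  have hzi := (Complex.abs_im_le_norm z).trans_lt hz
  have hzU : z ∈ U := by
    have : φ z < 0 := by
      simp only [φ]
      rw [max_lt_iff]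
      constructor <;> linarith
    exact this
  have hfin := Complex.norm_le_of_forall_mem_frontier_norm_le hbd
    ⟨hfd.mono subset_closure, hfd.continuousOn⟩ hfrle (subset_closure hzU)
  rw [hnormf, Real.exp_neg, ← div_eq_mul_inv, div_le_one (Real.exp_pos _)] at hfin
  refine hfin.trans (Real.exp_le_exp.2 ?_)
  have hK0 : 0 < K := by positivity
  have hn : ∀ w : ℂ, 3/4 ≤ ‖w‖ → ‖(w^2)⁻¹‖ ≤ 2 := by
    intro w hw
    rw [norm_inv, norm_pow]
    rw [inv_le_comm₀ (by positivity) (by norm_num)]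
    nlinarith
  have n1 := hn (1 - z) (by
    have := norm_sub_norm_le (1:ℂ) z
    rw [norm_one] at this; linarith)
  have n2 := hn (1 + z) (by
    have := norm_sub_norm_le (1:ℂ) (-z)
    rw [norm_one, norm_neg, sub_neg_eq_add] at this; linarith)
  calc (g z).re ≤ ‖g z‖ := Complex.re_le_norm _
    _ = K * ‖((1 - z) ^ 2)⁻¹ + ((1 + z) ^ 2)⁻¹‖ := by
      simp only [g, norm_mul, Complex.norm_real, Real.norm_eq_abs, abs_of_pos hK0]
    _ ≤ K * (2 + 2) := by gcongr; exact (norm_add_le _ _).trans (add_le_add n1 n2)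
    _ = 4 * K := by ring

lemma norm_le_exp_of_elog {W : ℝ → ℝ≥0∞} {z : ℂ} {r : ℝ} (hr : 0 ≤ r)
    (h : elog (MW W z) ≤ ENNReal.ofReal r) {P : Polynomial ℂ} (hP : P ∈ XW W) :
    ‖P.eval z‖ ≤ Real.exp r := by
  have hle : ENNReal.ofReal ‖P.eval z‖ ≤ MW W z := le_iSup₂ (f := fun (P : Polynomial ℂ) (_ : P ∈ XW W) => ENNReal.ofReal ‖P.eval z‖) P hP
  unfold elog at h
  split_ifs at h with ht
  · exact absurd h (by simp)
  · rw [ENNReal.ofReal_le_ofReal_iff hr] at h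
    have h1 : ‖P.eval z‖ ≤ (MW W z).toReal := by
      rwa [ENNReal.ofReal_le_iff_le_toReal ht] at hle
    rcases (norm_nonneg (P.eval z)).eq_or_lt with h0 | h0
    · rw [← h0]; positivity
    · exact h1.trans ((Real.log_le_iff_le_exp (h0.trans_le h1)).1 h)

lemma back_bound {E : Set ℝ} (hO : IsOpen (cplx E)ᶜ) {h : ℂ → ℝ}
    (hh : HarmonicOn h (cplx E)ᶜ) (hpos : ∀ z ∈ (cplx E)ᶜ, 0 < h z) (x₀ : ℝ) :
    ∃ C : ℝ, 0 < C ∧ ∀ z : ℂ, |z.re| ≤ 1 → 0 < |z.im| → |z.im| ≤ 1 →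
      h ((x₀ : ℂ) + z) ≤ C / z.im ^ 2 := by
  have him : ∀ z : ℂ, z.im ≠ 0 → z ∈ (cplx E)ᶜ := by
    rintro z hz ⟨x, -, rfl⟩
    simp at hz
  have hcont := hh.1.continuousOn
  have hb : ∀ s : ℝ, s ≠ 0 → ∃ m : ℝ, ∀ t ∈ Icc (-1:ℝ) 1, h ((x₀ : ℂ) + t + s * I) ≤ m := by
    intro s hs
    have hc : ContinuousOn (fun t : ℝ => h ((x₀ : ℂ) + t + s * I)) (Icc (-1) 1) := by
      refine hcont.comp (by fun_prop) ?_
      intro t _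
      apply him
      simpa using hs
    obtain ⟨m, hm⟩ := isCompact_Icc.exists_bound_of_continuousOn hc
    exact ⟨m, fun t ht => (le_abs_self _).trans (hm t ht)⟩
  have hb2 : ∀ s : ℝ, (s = 1 ∨ s = -1) → ∃ C : ℝ, 0 < C ∧ ∀ z : ℂ, |z.re| ≤ 1 → 0 < s * z.im → |z.im| = s * z.im → |z.im| ≤ 1 →
      h ((x₀ : ℂ) + z) ≤ C / z.im ^ 2 := by
    intro s hs
    have hs2 : s * s = 1 := by rcases hs with rfl | rfl <;> norm_num
    obtain ⟨m, hm⟩ := hb s (by rcases hs with rfl | rfl <;> norm_num)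
    refine ⟨4 * (max m 1), by positivity, fun z h1 h2 h3 h4 => ?_⟩
    set c : ℂ := (x₀ : ℂ) + z.re + s * I with hc
    have hd : dist ((x₀ : ℂ) + z) c = 1 - |z.im| := by
      rw [dist_eq_norm]
      have : (x₀ : ℂ) + z - c = ((z.im - s : ℝ) : ℂ) * I := by
        apply Complex.ext <;> simp [hc]
      rw [this, norm_mul, Complex.norm_I, mul_one, Complex.norm_real, Real.norm_eq_abs, h3]
      rw [h3] at h4
      have : |z.im - s| = |s * (z.im - s)| := by
        rw [abs_mul]
        rcases hs with rfl | rfl <;> simp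
      rw [this, mul_sub, hs2, abs_sub_comm, abs_of_nonneg (by linarith)]
    have hsub : Metric.ball c 1 ⊆ (cplx E)ᶜ := by
      intro w hw
      apply him
      intro hw0
      have h5 : |(w - c).im| < 1 := (Complex.abs_im_le_norm _).trans_lt (by simpa [dist_eq_norm] using hw)
      have h6 : (w - c).im = - s := by simp [hc, hw0]
      rw [h6] at h5
      rcases hs with rfl | rfl <;> norm_num at h5
    have hk := harnack (h := h) (c := c) (z := (x₀ : ℂ) + z) (R := 1)
      (fun w hw => (harmonicOn_iff hO).1 hh w (hsub hw)) (fun w hw => hpos w (hsub hw))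
      (by rw [Metric.mem_ball, hd]; linarith)
    rw [hd] at hk
    have hp : 0 < |z.im| := by linarith
    have hmc : h c ≤ max m 1 := (hm z.re (abs_le.1 h1)).trans (le_max_left _ _)
    refine hk.trans ?_
    have e1 : (1 : ℝ) - (1 - |z.im|) = |z.im| := by ring
    rw [e1, div_mul_eq_mul_div, ← sq_abs, div_le_div_iff₀ hp (by positivity)]
    have hM : 0 < max m 1 := by positivity
    have : h c * (|z.im| * |z.im|) ≤ max m 1 * (1 * |z.im|) := by gcongr
    nlinarith
  obtain ⟨C1, hC1, H1⟩ := hb2 1 (Or.inl rfl)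
  obtain ⟨C2, hC2, H2⟩ := hb2 (-1) (Or.inr rfl)
  refine ⟨C1 + C2, by positivity, fun z h1 h2 h3 => ?_⟩
  have hp : 0 < z.im ^ 2 := by rw [← sq_abs]; positivity
  rcases le_total 0 z.im with h | h
  · have := H1 z h1 (by rw [abs_of_nonneg h] at h2; linarith) (by rw [abs_of_nonneg h]; ring) h3
    refine this.trans ?_
    gcongr; linarith
  · have := H2 z h1 (by rw [abs_of_nonpos h] at h2; linarith) (by rw [abs_of_nonpos h]; ring) h3
    refine this.trans ?_
    gcongr; linarith

lemma poly_lip {B x₀ : ℝ} (hB : 0 < B) {P : Polynomial ℂ}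
    (h : ∀ z : ℂ, ‖z‖ < 1 / 4 → ‖P.eval ((x₀ : ℂ) + z)‖ ≤ B) {x y : ℝ}
    (hx : |x - x₀| < 1 / 16) (hy : |y - x₀| < 1 / 16) :
    ‖P.eval (x : ℂ) - P.eval (y : ℂ)‖ ≤ 8 * (2 * B + 1) * |x - y| := by
  have hb : ∀ w ∈ Metric.ball (y : ℂ) (1 / 8), ‖P.eval w‖ ≤ B := by
    intro w hw
    have := h (w - x₀) ?_
    · simpa using this
    · have h1 : ‖w - y‖ < 1 / 8 := by simpa [dist_eq_norm] using hw
      have h2 : ‖((y : ℂ) - x₀)‖ < 1 / 16 := by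
        rw [← Complex.ofReal_sub, Complex.norm_real]; exact hy
      have h3 : w - (x₀ : ℂ) = (w - y) + (y - x₀) := by ring
      rw [h3]
      refine (norm_add_le _ _).trans_lt (by linarith)
  have hxb : (x : ℂ) ∈ Metric.ball (y : ℂ) (1/8) := by
    rw [Metric.mem_ball, dist_eq_norm, ← Complex.ofReal_sub, Complex.norm_real, Real.norm_eq_abs]
    have : x - y = (x - x₀) - (y - x₀) := by ring
    rw [this]
    refine (abs_sub _ _).trans_lt (by linarith)
  have hyb : (y : ℂ) ∈ Metric.ball (y : ℂ) (1/8) := Metric.mem_ball_self (by norm_num)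
  have := Complex.dist_le_div_mul_dist_of_mapsTo_ball (f := fun w => P.eval w) (c := (y:ℂ)) (R₁ := 1/8)
    (R₂ := 2 * B + 1) P.differentiable.differentiableOn (by
      intro w hw
      have h1 := hb w hw
      have h2 := hb y hyb
      refine Metric.ball_subset_closedBall ?_
      rw [Metric.mem_ball, dist_eq_norm]
      refine (norm_sub_le _ _).trans_lt (by linarith)) hxb
  rw [dist_eq_norm, dist_eq_norm, ← Complex.ofReal_sub, Complex.norm_real, Real.norm_eq_abs] at this
  refine this.trans (le_of_eq (by ring))

lemma back {E : Set ℝ} {W : ℝ → ℝ≥0∞} (hW : IsWeight W) (hO : IsOpen (cplx E)ᶜ) {h : ℂ → ℝ}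
    (hh : HarmonicOn h (cplx E)ᶜ) (hpos : ∀ z ∈ (cplx E)ᶜ, 0 < h z)
    (hle : ∀ z ∈ (cplx E)ᶜ, elog (MW W z) ≤ ENNReal.ofReal (h z)) : ¬ PolyDense W := by
  intro hD
  obtain ⟨-, hW1, hWt, x₀, hacc⟩ := hW
  have him : ∀ z : ℂ, z.im ≠ 0 → z ∈ (cplx E)ᶜ := by
    rintro z hz ⟨x, -, rfl⟩
    simp at hz
  obtain ⟨C, hC, hCb⟩ := back_bound hO hh hpos x₀
  obtain ⟨B, hB, hBb⟩ := rhombus x₀ C hC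
  have hX : ∀ P ∈ XW W, ∀ z : ℂ, ‖z‖ < 1 / 4 → ‖P.eval ((x₀ : ℂ) + z)‖ ≤ B := by
    intro P hP
    apply hBb
    intro z h1 h2 h3
    have hz : (x₀ : ℂ) + z ∈ (cplx E)ᶜ := him _ (by simpa using abs_pos.1 h2)
    refine (norm_le_exp_of_elog (hpos _ hz).le (hle _ hz) hP).trans ?_
    exact Real.exp_le_exp.2 (hCb z h1 h2 h3)
  let f0 : ℝ → ℝ := fun x => min (Real.sqrt |x - x₀|) 1
  have hf0c : Continuous f0 := by fun_prop
  have hf01 : ∀ x, |f0 x| ≤ 1 := by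
    intro x
    rw [abs_of_nonneg (by positivity)]
    exact min_le_right _ _
  let f : ℝ → ℂ := fun x => (f0 x : ℂ)
  have hfn : ∀ x, ‖f x‖ ≤ 1 := fun x => by simpa [f] using hf01 x
  have hf : MemCW W f := by
    refine ⟨by fun_prop, ?_⟩
    refine tendsto_of_tendsto_of_tendsto_of_le_of_le tendsto_const_nhds (hWt 0) (fun _ => zero_le) ?_
    intro x
    simp only [pow_zero]
    gcongr
    exact hfn x
  set K := 2 * (8 * (2 * B + 1)) with hK
  have hK0 : 0 < K := by positivity
  have hlip : ∀ x y : ℝ, W x ≠ ⊤ → W y ≠ ⊤ → |x - x₀| < 1 / 16 → |y - x₀| < 1/16 →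
      |f0 x - f0 y| ≤ K * |x - y| := by
    intro x y hx hy hx1 hy1
    have hε : ∀ ε : ℝ, 0 < ε → ε ≤ 1 → |f0 x - f0 y| ≤ K * |x - y| + ε * ((W x).toReal + (W y).toReal) := by
      intro ε e0 e1
      obtain ⟨P, hP⟩ := hD f hf ε e0
      have hPx : ∀ x, ENNReal.ofReal ‖f x - P.eval (x:ℂ)‖ ≤ ENNReal.ofReal ε * W x := by
        intro x
        have h1 : ENNReal.ofReal ‖f x - P.eval (x:ℂ)‖ / W x ≤ ENNReal.ofReal ε :=
          (le_iSup (fun x : ℝ => ENNReal.ofReal ‖f x - P.eval (x:ℂ)‖ / W x) x).trans hP.le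
        have h0 : W x ≠ 0 := fun h => by have := hW1 x; simp [h] at this
        rcases eq_or_ne (W x) ⊤ with ht | ht
        · rw [ht, ENNReal.mul_top (by simpa using e0)]; exact le_top
        · exact (ENNReal.div_le_iff h0 ht).1 h1
      have hPr : ∀ x, W x ≠ ⊤ → ‖f x - P.eval (x:ℂ)‖ ≤ ε * (W x).toReal := by
        intro x hx
        have := hPx x
        rw [← ENNReal.ofReal_toReal hx, ← ENNReal.ofReal_mul e0.le, ENNReal.ofReal_le_ofReal_iff (by positivity)] at this
        exact this
      set Q : Polynomial ℂ := Polynomial.C (1/2) * P with hQ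
      have hQX : Q ∈ XW W := by
        intro x
        rcases eq_or_ne (W x) ⊤ with ht | ht
        · rw [ht]; exact le_top
        · have h1 := hPr x ht
          have h2 : 1 ≤ (W x).toReal := by
            have := ENNReal.toReal_mono ht (hW1 x); simpa using this
          rw [ENNReal.ofReal_le_iff_le_toReal ht]
          have h3 : ‖Q.eval (x:ℂ)‖ = ‖P.eval (x:ℂ)‖ / 2 := by
            simp [hQ]; ring
          have h4 : ‖P.eval (x:ℂ)‖ ≤ ‖f x‖ + ‖f x - P.eval (x:ℂ)‖ := by
            have := norm_sub_le (f x) (f x - P.eval (x:ℂ))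
            simpa using this
          have h5 := hfn x
          rw [h3]
          nlinarith
      have hlipQ := poly_lip hB (hX Q hQX) hx1 hy1
      have hlipP : ‖P.eval (x:ℂ) - P.eval (y:ℂ)‖ ≤ K * |x - y| := by
        have h3 : P.eval (x:ℂ) - P.eval (y:ℂ) = 2 * (Q.eval (x:ℂ) - Q.eval (y:ℂ)) := by
          simp [hQ]; ring
        rw [h3, norm_mul]
        norm_num
        rw [hK]; linarith
      have h1 := hPr x hx
      have h2 := hPr y hy
      have h3 : |f0 x - f0 y| = ‖f x - f y‖ := by
        simp only [f]
        rw [← Complex.ofReal_sub, Complex.norm_real, Real.norm_eq_abs]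
      rw [h3]
      have h4 : f x - f y = (f x - P.eval (x:ℂ)) + (P.eval (x:ℂ) - P.eval (y:ℂ)) - (f y - P.eval (y:ℂ)) := by ring
      rw [h4]
      refine (norm_sub_le _ _).trans ?_
      have := norm_add_le (f x - P.eval (x:ℂ)) (P.eval (x:ℂ) - P.eval (y:ℂ))
      linarith
    by_contra hcon
    push Not at hcon
    set S := (W x).toReal + (W y).toReal with hS
    have hS0 : 0 ≤ S := by positivity
    set δ := |f0 x - f0 y| - K * |x - y| with hδ
    have hδ0 : 0 < δ := by linarith
    have := hε (min 1 (δ / (2 * (S + 1)))) (by positivity) (min_le_left _ _)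
    have h2 : min 1 (δ / (2 * (S + 1))) * S ≤ δ / (2 * (S + 1)) * S := by
      gcongr; exact min_le_right _ _
    have h3 : δ / (2 * (S + 1)) * S ≤ δ / 2 := by
      rw [div_mul_eq_mul_div, div_le_div_iff₀ (by positivity) (by positivity)]
      nlinarith
    linarith
  have hfreq : ∃ᶠ y in nhdsWithin x₀ {x₀}ᶜ, W y ≠ ⊤ := accPt_iff_frequently_nhdsNE.1 hacc
  have hlim : ∀ x : ℝ, W x ≠ ⊤ → |x - x₀| < 1 / 16 → f0 x ≤ K * |x - x₀| := by
    intro x hx hx1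
    by_contra hcon
    push Not at hcon
    have hev : ∀ᶠ y in nhds x₀, K * |x - y| < |f0 x - f0 y| := by
      have hc1 : Continuous (fun y => K * |x - y|) := by fun_prop
      have hc2 : Continuous (fun y => |f0 x - f0 y|) := by fun_prop
      refine (hc1.tendsto x₀).eventually_lt (hc2.tendsto x₀) ?_
      have : f0 x₀ = 0 := by simp [f0]
      rw [this, sub_zero]
      exact hcon.trans_le (le_abs_self _)
    have hev2 : ∀ᶠ y in nhds x₀, |y - x₀| < 1/16 := by
      filter_upwards [Metric.ball_mem_nhds x₀ (show (0:ℝ) < 1/16 by norm_num)] with y hy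
      simpa [Real.dist_eq] using hy
    obtain ⟨y, h1, h2, h3⟩ := (hfreq.and_eventually (mem_nhdsWithin_of_mem_nhds (hev.and hev2))).exists
    exact absurd (hlip x y hx h1 hx1 h3) (not_le.2 h2)
  have hev : ∀ᶠ x in nhds x₀, |x - x₀| < min (1/16) (1 / (K^2)) := by
    filter_upwards [Metric.ball_mem_nhds x₀ (show (0:ℝ) < min (1/16) (1 / (K^2)) by positivity)] with y hy
    simpa [Real.dist_eq] using hy
  obtain ⟨x, ⟨h1, h2⟩, h3⟩ := ((hfreq.and_eventually (mem_nhdsWithin_of_mem_nhds hev)).and_eventually self_mem_nhdsWithin).exists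
  have hs1 : |x - x₀| < 1/16 := h2.trans_le (min_le_left _ _)
  have hs2 : |x - x₀| < 1/K^2 := h2.trans_le (min_le_right _ _)
  have hs0 : 0 < |x - x₀| := abs_pos.2 (sub_ne_zero.2 h3)
  have hl := hlim x h1 hs1
  set s := |x - x₀| with hs
  have hsq : f0 x = Real.sqrt s := by
    simp only [f0]
    apply min_eq_left
    exact Real.sqrt_le_iff.2 ⟨by norm_num, by linarith⟩
  rw [hsq] at hl
  have h4 : 0 < Real.sqrt s := Real.sqrt_pos.2 hs0
  have h5 := Real.mul_self_sqrt hs0.le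
  rw [lt_div_iff₀ (by positivity)] at hs2
  have h6 : 1 ≤ K * Real.sqrt s := by
    by_contra hc
    push Not at hc
    nlinarith
  nlinarith

def ApproxW (W : ℝ → ℝ≥0∞) (g : ℝ → ℂ) : Prop :=
  ∀ ε : ℝ, 0 < ε → ∃ P : Polynomial ℂ, ∀ x, W x ≠ ⊤ → ‖g x - P.eval (x:ℂ)‖ ≤ ε * (W x).toReal

lemma ApproxW.add {W : ℝ → ℝ≥0∞} {g h : ℝ → ℂ} (hg : ApproxW W g) (hh : ApproxW W h) :
    ApproxW W (fun x => g x + h x) := by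
  intro ε e0
  obtain ⟨P, hP⟩ := hg (ε/2) (by positivity)
  obtain ⟨Q, hQ⟩ := hh (ε/2) (by positivity)
  refine ⟨P + Q, fun x hx => ?_⟩
  have h1 := hP x hx
  have h2 := hQ x hx
  have : g x + h x - (P + Q).eval (x:ℂ) = (g x - P.eval (x:ℂ)) + (h x - Q.eval (x:ℂ)) := by
    simp; ring
  rw [this]
  refine (norm_add_le _ _).trans (by linarith)

lemma ApproxW.const_mul {W : ℝ → ℝ≥0∞} {g : ℝ → ℂ} (hg : ApproxW W g) (k : ℂ) :
    ApproxW W (fun x => k * g x) := by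
  intro ε e0
  obtain ⟨P, hP⟩ := hg (ε/(‖k‖+1)) (by positivity)
  refine ⟨Polynomial.C k * P, fun x hx => ?_⟩
  have h1 := hP x hx
  have : k * g x - (Polynomial.C k * P).eval (x:ℂ) = k * (g x - P.eval (x:ℂ)) := by
    simp; ring
  rw [this, norm_mul]
  calc ‖k‖ * ‖g x - P.eval (x:ℂ)‖ ≤ (‖k‖+1) * (ε/(‖k‖+1) * (W x).toReal) := by
        gcongr; linarith
    _ = ε * (W x).toReal := by field_simp

lemma step2 {W : ℝ → ℝ≥0∞} (hW : IsWeight W) {x₀ d : ℝ} (hd : 0 < d)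
    (hx : ∀ x, W x ≠ ⊤ → d ≤ |x - x₀|)
    (hub : ∀ N : ℝ, ∃ P ∈ XW W, N < ‖P.eval (x₀ : ℂ)‖) : PolyDense W := by
  have hW1 := hW.2.1
  have hw1 : ∀ x, W x ≠ ⊤ → 1 ≤ (W x).toReal := by
    intro x hx
    have := ENNReal.toReal_mono hx (hW1 x); simpa using this
  have hnx : ∀ x : ℝ, W x ≠ ⊤ → d ≤ ‖(x:ℂ) - x₀‖ := by
    intro x h
    rw [← Complex.ofReal_sub, Complex.norm_real]; exact hx x h
  have hn0 : ∀ x : ℝ, W x ≠ ⊤ → (x:ℂ) - x₀ ≠ 0 := by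
    intro x h h0
    have := hnx x h
    rw [h0, norm_zero] at this; linarith
  have hinv : ApproxW W (fun x => ((x:ℂ) - x₀)⁻¹) := by
    intro ε e0
    obtain ⟨P, hP, hN⟩ := hub (1/(ε*d))
    have hP0 : 0 < ‖P.eval (x₀:ℂ)‖ := lt_trans (by positivity) hN
    have hP0' : P.eval (x₀:ℂ) ≠ 0 := norm_pos_iff.1 hP0
    obtain ⟨R, hR⟩ := Polynomial.X_sub_C_dvd_sub_C_eval (a := (x₀:ℂ)) (p := P)
    refine ⟨Polynomial.C (-(P.eval (x₀:ℂ))⁻¹) * R, fun x hx => ?_⟩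
    have h1 : P.eval (x:ℂ) - P.eval (x₀:ℂ) = (x - x₀) * R.eval (x:ℂ) := by
      have := congrArg (Polynomial.eval (x:ℂ)) hR
      simpa using this
    have h0 := hn0 x hx
    have h2 : ((x:ℂ) - x₀)⁻¹ - (Polynomial.C (-(P.eval (x₀:ℂ))⁻¹) * R).eval (x:ℂ)
        = P.eval (x:ℂ) / (P.eval (x₀:ℂ) * (x - x₀)) := by
      have h3 : P.eval (x:ℂ) = P.eval (x₀:ℂ) + (x - x₀) * R.eval (x:ℂ) := by rw [← h1]; ring
      rw [h3]
      simp
      field_simp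
    rw [h2, norm_div, norm_mul]
    have h4 : ‖P.eval (x:ℂ)‖ ≤ (W x).toReal := (ENNReal.ofReal_le_iff_le_toReal hx).1 (hP x)
    have h5 := hnx x hx
    rw [div_le_iff₀ (by positivity)]
    have h6 : 1 ≤ ε * (‖P.eval (x₀:ℂ)‖ * ‖(x:ℂ) - x₀‖) := by
      rw [div_lt_iff₀ (by positivity)] at hN
      have : ‖P.eval (x₀:ℂ)‖ * d ≤ ‖P.eval (x₀:ℂ)‖ * ‖(x:ℂ) - x₀‖ := by gcongr
      nlinarith
    have := hw1 x hx
    nlinarith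
  have hdiv : ∀ g : ℝ → ℂ, ApproxW W g → ApproxW W (fun x => g x * ((x:ℂ) - x₀)⁻¹) := by
    intro g hg ε e0
    obtain ⟨Q, hQ⟩ := hg (ε/2*d) (by positivity)
    obtain ⟨R, hR⟩ := Polynomial.X_sub_C_dvd_sub_C_eval (a := (x₀:ℂ)) (p := Q)
    obtain ⟨S, hS⟩ := (hinv.const_mul (Q.eval (x₀:ℂ))) (ε/2) (by positivity)
    refine ⟨R + S, fun x hx => ?_⟩
    have h1 : Q.eval (x:ℂ) - Q.eval (x₀:ℂ) = (x - x₀) * R.eval (x:ℂ) := by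
      have := congrArg (Polynomial.eval (x:ℂ)) hR
      simpa using this
    have h0 := hn0 x hx
    have h2 : g x * ((x:ℂ) - x₀)⁻¹ - (R + S).eval (x:ℂ) =
        (g x - Q.eval (x:ℂ)) * ((x:ℂ) - x₀)⁻¹ + (Q.eval (x₀:ℂ) * ((x:ℂ) - x₀)⁻¹ - S.eval (x:ℂ)) := by
      have h3 : Q.eval (x:ℂ) = Q.eval (x₀:ℂ) + (x - x₀) * R.eval (x:ℂ) := by rw [← h1]; ring
      rw [h3]
      simp
      field_simp
      ring
    rw [h2]
    refine (norm_add_le _ _).trans ?_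
    have h4 := hS x hx
    have h5 := hQ x hx
    have h6 : ‖(g x - Q.eval (x:ℂ)) * ((x:ℂ) - x₀)⁻¹‖ ≤ ε/2 * (W x).toReal := by
      rw [norm_mul, norm_inv]
      calc _ ≤ (ε/2*d * (W x).toReal) * d⁻¹ := by
            gcongr; exact hnx x hx
        _ = _ := by field_simp
    linarith
  have hpow : ∀ n : ℕ, ApproxW W (fun x => (((x:ℂ) - x₀)⁻¹)^n) := by
    intro n
    induction n with
    | zero => intro ε e0; exact ⟨1, fun x hx => by simp; positivity⟩
    | succ n ih =>
      simp only [pow_succ]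
      exact hdiv _ ih
  have hpoly : ∀ p : Polynomial ℂ, ApproxW W (fun x => p.eval (((x:ℂ) - x₀)⁻¹)) := by
    intro p
    induction p using Polynomial.induction_on' with
    | add p q hp hq => simp only [Polynomial.eval_add]; exact hp.add hq
    | monomial n a => simp only [Polynomial.eval_monomial]; exact (hpow n).const_mul a
  intro f hf ε e0
  obtain ⟨hfc, hft⟩ := hf
  have hev := (hft.eventually (gt_mem_nhds (show (0:ℝ≥0∞) < ENNReal.ofReal (ε/4) by simpa using e0)))
  rw [eventually_comap] at hev
  obtain ⟨R, hR⟩ := (eventually_atTop.1 hev)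
  have hfR : ∀ x, W x ≠ ⊤ → R ≤ |x| → ‖f x‖ ≤ ε/4 * (W x).toReal := by
    intro x hx hxR
    have h1 := (hR |x| hxR x rfl).le
    have h0 : W x ≠ 0 := fun h => by have := hW1 x; simp [h] at this
    rw [ENNReal.div_le_iff h0 hx, ← ENNReal.ofReal_toReal hx, ← ENNReal.ofReal_mul (by positivity),
      ENNReal.ofReal_le_ofReal_iff (by positivity)] at h1
    exact h1
  let χ : ℝ → ℝ := fun x => max 0 (min 1 (|R| + 1 - |x|))
  have hχc : Continuous χ := by fun_prop
  have hχ0 : ∀ x, 0 ≤ χ x := fun x => le_max_left _ _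
  have hχ1 : ∀ x, χ x ≤ 1 := fun x => max_le zero_le_one (min_le_left _ _)
  have hχR : ∀ x, |x| ≤ |R| → χ x = 1 := by
    intro x h
    simp only [χ]
    rw [min_eq_left (by linarith), max_eq_right zero_le_one]
  have hχb : ∀ x, |R| + 1 ≤ |x| → χ x = 0 := by
    intro x h
    simp only [χ]
    exact max_eq_left ((min_le_right _ _).trans (by linarith))
  let g : ℝ → ℂ := fun x => χ x * f x
  have hgc : Continuous g := by fun_prop
  have hfg : ∀ x, W x ≠ ⊤ → ‖f x - g x‖ ≤ ε/4 * (W x).toReal := by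
    intro x hx
    have h1 : f x - g x = ((1 - χ x : ℝ) : ℂ) * f x := by simp [g]; ring
    rw [h1, norm_mul, Complex.norm_real, Real.norm_eq_abs, abs_of_nonneg (by linarith [hχ1 x])]
    rcases le_total |x| |R| with h | h
    · rw [hχR x h]; simp; positivity
    · have := hfR x hx ((le_abs_self R).trans h)
      have h2 := hχ0 x
      have h3 := hχ1 x
      nlinarith [norm_nonneg (f x)]
  let G : ℝ → ℂ := fun t => if t = 0 then 0 else g (x₀ + t⁻¹)
  have hGc : Continuous G := by
    rw [continuous_iff_continuousAt]
    intro t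
    rcases eq_or_ne t 0 with rfl | ht
    · have : G =ᶠ[nhds 0] fun _ => 0 := by
        filter_upwards [Metric.ball_mem_nhds (0:ℝ) (show 0 < 1/(|R| + 1 + |x₀|) by positivity)] with t ht
        simp only [G]
        split_ifs with h0
        · rfl
        · have h1 : |t| < 1/(|R| + 1 + |x₀|) := by simpa using ht
          have h2 : 0 < |t| := abs_pos.2 h0
          rw [lt_div_iff₀ (by positivity)] at h1
          have h3 : |R| + 1 + |x₀| ≤ |t⁻¹| := by
            rw [abs_inv, ← one_div, le_div_iff₀ h2]; linarith
          have h4 : |R| + 1 ≤ |x₀ + t⁻¹| := by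
            have := abs_sub_abs_le_abs_sub (t⁻¹) (-x₀)
            rw [abs_neg, sub_neg_eq_add, add_comm t⁻¹] at this
            linarith
          simp [g, hχb _ h4]
      exact continuousAt_const.congr this.symm
    · have : G =ᶠ[nhds t] fun t => g (x₀ + t⁻¹) := by
        filter_upwards [isOpen_ne.mem_nhds ht] with s hs
        simp only [G]
        rw [if_neg hs]
      refine ContinuousAt.congr ?_ this.symm
      exact hgc.continuousAt.comp (continuousAt_const.add (continuousAt_inv₀ ht))
  obtain ⟨p1, hp1⟩ := exists_polynomial_near_of_continuousOn (-d⁻¹) d⁻¹ (fun t => (G t).re)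
    (by fun_prop) (ε/8) (by positivity)
  obtain ⟨p2, hp2⟩ := exists_polynomial_near_of_continuousOn (-d⁻¹) d⁻¹ (fun t => (G t).im)
    (by fun_prop) (ε/8) (by positivity)
  let p : Polynomial ℂ := p1.map Complex.ofRealHom + Polynomial.C I * p2.map Complex.ofRealHom
  have hpG : ∀ t ∈ Icc (-d⁻¹) d⁻¹, ‖G t - p.eval (t:ℂ)‖ ≤ ε/4 := by
    intro t ht
    have e1 : ∀ q : Polynomial ℝ, (q.map Complex.ofRealHom).eval (t:ℂ) = ((q.eval t : ℝ) : ℂ) := by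
      intro q
      have := Polynomial.eval_map_apply (f := Complex.ofRealHom) (p := q) t
      simpa using this
    have h1 := hp1 t ht
    have h2 := hp2 t ht
    have hre : (G t - p.eval (t:ℂ)).re = (G t).re - p1.eval t := by
      simp [p, e1]
    have him : (G t - p.eval (t:ℂ)).im = (G t).im - p2.eval t := by
      simp [p, e1]
    have h3 := Complex.norm_le_abs_re_add_abs_im (G t - p.eval (t:ℂ))
    rw [hre, him] at h3
    rw [abs_sub_comm] at h1 h2
    linarith
  obtain ⟨Q, hQ⟩ := hpoly p (ε/4) (by positivity)
  refine ⟨Q, ?_⟩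
  have hfin : ∀ x, W x ≠ ⊤ → ‖f x - Q.eval (x:ℂ)‖ ≤ 3*ε/4 * (W x).toReal := by
    intro x hxW
    have h1 := hfg x hxW
    have h2 := hQ x hxW
    set t := (x - x₀)⁻¹ with ht
    have hxd := hx x hxW
    have hne : x - x₀ ≠ 0 := by intro h; rw [h, abs_zero] at hxd; linarith
    have htm : |t| ≤ d⁻¹ := by rw [ht, abs_inv]; gcongr
    have h3 := hpG t (abs_le.1 htm)
    have h4 : G t = g x := by
      simp only [G]
      rw [if_neg (inv_ne_zero hne), ht, inv_inv]; congr 1; ring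
    have h5 : ((x:ℂ) - x₀)⁻¹ = (t:ℂ) := by rw [ht]; push_cast; rfl
    simp only [h5] at h2
    rw [h4] at h3
    have h6 : f x - Q.eval (x:ℂ) = (f x - g x) + (g x - p.eval (t:ℂ)) + (p.eval (t:ℂ) - Q.eval (x:ℂ)) := by ring
    rw [h6]
    have h7 := norm_add_le ((f x - g x) + (g x - p.eval (t:ℂ))) (p.eval (t:ℂ) - Q.eval (x:ℂ))
    have h8 := norm_add_le (f x - g x) (g x - p.eval (t:ℂ))
    have h9 := hw1 x hxW
    nlinarith
  refine lt_of_le_of_lt (b := ENNReal.ofReal (3*ε/4)) ?_ ?_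
  · refine iSup_le fun x => ?_
    rcases eq_or_ne (W x) ⊤ with ht | ht
    · simp [ht]
    · have h0 : W x ≠ 0 := fun h => by have := hW1 x; simp [h] at this
      have := hfin x ht
      rw [ENNReal.div_le_iff h0 ht, ← ENNReal.ofReal_toReal ht, ← ENNReal.ofReal_mul (by positivity),
        ENNReal.ofReal_le_ofReal_iff (by positivity)]
      exact this
  · rw [ENNReal.ofReal_lt_ofReal_iff e0]; linarith

lemma duality_exact {D : Set ℝ} (hD : D.Infinite) {w : ℝ → ℝ} (hw : ∀ x ∈ D, 1 ≤ w x) {x₀ N s : ℝ}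
    (hs : N < s) (hN : 0 ≤ N) (n : ℕ)
    (hp : ∀ p : Polynomial ℝ, (∀ x ∈ D, |p.eval x| ≤ w x) → |p.eval x₀| ≤ N) :
    ∃ (t : Finset ℝ) (c : ℝ → ℝ), ↑t ⊆ D ∧ (∑ x ∈ t, w x * |c x| ≤ s) ∧
      ∀ k ≤ n, ∑ x ∈ t, c x * x ^ k = x₀ ^ k := by
  classical
  have hs0 : 0 < s := by linarith
  let m : ℝ → (Fin (n+1) → ℝ) := fun x j => x ^ (j : ℕ)
  let K : Set (Fin (n+1) → ℝ) := {v | ∃ (t : Finset ℝ) (c : ℝ → ℝ), ↑t ⊆ D ∧ (∀ x ∉ t, c x = 0) ∧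
    (∑ x ∈ t, w x * |c x| ≤ s) ∧ v = ∑ x ∈ t, c x • m x}
  suffices h : m x₀ ∈ K by
    obtain ⟨t, c, h1, -, h2, h3⟩ := h
    refine ⟨t, c, h1, h2, fun k hk => ?_⟩
    have := congrFun h3 ⟨k, by omega⟩
    simp [m] at this
    exact this.symm
  have hKc : Convex ℝ K := by
    rintro v1 ⟨t1, c1, a1, b1, d1, e1⟩ v2 ⟨t2, c2, a2, b2, d2, e2⟩ α β hα hβ hαβ
    have hs1 : t1 ⊆ t1 ∪ t2 := Finset.subset_union_left
    have hs2 : t2 ⊆ t1 ∪ t2 := Finset.subset_union_right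
    have e1' : v1 = ∑ x ∈ t1 ∪ t2, c1 x • m x := by
      rw [e1]; exact Finset.sum_subset hs1 (fun x _ hx => by simp [b1 x hx])
    have e2' : v2 = ∑ x ∈ t1 ∪ t2, c2 x • m x := by
      rw [e2]; exact Finset.sum_subset hs2 (fun x _ hx => by simp [b2 x hx])
    have d1' : ∑ x ∈ t1 ∪ t2, w x * |c1 x| ≤ s := by
      refine le_of_eq_of_le (Finset.sum_subset hs1 (fun x _ hx => by simp [b1 x hx])).symm d1
    have d2' : ∑ x ∈ t1 ∪ t2, w x * |c2 x| ≤ s := by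
      refine le_of_eq_of_le (Finset.sum_subset hs2 (fun x _ hx => by simp [b2 x hx])).symm d2
    have hsub : (↑(t1 ∪ t2) : Set ℝ) ⊆ D := by
      rw [Finset.coe_union]; exact union_subset a1 a2
    refine ⟨t1 ∪ t2, fun x => α * c1 x + β * c2 x, hsub, ?_, ?_, ?_⟩
    · intro x hx
      rw [Finset.mem_union, not_or] at hx
      simp [b1 x hx.1, b2 x hx.2]
    · calc ∑ x ∈ t1 ∪ t2, w x * |α * c1 x + β * c2 x|
          ≤ ∑ x ∈ t1 ∪ t2, (α * (w x * |c1 x|) + β * (w x * |c2 x|)) := by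
            apply Finset.sum_le_sum
            intro x hx
            have hwx : 0 ≤ w x := zero_le_one.trans (hw x (hsub hx))
            have := abs_add_le (α * c1 x) (β * c2 x)
            rw [abs_mul, abs_mul, abs_of_nonneg hα, abs_of_nonneg hβ] at this
            nlinarith [mul_le_mul_of_nonneg_left this hwx]
        _ = α * ∑ x ∈ t1 ∪ t2, w x * |c1 x| + β * ∑ x ∈ t1 ∪ t2, w x * |c2 x| := by
            rw [Finset.sum_add_distrib, Finset.mul_sum, Finset.mul_sum]
        _ ≤ α * s + β * s := by gcongr
        _ = s := by rw [← add_mul, hαβ, one_mul]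
    · rw [e1', e2', Finset.smul_sum, Finset.smul_sum, ← Finset.sum_add_distrib]
      refine Finset.sum_congr rfl fun x _ => ?_
      rw [add_smul, mul_smul, mul_smul]
  have h0 : (0 : Fin (n+1) → ℝ) ∈ interior K := by
    let x : Fin (n+1) → ℝ := fun i => (hD.natEmbedding D i : ℝ)
    have hxD : ∀ i, x i ∈ D := fun i => (hD.natEmbedding D i).2
    have hxi : Function.Injective x := by
      intro i j h
      have := (hD.natEmbedding D).injective (Subtype.ext h)
      exact Fin.ext this
    let A := Matrix.vandermonde x
    have hA : IsUnit A.det := isUnit_iff_ne_zero.2 (Matrix.det_vandermonde_ne_zero_iff.2 hxi)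
    let T := Matrix.vecMulLinear A
    have hT : Function.Surjective T := by
      intro v
      refine ⟨Matrix.vecMul v A⁻¹, ?_⟩
      simp only [T, Matrix.vecMulLinear_apply, Matrix.vecMul_vecMul, Matrix.nonsing_inv_mul A hA, Matrix.vecMul_one]
    have hTo : IsOpenMap T := T.isOpenMap_of_finiteDimensional hT
    let O : Set (Fin (n+1) → ℝ) := {c | ∑ i, w (x i) * |c i| < s}
    have hO : IsOpen O := by
      refine isOpen_lt ?_ continuous_const
      fun_prop
    refine mem_interior.2 ⟨T '' O, ?_, hTo _ hO, ⟨0, ?_, by simp⟩⟩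
    · rintro _ ⟨c, hc, rfl⟩
      have hc' : ∑ i, w (x i) * |c i| < s := hc
      refine ⟨Finset.univ.image x, Function.extend x c 0, ?_, ?_, ?_, ?_⟩
      · intro y hy
        simp only [Finset.coe_image, Finset.coe_univ, image_univ, mem_range] at hy
        obtain ⟨i, rfl⟩ := hy
        exact hxD i
      · intro y hy
        apply Function.extend_apply'
        rintro ⟨i, rfl⟩
        exact hy (Finset.mem_image_of_mem _ (Finset.mem_univ _))
      · rw [Finset.sum_image hxi.injOn]
        simp only [hxi.extend_apply]
        exact hc'.le
      · rw [Finset.sum_image hxi.injOn]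
        simp only [hxi.extend_apply]
        funext j
        simp [T, Matrix.vecMul, dotProduct, A, Matrix.vandermonde_apply, m]
    · change ∑ i, w (x i) * |(0 : Fin (n+1) → ℝ) i| < s
      simpa using hs0
  have hKm : ∀ x ∈ D, ∀ σ : ℝ, |σ| ≤ 1 → (σ * (s / w x)) • m x ∈ K := by
    intro x hx σ hσ
    have hwx := hw x hx
    refine ⟨{x}, fun y => if y = x then σ * (s / w x) else 0, by simpa using hx, ?_, ?_, ?_⟩
    · intro y hy
      exact if_neg (by simpa using hy)
    · simp only [Finset.sum_singleton, if_true]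
      rw [abs_mul, abs_of_pos (show 0 < s / w x by positivity)]
      have : w x * (|σ| * (s / w x)) = |σ| * s := by field_simp
      rw [this]; nlinarith
    · simp
  apply interior_subset
  by_contra hcon
  obtain ⟨f, hf⟩ := geometric_hahn_banach_open_point hKc.interior isOpen_interior hcon
  have hA : 0 < f (m x₀) := by simpa using hf 0 h0
  have hfK : ∀ v ∈ K, f v ≤ f (m x₀) := by
    intro v hv
    have hcl : v ∈ closure (interior K) := by
      rw [hKc.closure_interior_eq_closure_of_nonempty_interior ⟨0, h0⟩]
      exact subset_closure hv
    have : closure (interior K) ⊆ {v | f v ≤ f (m x₀)} :=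
      closure_minimal (fun v hv => (hf v hv).le) (isClosed_le f.continuous continuous_const)
    exact this hcl
  let p : Polynomial ℝ := ∑ j : Fin (n+1), Polynomial.C (f (Pi.single j 1)) * Polynomial.X ^ (j : ℕ)
  have hpe : ∀ x, p.eval x = f (m x) := by
    intro x
    have h1 := LinearMap.pi_apply_eq_sum_univ (f : (Fin (n+1) → ℝ) →ₗ[ℝ] ℝ) (m x)
    have h2 : f (m x) = (f : (Fin (n+1) → ℝ) →ₗ[ℝ] ℝ) (m x) := rfl
    rw [h2, h1]
    simp only [p, Polynomial.eval_finsetSum, Polynomial.eval_mul, Polynomial.eval_C, Polynomial.eval_pow, Polynomial.eval_X]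
    refine Finset.sum_congr rfl fun j _ => ?_
    rw [smul_eq_mul, mul_comm]
    have : (Pi.single j 1 : Fin (n+1) → ℝ) = fun i => if j = i then 1 else 0 := by
      funext i
      simp [Pi.single_apply, eq_comm]
    rw [this]
    rfl
  set A := f (m x₀) with hAd
  have hbad := hp (Polynomial.C (s / A) * p) (by
    intro x hx
    have hwx := hw x hx
    have h1 := hfK _ (hKm x hx 1 (by simp))
    have h2 := hfK _ (hKm x hx (-1) (by simp))
    rw [map_smul, smul_eq_mul, ← hpe] at h1 h2
    rw [Polynomial.eval_mul, Polynomial.eval_C, abs_mul, abs_of_pos (by positivity), div_mul_eq_mul_div, div_le_iff₀ hA]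
    have h3 : s / w x * |p.eval x| ≤ A := by
      rcases abs_cases (p.eval x) with ⟨h, -⟩ | ⟨h, -⟩ <;> rw [h] <;> linarith
    rw [div_mul_eq_mul_div, div_le_iff₀ (by positivity)] at h3
    linarith)
  rw [Polynomial.eval_mul, Polynomial.eval_C, hpe, ← hAd, div_mul_cancel₀ _ hA.ne', abs_of_pos hs0] at hbad
  linarith

lemma reduce_support {D : Set ℝ} {w : ℝ → ℝ} (hw : ∀ x ∈ D, 1 ≤ w x) {x₀ s : ℝ} (n : ℕ) :
    ∀ (N : ℕ) (t : Finset ℝ) (c : ℝ → ℝ), t.card ≤ N → ↑t ⊆ D → (∑ x ∈ t, w x * |c x| ≤ s) →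
      (∀ k ≤ n, ∑ x ∈ t, c x * x ^ k = x₀ ^ k) →
    ∃ (t : Finset ℝ) (c : ℝ → ℝ), t.card ≤ n + 1 ∧ ↑t ⊆ D ∧ (∑ x ∈ t, w x * |c x| ≤ s) ∧
      ∀ k ≤ n, ∑ x ∈ t, c x * x ^ k = x₀ ^ k := by
  classical
  intro N
  induction N with
  | zero =>
    intro t c h1 h2 h3 h4
    exact ⟨t, c, by omega, h2, h3, h4⟩
  | succ N ih =>
    intro t c h1 h2 h3 h4
    by_cases hcard : t.card ≤ n + 1
    · exact ⟨t, c, hcard, h2, h3, h4⟩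
    -- if some coefficient vanishes
    by_cases hz : ∃ x ∈ t, c x = 0
    · obtain ⟨x, hx, hcx⟩ := hz
      refine ih (t.erase x) c (by rw [Finset.card_erase_of_mem hx]; omega) ?_ ?_ ?_
      · exact (Finset.coe_subset.2 (Finset.erase_subset _ _)).trans h2
      · rw [Finset.sum_erase _ (by simp [hcx])]; exact h3
      · intro k hk; rw [Finset.sum_erase _ (by simp [hcx])]; exact h4 k hk
    push Not at hz
    -- nontrivial relation
    obtain ⟨d, ⟨x1, hx1, hd1⟩, hd0⟩ : ∃ d : ℝ → ℝ, (∃ x ∈ t, d x ≠ 0) ∧ ∀ k ≤ n, ∑ x ∈ t, d x * x ^ k = 0 := by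
      let T : (t → ℝ) →ₗ[ℝ] (Fin (n+1) → ℝ) :=
        LinearMap.pi (fun j => ∑ x : t, ((x:ℝ)^(j:ℕ)) • LinearMap.proj x)
      have hk : T.ker ≠ ⊥ := by
        apply LinearMap.ker_ne_bot_of_finrank_lt
        simp
        omega
      obtain ⟨d, hd, hdne⟩ := (Submodule.ne_bot_iff _).1 hk
      obtain ⟨x, hx⟩ := Function.ne_iff.1 hdne
      refine ⟨fun y => if h : y ∈ t then d ⟨y, h⟩ else 0, ⟨x, x.2, by simpa using hx⟩, ?_⟩
      intro k hk
      have := congrFun (LinearMap.mem_ker.1 hd) ⟨k, by omega⟩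
      simp [T] at this
      rw [← Finset.sum_attach]
      rw [← this]
      refine Finset.sum_congr (by simp) fun x _ => ?_
      simp [mul_comm]
    -- WLOG sign
    obtain ⟨d, ⟨x1, hx1, hd1⟩, hd0, hds⟩ : ∃ d : ℝ → ℝ, (∃ x ∈ t, d x ≠ 0) ∧ (∀ k ≤ n, ∑ x ∈ t, d x * x ^ k = 0) ∧
        ∑ x ∈ t, w x * (SignType.sign (c x) * d x) ≤ 0 := by
      rcases le_total (∑ x ∈ t, w x * (SignType.sign (c x) * d x)) 0 with h | h
      · exact ⟨d, ⟨x1, hx1, hd1⟩, hd0, h⟩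
      · refine ⟨fun x => - d x, ⟨x1, hx1, by simpa using hd1⟩, ?_, ?_⟩
        · intro k hk; simp [hd0 k hk]
        · simp only [mul_neg, Finset.sum_neg_distrib]; linarith
    have hwt : ∀ x ∈ t, 0 < w x := fun x hx => zero_lt_one.trans_le (hw x (h2 hx))
    let t' := t.filter (fun x => SignType.sign (c x) * d x < 0)
    have hne : t'.Nonempty := by
      by_contra hemp
      rw [Finset.not_nonempty_iff_eq_empty] at hemp
      have hnn : ∀ x ∈ t, 0 ≤ (SignType.sign (c x) * d x : ℝ) := by
        intro x hx
        by_contra hneg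
        have : x ∈ t' := Finset.mem_filter.2 ⟨hx, not_le.1 hneg⟩
        rw [hemp] at this
        simp at this
      have hz0 : ∑ x ∈ t, w x * (SignType.sign (c x) * d x) = 0 :=
        le_antisymm hds (Finset.sum_nonneg fun x hx => mul_nonneg (hwt x hx).le (hnn x hx))
      have := (Finset.sum_eq_zero_iff_of_nonneg (fun x hx => mul_nonneg (hwt x hx).le (hnn x hx))).1 hz0 x1 hx1
      have hsgn : (SignType.sign (c x1) : ℝ) ≠ 0 := by
        have := hz x1 hx1
        rcases lt_or_gt_of_ne this with h | h
        · simp [sign_neg h]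
        · simp [sign_pos h]
      rcases mul_eq_zero.1 this with h | h
      · exact (hwt x1 hx1).ne' h
      · rcases mul_eq_zero.1 h with h | h
        · exact hsgn h
        · exact hd1 h
    obtain ⟨y, hy, hmin⟩ := Finset.exists_min_image t' (fun x => |c x| / |d x|) hne
    obtain ⟨hyt, hyneg⟩ := Finset.mem_filter.1 hy
    set r := |c y| / |d y| with hr
    have hr0 : 0 ≤ r := by positivity
    have hsign : ∀ x ∈ t, |c x + r * d x| = SignType.sign (c x) * (c x + r * d x) := by
      intro x hx
      have hcx := hz x hx
      have hmul : (SignType.sign (c x) : ℝ) * c x = |c x| := by rw [sign_mul_self]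
      have hnn : 0 ≤ (SignType.sign (c x) : ℝ) * (c x + r * d x) := by
        by_cases hneg : (SignType.sign (c x) * d x : ℝ) < 0
        · have h5 := hmin x (Finset.mem_filter.2 ⟨hx, hneg⟩)
          have hdx : d x ≠ 0 := by rintro h; simp [h] at hneg
          rw [le_div_iff₀ (abs_pos.2 hdx)] at h5
          have h6 : (SignType.sign (c x) * d x : ℝ) ≥ - |d x| := by
            rcases lt_or_gt_of_ne hcx with h | h
            · simp [sign_neg h]; exact le_abs_self _
            · simp [sign_pos h]; exact neg_abs_le _
          nlinarith
        · push Not at hneg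
          nlinarith [abs_nonneg (c x)]
      rw [← abs_of_nonneg hnn, abs_mul]
      have : |(SignType.sign (c x) : ℝ)| = 1 := by
        rcases lt_or_gt_of_ne hcx with h | h
        · simp [sign_neg h]
        · simp [sign_pos h]
      rw [this, one_mul]
    have hy0 : c y + r * d y = 0 := by
      have hdy : d y ≠ 0 := by rintro h; simp [h] at hyneg
      rcases lt_or_gt_of_ne (hz y hyt) with h | h
      · simp [sign_neg h] at hyneg
        rw [hr, abs_of_neg h, abs_of_pos hyneg]; field_simp; ring
      · simp [sign_pos h] at hyneg
        rw [hr, abs_of_pos h, abs_of_neg hyneg]; field_simp; ring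
    refine ih (t.erase y) (fun x => c x + r * d x) (by rw [Finset.card_erase_of_mem hyt]; omega) ?_ ?_ ?_
    · exact (Finset.coe_subset.2 (Finset.erase_subset _ _)).trans h2
    · rw [Finset.sum_erase _ (by simp [hy0])]
      calc ∑ x ∈ t, w x * |c x + r * d x|
          = ∑ x ∈ t, (w x * |c x| + r * (w x * (SignType.sign (c x) * d x))) := by
            refine Finset.sum_congr rfl fun x hx => ?_
            rw [hsign x hx, ← sign_mul_self (c x)]; ring
        _ = ∑ x ∈ t, w x * |c x| + r * ∑ x ∈ t, w x * (SignType.sign (c x) * d x) := by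
            rw [Finset.sum_add_distrib, Finset.mul_sum]
        _ ≤ s := by nlinarith
    · intro k hk
      rw [Finset.sum_erase _ (by simp [hy0])]
      simp only [add_mul, Finset.sum_add_distrib, mul_assoc, ← Finset.mul_sum]
      rw [h4 k hk, hd0 k hk]; ring

lemma quad_poly {t : Finset ℝ} {c : ℝ → ℝ} {x₀ : ℝ} {n : ℕ}
    (hq : ∀ k ≤ n, ∑ x ∈ t, c x * x ^ k = x₀ ^ k) {R : Polynomial ℂ} (hR : R.natDegree ≤ n) :
    ∑ x ∈ t, (c x : ℂ) * R.eval (x:ℂ) = R.eval (x₀:ℂ) := by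
  simp only [Polynomial.eval_eq_sum_range' (Nat.lt_succ_of_le hR), Finset.mul_sum]
  rw [Finset.sum_comm]
  refine Finset.sum_congr rfl fun k hk => ?_
  have h1 := hq k (by simpa [Nat.lt_succ_iff] using hk)
  have h2 : ∑ x ∈ t, (c x : ℂ) * (x:ℂ) ^ k = (x₀:ℂ) ^ k := by exact_mod_cast h1
  rw [← h2, Finset.mul_sum]
  refine Finset.sum_congr rfl fun x _ => ?_
  ring

lemma quad_identity {t : Finset ℝ} {c : ℝ → ℝ} {x₀ : ℝ} {n : ℕ} (ht : t.card ≤ n + 1) (hx₀ : x₀ ∉ t)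
    (hq : ∀ k ≤ n, ∑ x ∈ t, c x * x ^ k = x₀ ^ k) {P : Polynomial ℂ} (hP : P.natDegree ≤ n) {z : ℂ}
    (hz : ∀ x ∈ t, z ≠ (x:ℂ)) :
    P.eval z * ∏ x ∈ t, ((x₀:ℂ) - x) =
      (∏ x ∈ t, (z - x)) * ∑ x ∈ t, (c x : ℂ) * ((x₀ - x) * P.eval (x:ℂ) / (z - x)) := by
  let B : Polynomial ℂ := ∏ x ∈ t, (Polynomial.X - Polynomial.C (x:ℂ))
  have hBe : ∀ y : ℂ, B.eval y = ∏ x ∈ t, (y - x) := by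
    intro y; simp [B, Polynomial.eval_prod]
  have hBd : B.natDegree ≤ n + 1 := by
    simp only [B]
    rw [Polynomial.natDegree_prod_of_monic _ _ (fun x _ => Polynomial.monic_X_sub_C _)]
    simpa using ht
  have hBt : ∀ x ∈ t, B.eval (x:ℂ) = 0 := by
    intro x hx
    rw [hBe]; exact Finset.prod_eq_zero hx (by simp)
  rw [← hBe, ← hBe]
  have hzx : ∀ x ∈ t, z - x ≠ 0 := fun x hx => sub_ne_zero.2 (hz x hx)
  rcases eq_or_ne z (x₀:ℂ) with rfl | hzx₀
  · rw [mul_comm]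
    congr 1
    rw [← quad_poly hq hP]
    refine Finset.sum_congr rfl fun x hx => ?_
    rw [mul_div_cancel_left₀ _ (hzx x hx)]
  let F : Polynomial ℂ := (Polynomial.C (x₀:ℂ) - Polynomial.X) * P * Polynomial.C (B.eval z)
    - Polynomial.C ((x₀ - z) * P.eval z) * B
  have hF0 : F.IsRoot z := by
    simp [F, Polynomial.IsRoot]
  obtain ⟨R, hR⟩ := Polynomial.dvd_iff_isRoot.2 hF0
  have hFd : F.natDegree ≤ n + 1 := by
    refine (Polynomial.natDegree_sub_le _ _).trans (max_le ?_ ?_)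
    · refine (Polynomial.natDegree_mul_C_le _ _).trans ?_
      refine Polynomial.natDegree_mul_le.trans ?_
      have : (Polynomial.C (x₀:ℂ) - Polynomial.X).natDegree ≤ 1 := by
        refine (Polynomial.natDegree_sub_le _ _).trans (max_le ?_ ?_) <;> simp
      omega
    · exact (Polynomial.natDegree_C_mul_le _ _).trans hBd
  have hRd : R.natDegree ≤ n := by
    by_cases h0 : R = 0
    · simp [h0]
    · rw [hR, Polynomial.natDegree_mul (Polynomial.X_sub_C_ne_zero z) h0, Polynomial.natDegree_X_sub_C] at hFd
      omega
  have hRe : ∀ y : ℂ, F.eval y = (y - z) * R.eval y := by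
    intro y; rw [hR]; simp
  have hFe : ∀ y : ℂ, F.eval y = (x₀ - y) * P.eval y * B.eval z - (x₀ - z) * P.eval z * B.eval y := by
    intro y; simp [F]
  have h1 := quad_poly hq hRd
  have h2 : R.eval (x₀:ℂ) = - (P.eval z * B.eval (x₀:ℂ)) := by
    have h3 := hRe x₀
    rw [hFe] at h3
    have h4 : (x₀:ℂ) - z ≠ 0 := sub_ne_zero.2 hzx₀.symm
    apply mul_left_cancel₀ h4
    rw [← h3]; ring
  have h3 : ∀ x ∈ t, R.eval (x:ℂ) = - (B.eval z * ((x₀ - x) * P.eval (x:ℂ) / (z - x))) := by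
    intro x hx
    have h4 := hRe x
    rw [hFe, hBt x hx] at h4
    have h5 := hzx x hx
    have h6 : (x:ℂ) - z ≠ 0 := by rw [← neg_sub]; exact neg_ne_zero.2 h5
    apply mul_left_cancel₀ h6
    rw [← h4]
    field_simp
    ring
  rw [h2] at h1
  rw [Finset.mul_sum, ← neg_inj, ← h1, ← Finset.sum_neg_distrib]
  refine Finset.sum_congr rfl fun x hx => ?_
  rw [h3 x hx]; ring

lemma quad_bound {t : Finset ℝ} {c : ℝ → ℝ} {x₀ : ℝ} {n : ℕ} (ht : t.card ≤ n + 1) (hx₀ : x₀ ∉ t)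
    (hq : ∀ k ≤ n, ∑ x ∈ t, c x * x ^ k = x₀ ^ k) {P : Polynomial ℂ} (hP : P.natDegree ≤ n) {z : ℂ}
    (hz : ∀ x ∈ t, z ≠ (x:ℂ)) {w : ℝ → ℝ} (hw : ∀ x ∈ t, ‖P.eval (x:ℂ)‖ ≤ w x)
    {s Y : ℝ} (hm : ∑ x ∈ t, w x * |c x| ≤ s) (hY : ∀ x ∈ t, |x - x₀| / ‖z - x‖ ≤ Y) (hY0 : 0 ≤ Y) :
    ‖P.eval z‖ ≤ ‖∏ x ∈ t, ((z - x) / ((x₀:ℂ) - x))‖ * (s * Y) := by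
  have hid := quad_identity ht hx₀ hq hP hz
  have hB0 : ∏ x ∈ t, ((x₀:ℂ) - x) ≠ 0 := by
    rw [Finset.prod_ne_zero_iff]
    intro x hx h
    rw [sub_eq_zero] at h
    have h' : x₀ = x := by exact_mod_cast h
    exact hx₀ (h' ▸ hx)
  rw [Finset.prod_div_distrib]
  have h1 : P.eval z = (∏ x ∈ t, (z - x)) / (∏ x ∈ t, ((x₀:ℂ) - x)) *
      ∑ x ∈ t, (c x : ℂ) * ((x₀ - x) * P.eval (x:ℂ) / (z - x)) := by
    rw [div_mul_eq_mul_div, ← hid, mul_div_cancel_right₀ _ hB0]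
  rw [h1, norm_mul]
  gcongr
  calc ‖∑ x ∈ t, (c x : ℂ) * ((x₀ - x) * P.eval (x:ℂ) / (z - x))‖
      ≤ ∑ x ∈ t, ‖(c x : ℂ) * ((x₀ - x) * P.eval (x:ℂ) / (z - x))‖ := norm_sum_le _ _
    _ ≤ ∑ x ∈ t, (w x * |c x|) * Y := by
        refine Finset.sum_le_sum fun x hx => ?_
        have e1 : ‖(x₀:ℂ) - x‖ = |x - x₀| := by
          rw [← Complex.ofReal_sub, Complex.norm_real, Real.norm_eq_abs, abs_sub_comm]
        rw [norm_mul, norm_div, norm_mul, e1, Complex.norm_real, Real.norm_eq_abs]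
        have h2 := hw x hx
        have h3 := hY x hx
        calc |c x| * (|x - x₀| * ‖P.eval (x:ℂ)‖ / ‖z - x‖)
            = (‖P.eval (x:ℂ)‖ * |c x|) * (|x - x₀| / ‖z - x‖) := by ring
          _ ≤ (w x * |c x|) * Y := by
            have : 0 ≤ w x := (norm_nonneg _).trans h2
            gcongr
    _ = (∑ x ∈ t, w x * |c x|) * Y := by rw [Finset.sum_mul]
    _ ≤ s * Y := by gcongr

lemma count_bound {t : Finset ℝ} {c : ℝ → ℝ} {x₀ : ℝ} {n : ℕ} (ht : t.card ≤ n + 1)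
    (hq : ∀ k ≤ n, ∑ x ∈ t, c x * x ^ k = x₀ ^ k) {w : ℝ → ℝ} (hw : ∀ x ∈ t, 1 ≤ w x)
    {s d : ℝ} (hm : ∑ x ∈ t, w x * |c x| ≤ s) (hs : 1 ≤ s) (hd : 0 < d) (htd : ∀ x ∈ t, d ≤ |x - x₀|) :
    ∑ x ∈ t, 1 / |x - x₀| ^ 2 ≤ 4 / d ^ 2 * Real.log (4 * s ^ 2) := by
  set η := d / 2 with hη
  have hη0 : 0 < η := by positivity
  have hx₀ : x₀ ∉ t := by
    intro h
    have := htd _ h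
    simp at this; linarith
  have hside : ∀ σ : ℝ, |σ| = 1 → 1 ≤ (∏ x ∈ t, |((x₀ + σ * η) - x) / (x₀ - x)|) * (s * 2) := by
    intro σ hσ
    have hfar : ∀ x ∈ t, |x - x₀| / 2 ≤ |x₀ + σ * η - x| := by
      intro x hx
      have h1 := htd x hx
      have h2 := abs_sub_abs_le_abs_sub (x₀ - x) (-(σ * η))
      rw [abs_neg, abs_mul, hσ, abs_of_pos hη0, abs_sub_comm x₀ x] at h2
      have h3 : x₀ - x - -(σ * η) = x₀ + σ * η - x := by ring
      rw [h3] at h2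
      linarith
    have hpos : ∀ x ∈ t, 0 < |x₀ + σ * η - x| := by
      intro x hx
      have := hfar x hx
      have := htd x hx
      linarith
    have := quad_bound (P := 1) (z := ((x₀ + σ * η : ℝ) : ℂ)) (w := w) (s := s) (Y := 2) ht hx₀ hq (by simp) ?_ (by simpa using hw) hm ?_ (by norm_num)
    · simp only [Polynomial.eval_one, norm_one, norm_prod, norm_div] at this
      refine this.trans (le_of_eq ?_)
      congr 1
      refine Finset.prod_congr rfl fun x _ => ?_
      rw [← Complex.ofReal_sub, ← Complex.ofReal_sub, Complex.norm_real, Complex.norm_real, abs_div]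
      rfl
    · intro x hx h
      have h' : x₀ + σ * η = x := by exact_mod_cast h
      have := hpos x hx
      rw [h', sub_self, abs_zero] at this
      exact lt_irrefl _ this
    · intro x hx
      rw [← Complex.ofReal_sub, Complex.norm_real, Real.norm_eq_abs, div_le_iff₀ (hpos x hx)]
      have := hfar x hx
      linarith
  have h1 := hside 1 (by simp)
  have h2 := hside (-1) (by simp)
  set p1 := ∏ x ∈ t, |((x₀ + 1 * η) - x) / (x₀ - x)|
  set p2 := ∏ x ∈ t, |((x₀ + -1 * η) - x) / (x₀ - x)|
  have h3 : 1 ≤ p1 * p2 * (4 * s ^ 2) := by nlinarith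
  have h4 : p1 * p2 ≤ Real.exp (- ∑ x ∈ t, η ^ 2 / |x - x₀| ^ 2) := by
    rw [← Finset.prod_mul_distrib, ← Finset.sum_neg_distrib, Real.exp_sum]
    refine Finset.prod_le_prod (fun x _ => by positivity) fun x hx => ?_
    have h5 := htd x hx
    have hne : x₀ - x ≠ 0 := by
      intro h; rw [abs_sub_comm, h, abs_zero] at h5; linarith
    rw [← abs_mul]
    have h6 : ((x₀ + 1 * η) - x) / (x₀ - x) * (((x₀ + -1 * η) - x) / (x₀ - x)) = 1 - η ^ 2 / |x - x₀| ^ 2 := by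
      rw [sq_abs]
      have : (x - x₀) ^ 2 = (x₀ - x) ^ 2 := by ring
      rw [this]
      field_simp
      ring
    rw [h6, abs_of_nonneg]
    · have := Real.add_one_le_exp (-(η ^ 2 / |x - x₀| ^ 2)); linarith
    · have h7 : 0 < |x - x₀| := by linarith
      rw [sub_nonneg, div_le_one (by positivity)]
      have : η ≤ |x - x₀| := by linarith
      gcongr
  have h5 : ∑ x ∈ t, η ^ 2 / |x - x₀| ^ 2 ≤ Real.log (4 * s ^ 2) := by
    rw [Real.le_log_iff_exp_le (by positivity)]
    have h6 : 1 ≤ Real.exp (- ∑ x ∈ t, η ^ 2 / |x - x₀| ^ 2) * (4 * s ^ 2) := by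
      refine h3.trans ?_
      gcongr
    rw [Real.exp_neg, ← div_eq_inv_mul, le_div_iff₀ (Real.exp_pos _)] at h6
    linarith
  have h6 : ∑ x ∈ t, 1 / |x - x₀| ^ 2 = 4 / d ^ 2 * ∑ x ∈ t, η ^ 2 / |x - x₀| ^ 2 := by
    rw [Finset.mul_sum]
    refine Finset.sum_congr rfl fun x _ => ?_
    rw [hη]; field_simp; norm_num
  rw [h6]
  gcongr

noncomputable def qf (x y : ℝ) (z : ℂ) : ℂ := Complex.exp (Complex.log ((z - y) / (z - x)) / 2)

lemma quot_slit {x y : ℝ} {z : ℂ} (hz : z ∉ cplx (uIcc x y)) : (z - y) / (z - x) ∈ slitPlane := by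
  by_contra hcon
  rw [Complex.mem_slitPlane_iff] at hcon
  push Not at hcon
  obtain ⟨h1, h2⟩ := hcon
  set u := (z - y) / (z - x) with hu
  have hzx : z - x ≠ 0 := by
    intro h
    exact hz ⟨x, left_mem_uIcc, (sub_eq_zero.1 h).symm⟩
  set r := - u.re with hr
  have hr0 : 0 ≤ r := by linarith
  have hur : u = -(r:ℂ) := by
    apply Complex.ext
    · simp [hr]
    · simp [h2]
  have h3 : z - y = -(r:ℂ) * (z - x) := by
    rw [← hur, hu]; field_simp
  have h1r : (1 + r : ℝ) ≠ 0 := by positivity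
  have h1r' : (1 + r : ℂ) ≠ 0 := by exact_mod_cast h1r
  have h4 : z = (((y + r * x) / (1 + r) : ℝ) : ℂ) := by
    push_cast
    rw [eq_div_iff h1r']
    linear_combination h3
  refine hz ⟨(y + r * x) / (1 + r), ?_, h4.symm⟩
  rw [mem_uIcc]
  rcases le_total x y with h | h
  · left
    rw [le_div_iff₀ (by positivity), div_le_iff₀ (by positivity)]
    constructor <;> nlinarith
  · right
    rw [le_div_iff₀ (by positivity), div_le_iff₀ (by positivity)]
    constructor <;> nlinarith

lemma notMem_ne {x y : ℝ} {z : ℂ} (hz : z ∉ cplx (uIcc x y)) : z - x ≠ 0 := by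
  intro h
  exact hz ⟨x, left_mem_uIcc, (sub_eq_zero.1 h).symm⟩

lemma qf_diff {x y : ℝ} {z : ℂ} (hz : z ∉ cplx (uIcc x y)) : DifferentiableAt ℂ (qf x y) z := by
  have h1 : DifferentiableAt ℂ (fun z : ℂ => (z - y) / (z - x)) z :=
    DifferentiableAt.fun_div (by fun_prop) (by fun_prop) (notMem_ne hz)
  exact ((h1.clog (quot_slit hz)).div_const 2).cexp

lemma qf_sq {x y : ℝ} {z : ℂ} (hz : z ∉ cplx (uIcc x y)) : qf x y z ^ 2 = (z - y) / (z - x) := by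
  unfold qf
  rw [← Complex.exp_nat_mul]
  have : ((2:ℕ):ℂ) * (Complex.log ((z - y) / (z - x)) / 2) = Complex.log ((z - y) / (z - x)) := by
    push_cast; ring
  rw [this, Complex.exp_log (Complex.slitPlane_ne_zero (quot_slit hz))]

lemma qf_re (x y : ℝ) (z : ℂ) : 0 ≤ (qf x y z).re := by
  unfold qf
  rw [Complex.exp_re]
  apply mul_nonneg (Real.exp_pos _).le
  apply Real.cos_nonneg_of_neg_pi_div_two_le_of_le
  · have := Complex.neg_pi_lt_arg ((z - y) / (z - x))
    simp [Complex.log_im]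
    linarith
  · have := Complex.arg_le_pi ((z - y) / (z - x))
    simp [Complex.log_im]
    linarith

lemma qf_norm_sq {x y : ℝ} {z : ℂ} (hz : z ∉ cplx (uIcc x y)) :
    ‖qf x y z‖ ^ 2 = ‖z - y‖ / ‖z - x‖ := by
  rw [← norm_pow, qf_sq hz, norm_div]

lemma one_add_norm {q : ℂ} {A : ℝ} (hA : 0 ≤ A) (hq : 0 ≤ q.re) :
    1 ≤ ‖1 + A * q‖ ∧ A * ‖q‖ ≤ ‖1 + A * q‖ := by
  constructor
  · have h1 := Complex.re_le_norm (1 + A * q)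
    simp at h1
    nlinarith
  · have h1 : ‖(A * q : ℂ)‖ = A * ‖q‖ := by simp [abs_of_nonneg hA]
    rw [← h1, ← sq_le_sq₀ (norm_nonneg _) (norm_nonneg _), ← Complex.normSq_eq_norm_sq, ← Complex.normSq_eq_norm_sq,
      Complex.normSq_apply, Complex.normSq_apply]
    simp
    nlinarith [mul_nonneg hA hq]

lemma key_bound {x y x₀ c : ℝ} {k : ℕ} (hc : 0 < c) (hc1 : c ≤ 1) {z : ℂ} (hz : z ∉ cplx (uIcc x y))
    (hl : |y - x| = c / (1 + |x - x₀|) ^ k) :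
    |x - x₀| / ‖z - x‖ ≤ 2 ^ (k+6) / c * (1 + ‖z - x₀‖) ^ (k+5) *
      ‖1 + ((1 / (1 + |x - x₀|) ^ 2 : ℝ) : ℂ) * qf x y z‖ ^ 2 := by
  set s := |x - x₀| with hs
  have hs0 : 0 ≤ s := abs_nonneg _
  set Z := ‖z - x₀‖ with hZ
  have hZ0 : 0 ≤ Z := norm_nonneg _
  set A := 1 / (1 + s) ^ 2 with hA
  have hA0 : 0 < A := by positivity
  obtain ⟨h1, h2⟩ := one_add_norm hA0.le (qf_re x y z)
  set T := ‖1 + (A : ℂ) * qf x y z‖ with hT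
  have hzx : 0 < ‖z - x‖ := norm_pos_iff.2 (notMem_ne hz)
  have hT1 : 1 ≤ T ^ 2 := one_le_pow₀ h1
  have hsx : ‖((x₀:ℂ) - x)‖ = s := by
    rw [← Complex.ofReal_sub, Complex.norm_real, Real.norm_eq_abs, abs_sub_comm]
  have hZk : ∀ m : ℕ, 1 ≤ (1 + Z) ^ m := fun m => one_le_pow₀ (by linarith)
  rcases le_or_gt (2 * Z) s with h | h
  · have h3 : s ≤ 2 * ‖z - x‖ := by
      have h4 : (x₀:ℂ) - x = (z - x) - (z - x₀) := by ring
      have h5 := norm_sub_le (z - x) (z - x₀)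
      rw [← h4, hsx] at h5
      linarith
    have h6 : s / ‖z - x‖ ≤ 2 := by rwa [div_le_iff₀ hzx]
    refine h6.trans ?_
    have h7 : (2:ℝ) ≤ 2 ^ (k+6) / c := by
      rw [le_div_iff₀ hc]
      have : (1:ℝ) ≤ 2 ^ k := one_le_pow₀ (by norm_num)
      rw [pow_add]; nlinarith
    calc (2:ℝ) = 2 * 1 * 1 := by norm_num
      _ ≤ _ := by gcongr; exact hZk _
  · have h1s : 1 + s ≤ 2 * (1 + Z) := by linarith
    set l := c / (1 + s) ^ k with hl'
    have hl0 : 0 < l := by positivity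
    rcases le_or_gt (l / 2) ‖z - x‖ with h3 | h3
    · calc s / ‖z - x‖ ≤ (1 + s) / (l / 2) := by gcongr; linarith
        _ = 2 * (1 + s) ^ (k+1) / c := by rw [hl']; field_simp; ring
        _ ≤ 2 * (2 * (1 + Z)) ^ (k+1) / c := by gcongr
        _ ≤ 2 * (2 * (1 + Z)) ^ (k+5) / c := by
            gcongr
            · linarith
            · norm_num
        _ = 2 ^ (k+6) / c * (1 + Z) ^ (k+5) * 1 := by rw [mul_pow]; ring
        _ ≤ _ := by gcongr
    · have hy : l / 2 ≤ ‖z - y‖ := by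
        have h4 : ((x:ℂ) - y) = (z - y) - (z - x) := by ring
        have h5 := norm_sub_le (z - y) (z - x)
        have h6 : ‖(x:ℂ) - y‖ = l := by
          rw [← Complex.ofReal_sub, Complex.norm_real, Real.norm_eq_abs, abs_sub_comm, hl]
        rw [← h4, h6] at h5
        linarith
      have h4 : A ^ 2 * (‖z - y‖ / ‖z - x‖) ≤ T ^ 2 := by
        rw [← qf_norm_sq hz, ← mul_pow]
        gcongr
      have h5 : A ^ 2 * (l / 2 / ‖z - x‖) ≤ T ^ 2 := by
        refine le_trans ?_ h4
        gcongr
      calc s / ‖z - x‖ ≤ (1 + s) / ‖z - x‖ := by gcongr; linarith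
        _ = (2 * (1 + s) ^ (k+5) / c) * (A ^ 2 * (l / 2 / ‖z - x‖)) := by
            rw [hA, hl']; field_simp; ring
        _ ≤ (2 * (2 * (1 + Z)) ^ (k+5) / c) * T ^ 2 := by gcongr
        _ = _ := by rw [mul_pow]; ring

noncomputable def Vf (a b : ℝ) (z : ℂ) : ℂ := (1 + qf b a z) ^ 2 * (z - b) / ((b - a : ℝ) : ℂ)

lemma Vf_bound {a b x₀ : ℝ} (hab : a < b) {z : ℂ} (hz : z ∉ cplx (uIcc b a)) :
    DifferentiableAt ℂ (Vf a b) z ∧ Vf a b z ≠ 0 ∧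
      1 + ‖z - x₀‖ ≤ (1 + |b - x₀| + (b - a)) * ‖Vf a b z‖ := by
  have hδ : 0 < b - a := by linarith
  have hδ' : ((b - a : ℝ) : ℂ) ≠ 0 := by exact_mod_cast hδ.ne'
  have hzb := notMem_ne hz
  have hq := qf_diff hz
  set q := qf b a z with hqd
  have hsq := qf_sq hz
  rw [← hqd] at hsq
  have hre := qf_re b a z
  rw [← hqd] at hre
  have h1 : 1 ≤ ‖1 + q‖ := by
    have := (one_add_norm (q := q) zero_le_one hre).1
    simpa using this
  have hV : ‖Vf a b z‖ = ‖1 + q‖ ^ 2 * ‖z - b‖ / (b - a) := by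
    unfold Vf
    rw [norm_div, norm_mul, norm_pow, Complex.norm_real, Real.norm_eq_abs, abs_of_pos hδ]
  have hV1 : ‖z - b‖ ≤ (b - a) * ‖Vf a b z‖ := by
    rw [hV, mul_div_cancel₀ _ hδ.ne']
    exact le_mul_of_one_le_left (norm_nonneg _) (one_le_pow₀ h1)
  have hV2 : 1 ≤ ‖Vf a b z‖ := by
    have h3 : (q - 1) * (q + 1) * (z - b) = ((b - a : ℝ) : ℂ) := by
      have : (q - 1) * (q + 1) = q ^ 2 - 1 := by ring
      rw [this, hsq]
      field_simp
      push_cast; ring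
    have h4 : ‖q - 1‖ * ‖1 + q‖ * ‖z - b‖ = b - a := by
      rw [add_comm 1 q, ← norm_mul, ← norm_mul, h3, Complex.norm_real, Real.norm_eq_abs, abs_of_pos hδ]
    have h5 : ‖q - 1‖ ≤ ‖1 + q‖ := by
      rw [← sq_le_sq₀ (norm_nonneg _) (norm_nonneg _), ← Complex.normSq_eq_norm_sq, ← Complex.normSq_eq_norm_sq,
      Complex.normSq_apply, Complex.normSq_apply]
      simp
      nlinarith
    rw [hV, le_div_iff₀ hδ, one_mul]
    calc b - a = ‖q - 1‖ * ‖1 + q‖ * ‖z - b‖ := h4.symm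
      _ ≤ ‖1 + q‖ * ‖1 + q‖ * ‖z - b‖ := by gcongr
      _ = _ := by ring
  refine ⟨?_, ?_, ?_⟩
  · unfold Vf
    exact ((((differentiableAt_const 1).fun_add hq).fun_pow 2).fun_mul (by fun_prop)).div_const _
  · rw [← norm_pos_iff]; linarith
  · have h6 : ‖z - x₀‖ ≤ ‖z - b‖ + |b - x₀| := by
      have : z - x₀ = (z - b) + ((b - x₀ : ℝ) : ℂ) := by push_cast; ring
      rw [this]
      refine (norm_add_le _ _).trans ?_
      rw [Complex.norm_real, Real.norm_eq_abs]
    nlinarith [abs_nonneg (b - x₀)]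

lemma Phi_exists {E : Set ℝ} {x₀ d c a₀ b₀ s : ℝ} {k : ℕ} (hd : 0 < d) (hEd : ∀ x ∈ E, d ≤ |x - x₀|)
    (hc : 0 < c) (hc1 : c ≤ 1)
    (hseg : ∀ x ∈ E, ∃ y, uIcc x y ⊆ E ∧ |y - x| = c / (1 + |x - x₀|) ^ k)
    (hab : a₀ < b₀) (hI : Icc a₀ b₀ ⊆ E) (hs : 1 ≤ s) :
    ∃ C : ℝ, 0 < C ∧ ∀ (n : ℕ) (t : Finset ℝ) (cf w : ℝ → ℝ), t.card ≤ n + 1 → ↑t ⊆ E →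
      (∀ x ∈ t, 1 ≤ w x) → (∑ x ∈ t, w x * |cf x| ≤ s) → (∀ k ≤ n, ∑ x ∈ t, cf x * x ^ k = x₀ ^ k) →
      ∃ Φ : ℂ → ℂ, DifferentiableOn ℂ Φ (cplx E)ᶜ ∧ (∀ z ∈ (cplx E)ᶜ, Φ z ≠ 0) ∧ ‖Φ x₀‖ ≤ C ∧
        ∀ P : Polynomial ℂ, P.natDegree ≤ n → (∀ x ∈ t, ‖P.eval (x:ℂ)‖ ≤ w x) →
          ∀ z ∈ (cplx E)ᶜ, ‖P.eval z‖ ≤ ‖Φ z‖ := by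
  have hmono : ∀ {S : Set ℝ}, S ⊆ E → ∀ z ∈ (cplx E)ᶜ, z ∉ cplx S := by
    intro S hS z hz h
    exact hz (Set.image_mono hS h)
  have hVz : ∀ z ∈ (cplx E)ᶜ, z ∉ cplx (uIcc b₀ a₀) := hmono (by rw [uIcc_of_ge hab.le]; exact hI)
  have hx₀E : x₀ ∉ E := fun h => by have := hEd _ h; simp at this; linarith
  have hx₀Ω : (x₀:ℂ) ∈ (cplx E)ᶜ := by
    rintro ⟨x, hx, h⟩
    have : x = x₀ := Complex.ofReal_injective h
    exact hx₀E (this ▸ hx)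
  set H := 1 + |b₀ - x₀| + (b₀ - a₀) with hH
  have hH0 : 0 < H := by have := abs_nonneg (b₀ - x₀); linarith
  set G := s * (2 ^ (k+6) / c * H ^ (k+5)) with hG
  have hG0 : 0 < G := by positivity
  set Cc := G * ‖Vf a₀ b₀ x₀‖ ^ (k+5) * Real.exp (2 * ((1 + 1/d) * (4 / d ^ 2 * Real.log (4 * s ^ 2)))) + 1 with hCc
  refine ⟨Cc, by positivity, ?_⟩
  intro n t cf w ht htE hw hm hq
  have : ∀ x, ∃ y, x ∈ E → uIcc x y ⊆ E ∧ |y - x| = c / (1 + |x - x₀|) ^ k := by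
    intro x
    by_cases h : x ∈ E
    · obtain ⟨y, hy⟩ := hseg x h; exact ⟨y, fun _ => hy⟩
    · exact ⟨0, fun h' => absurd h' h⟩
  choose y hy using this
  have hyz : ∀ x ∈ t, ∀ z ∈ (cplx E)ᶜ, z ∉ cplx (uIcc x (y x)) := fun x hx => hmono (hy x (htE hx)).1
  let A : ℝ → ℝ := fun x => 1 / (1 + |x - x₀|) ^ 2
  have hA0 : ∀ x, 0 < A x := fun x => by simp only [A]; positivity
  let f : ℝ → ℂ → ℂ := fun x z => (1 + (A x : ℂ) * qf x (y x) z) ^ 2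
  have hf1 : ∀ x z, 1 ≤ ‖f x z‖ := by
    intro x z
    simp only [f, norm_pow]
    exact one_le_pow₀ (one_add_norm (hA0 x).le (qf_re _ _ _)).1
  let Φ : ℂ → ℂ := fun z => (∏ x ∈ t, ((z - x) / ((x₀:ℂ) - x))) * ((G : ℂ) * Vf a₀ b₀ z ^ (k+5) * ∏ x ∈ t, f x z)
  have hx₀t : x₀ ∉ t := fun h => hx₀E (htE h)
  have hx₀x : ∀ x ∈ t, (x₀:ℂ) - x ≠ 0 := by
    intro x hx h
    rw [sub_eq_zero] at h
    have h' : x₀ = x := by exact_mod_cast h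
    exact hx₀t (h' ▸ hx)
  have hzx : ∀ z ∈ (cplx E)ᶜ, ∀ x ∈ t, z - x ≠ 0 := fun z hz x hx => notMem_ne (hyz x hx z hz)
  refine ⟨Φ, ?_, ?_, ?_, ?_⟩
  · intro z hz
    have h1 : DifferentiableAt ℂ (fun z : ℂ => ∏ x ∈ t, ((z - x) / ((x₀:ℂ) - x))) z := by
      apply DifferentiableAt.fun_finsetProd
      intro x _
      fun_prop
    have h2 : DifferentiableAt ℂ (fun z : ℂ => ∏ x ∈ t, f x z) z := by
      apply DifferentiableAt.fun_finsetProd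
      intro x hx
      have := qf_diff (hyz x hx z hz)
      exact ((differentiableAt_const 1).fun_add (this.const_mul _)).fun_pow 2
    have h3 := (Vf_bound (x₀ := x₀) hab (hVz z hz)).1
    exact (h1.fun_mul (((h3.fun_pow (k+5)).const_mul _).fun_mul h2)).differentiableWithinAt
  · intro z hz
    have h3 := (Vf_bound (x₀ := x₀) hab (hVz z hz)).2.1
    apply mul_ne_zero
    · rw [Finset.prod_ne_zero_iff]
      intro x hx
      exact div_ne_zero (hzx z hz x hx) (hx₀x x hx)
    · apply mul_ne_zero (mul_ne_zero (by exact_mod_cast hG0.ne') (pow_ne_zero _ h3))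
      rw [Finset.prod_ne_zero_iff]
      intro x hx h
      have := hf1 x z
      rw [h, norm_zero] at this
      linarith
  · have h1 : ∏ x ∈ t, (((x₀:ℂ) - x) / ((x₀:ℂ) - x)) = 1 :=
      Finset.prod_eq_one fun x hx => div_self (hx₀x x hx)
    have h2 : ∏ x ∈ t, ‖f x x₀‖ ≤ Real.exp (2 * ((1 + 1/d) * (4 / d ^ 2 * Real.log (4 * s ^ 2)))) := by
      calc ∏ x ∈ t, ‖f x x₀‖ ≤ ∏ x ∈ t, Real.exp (2 * ((1 + 1/d) * (1 / |x - x₀| ^ 2))) := by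
            refine Finset.prod_le_prod (fun _ _ => norm_nonneg _) fun x hx => ?_
            have hdx := hEd x (htE hx)
            have hsx : 0 < |x - x₀| := by linarith
            have hq2 := qf_norm_sq (hyz x hx _ hx₀Ω)
            have e1 : ‖(x₀:ℂ) - x‖ = |x - x₀| := by
              rw [← Complex.ofReal_sub, Complex.norm_real, Real.norm_eq_abs, abs_sub_comm]
            have e2 : ‖(x₀:ℂ) - y x‖ ≤ |x - x₀| + 1 := by
              have h5 : (x₀:ℂ) - y x = ((x₀ - x : ℝ) : ℂ) + ((x - y x : ℝ) : ℂ) := by push_cast; ring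
              rw [h5]
              refine (norm_add_le _ _).trans ?_
              rw [Complex.norm_real, Complex.norm_real, Real.norm_eq_abs, Real.norm_eq_abs, abs_sub_comm, abs_sub_comm x (y x), (hy x (htE hx)).2]
              gcongr
              rw [div_le_one (by positivity)]
              exact hc1.trans (one_le_pow₀ (by linarith))
            have e3 : ‖qf x (y x) x₀‖ ^ 2 ≤ 1 + 1/d := by
              rw [hq2, e1]
              calc _ ≤ (|x - x₀| + 1) / |x - x₀| := by gcongr
                _ = 1 + 1 / |x - x₀| := by field_simp
                _ ≤ _ := by gcongr
            have e4 : ‖qf x (y x) x₀‖ ≤ 1 + 1/d := by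
              have : 0 < 1/d := by positivity
              by_contra hcon
              push Not at hcon
              nlinarith
            have e5 : ‖1 + (A x : ℂ) * qf x (y x) x₀‖ ≤ 1 + (1 + 1/d) * (1 / |x - x₀| ^ 2) := by
              refine (norm_add_le _ _).trans ?_
              rw [norm_one, norm_mul, Complex.norm_real, Real.norm_eq_abs, abs_of_pos (hA0 x), mul_comm]
              have : A x ≤ 1 / |x - x₀| ^ 2 := by
                simp only [A]
                gcongr
                linarith
              gcongr
            have e6 : ‖1 + (A x : ℂ) * qf x (y x) x₀‖ ≤ Real.exp ((1 + 1/d) * (1 / |x - x₀| ^ 2)) :=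
              e5.trans (by linarith [Real.add_one_le_exp ((1 + 1/d) * (1 / |x - x₀| ^ 2))])
            simp only [f, norm_pow]
            rw [two_mul ((1 + 1/d) * (1 / |x - x₀| ^ 2)), Real.exp_add, ← pow_two]
            gcongr
        _ = Real.exp (2 * ((1 + 1/d) * ∑ x ∈ t, (1 / |x - x₀| ^ 2))) := by
            rw [← Real.exp_sum, Finset.mul_sum, Finset.mul_sum]
        _ ≤ _ := by
            gcongr
            exact count_bound ht hq hw hm hs hd (fun x hx => hEd x (htE hx))
    simp only [Φ]
    rw [h1, one_mul, norm_mul, norm_mul, norm_pow, norm_prod, Complex.norm_real, Real.norm_eq_abs, abs_of_pos hG0, hCc]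
    have : G * ‖Vf a₀ b₀ x₀‖ ^ (k+5) * ∏ x ∈ t, ‖f x x₀‖ ≤ G * ‖Vf a₀ b₀ x₀‖ ^ (k+5) * Real.exp (2 * ((1 + 1/d) * (4 / d ^ 2 * Real.log (4 * s ^ 2)))) := by
      gcongr
    linarith
  · intro P hP hPw z hz
    obtain ⟨-, -, h3⟩ := Vf_bound (x₀ := x₀) hab (hVz z hz)
    have hb := quad_bound (Y := 2 ^ (k+6) / c * (1 + ‖z - x₀‖) ^ (k+5) * ∏ x ∈ t, ‖f x z‖) ht hx₀t hq hP
      (fun x hx => sub_ne_zero.1 (hzx z hz x hx)) hPw hm ?_ (by positivity)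
    · refine hb.trans ?_
      simp only [Φ]
      rw [norm_mul]
      gcongr
      rw [norm_mul, norm_mul, norm_pow, norm_prod, Complex.norm_real, Real.norm_eq_abs, abs_of_pos hG0]
      calc s * (2 ^ (k+6) / c * (1 + ‖z - x₀‖) ^ (k+5) * ∏ x ∈ t, ‖f x z‖)
          ≤ s * (2 ^ (k+6) / c * (H * ‖Vf a₀ b₀ z‖) ^ (k+5) * ∏ x ∈ t, ‖f x z‖) := by gcongr
        _ = _ := by rw [hG, mul_pow]; ring
    · intro x hx
      refine (key_bound hc hc1 (hyz x hx z hz) (hy x (htE hx)).2).trans ?_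
      have : ‖1 + ((1 / (1 + |x - x₀|) ^ 2 : ℝ) : ℂ) * qf x (y x) z‖ ^ 2 = ‖f x z‖ := by
        simp only [f, norm_pow, A]
      rw [this]
      gcongr
      rw [← Finset.mul_prod_erase t _ hx]
      refine le_mul_of_one_le_right (norm_nonneg _) ?_
      have h9 := Finset.prod_le_prod (s := t.erase x) (f := fun _ => (1:ℝ)) (g := fun x => ‖f x z‖)
        (fun _ _ => zero_le_one) (fun x' _ => hf1 x' z)
      simpa using h9

lemma harnack_chain {Ω : Set ℂ} (hΩ : IsOpen Ω) (hpc : IsPreconnected Ω) {u : ℕ → ℂ → ℝ}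
    (hu : ∀ n, InnerProductSpace.HarmonicOnNhd (u n) Ω) (hpos : ∀ n, ∀ z ∈ Ω, 0 < u n z)
    {x₀ : ℂ} (hx₀ : x₀ ∈ Ω) {C : ℝ} (hC : ∀ n, u n x₀ ≤ C) :
    ∀ z ∈ Ω, ∃ C : ℝ, ∀ n, u n z ≤ C := by
  have hstep : ∀ z w : ℂ, ∀ R : ℝ, Metric.ball z R ⊆ Ω → w ∈ Metric.ball z R →
      (∃ C : ℝ, ∀ n, u n z ≤ C) → (∃ C : ℝ, ∀ n, u n w ≤ C) := by
    rintro z w R hR hw ⟨C, hC⟩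
    have hwR : dist w z < R := hw
    have hR0 : 0 < R := dist_nonneg.trans_lt hwR
    refine ⟨4 * R / (R - dist w z) * C, fun n => ?_⟩
    refine (harnack (fun y hy => hu n y (hR hy)) (fun y hy => hpos n y (hR hy)) hw).trans ?_
    have : 0 < R - dist w z := by linarith
    gcongr
    exact hC n
  let S : Set ℂ := {z | z ∈ Ω ∧ ∃ C : ℝ, ∀ n, u n z ≤ C}
  have hS : IsOpen S := by
    rw [Metric.isOpen_iff]
    rintro z ⟨hz, hzC⟩
    obtain ⟨R, hR0, hR⟩ := Metric.isOpen_iff.1 hΩ z hz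
    exact ⟨R, hR0, fun w hw => ⟨hR hw, hstep z w R hR hw hzC⟩⟩
  have hsub : Ω ⊆ S := by
    refine hpc.subset_of_closure_inter_subset hS ⟨x₀, hx₀, hx₀, C, hC⟩ ?_
    rintro z ⟨hzc, hz⟩
    obtain ⟨R, hR0, hR⟩ := Metric.isOpen_iff.1 hΩ z hz
    obtain ⟨w, hwS, hw⟩ := Metric.mem_closure_iff.1 hzc (R/2) (by positivity)
    refine ⟨hz, hstep w z (R/2) ?_ hw hwS.2⟩
    intro y hy
    apply hR
    rw [Metric.mem_ball] at hy ⊢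
    have := dist_triangle y w z
    rw [dist_comm] at hw
    linarith
  intro z hz
  exact (hsub hz).2

lemma limit_fn {Ω : Set ℂ} (hΩ : IsOpen Ω) (hpc : IsPreconnected Ω) {F : ℕ → ℂ → ℂ}
    (hd : ∀ n, DifferentiableOn ℂ (F n) Ω) (h1 : ∀ n, ∀ z ∈ Ω, ‖F n z‖ ≤ 1)
    (h0 : ∀ n, ∀ z ∈ Ω, F n z ≠ 0) {x₀ : ℂ} (hx₀ : x₀ ∈ Ω) {δ : ℝ} (hδ : 0 < δ)
    (hF : ∀ n, δ ≤ ‖F n x₀‖) :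
    ∃ f : ℂ → ℂ, DifferentiableOn ℂ f Ω ∧ (∀ z ∈ Ω, f z ≠ 0) ∧
      ∀ z ∈ Ω, Tendsto (fun n => F n z) (hyperfilter ℕ : Filter ℕ) (nhds (f z)) := by
  have hlim : ∀ z, ∃ y : ℂ, z ∈ Ω → Tendsto (fun n => F n z) (hyperfilter ℕ : Filter ℕ) (nhds y) := by
    intro z
    by_cases hz : z ∈ Ω
    · obtain ⟨y, -, hy⟩ := (isCompact_closedBall (0:ℂ) 1).ultrafilter_le_nhds ((hyperfilter ℕ).map (fun n => F n z))
        (by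
          rw [Ultrafilter.coe_map, le_principal_iff]
          exact Filter.mem_map.2 (univ_mem' fun n => by simpa using h1 n z hz))
      exact ⟨y, fun _ => hy⟩
    · exact ⟨0, fun h => absurd h hz⟩
  choose f hf using hlim
  have hlu : TendstoLocallyUniformlyOn F f (hyperfilter ℕ : Filter ℕ) Ω := by
    rw [Metric.tendstoLocallyUniformlyOn_iff]
    intro ε hε z hz
    obtain ⟨R, hR0, hR⟩ := Metric.isOpen_iff.1 hΩ z hz
    have hlip : ∀ n, ∀ w ∈ Metric.ball z R, dist (F n w) (F n z) ≤ 2 / R * dist w z := by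
      intro n w hw
      refine Complex.dist_le_div_mul_dist_of_mapsTo_ball ((hd n).mono hR) ?_ hw
      intro y hy
      have e1 := h1 n y (hR hy)
      have e2 := h1 n z hz
      rw [Metric.mem_closedBall, dist_eq_norm]
      refine (norm_sub_le _ _).trans (by linarith)
    have hlipf : ∀ w ∈ Metric.ball z R, dist (f w) (f z) ≤ 2 / R * dist w z := by
      intro w hw
      exact le_of_tendsto ((hf w (hR hw)).dist (hf z hz)) (Eventually.of_forall fun n => hlip n w hw)
    set r := min R (ε * R / 8) with hr
    have hr0 : 0 < r := by positivity
    refine ⟨Metric.ball z r, mem_nhdsWithin_of_mem_nhds (Metric.ball_mem_nhds _ hr0), ?_⟩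
    filter_upwards [(Metric.tendsto_nhds.1 (hf z hz)) (ε/4) (by positivity)] with n hn w hw
    have hwr : dist w z < r := hw
    have hwR : w ∈ Metric.ball z R := Metric.ball_subset_ball (min_le_left _ _) hw
    have e1 := hlip n w hwR
    have e2 := hlipf w hwR
    have e3 : 2 / R * dist w z ≤ ε / 4 := by
      have : dist w z ≤ ε * R / 8 := hwr.le.trans (min_le_right _ _)
      rw [div_mul_eq_mul_div, div_le_iff₀ hR0]
      linarith
    have e4 := dist_triangle4 (f w) (f z) (F n z) (F n w)
    rw [dist_comm (f z) (F n z), dist_comm (F n z) (F n w)] at e4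
    linarith
  have hch := harnack_chain (u := fun n z => Real.log ‖(F n z)⁻¹‖ + 1) hΩ hpc ?_ ?_ hx₀ (C := Real.log (δ⁻¹) + 1) ?_
  · refine ⟨f, hlu.differentiableOn (Eventually.of_forall hd) hΩ, ?_, hf⟩
    intro z hz hfz
    obtain ⟨C, hC⟩ := hch z hz
    have hlow : ∀ n, Real.exp (-C) ≤ ‖F n z‖ := by
      intro n
      have hp : 0 < ‖F n z‖ := norm_pos_iff.2 (h0 n z hz)
      rw [← Real.le_log_iff_exp_le hp]
      have := hC n
      rw [norm_inv, Real.log_inv] at this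
      linarith
    have h2 : Real.exp (-C) ≤ ‖f z‖ := ge_of_tendsto (hf z hz).norm (Eventually.of_forall hlow)
    rw [hfz, norm_zero] at h2
    exact absurd h2 (not_le.2 (Real.exp_pos _))
  · intro n z hz
    have han : AnalyticAt ℂ (F n) z := (hd n).analyticAt (hΩ.mem_nhds hz)
    exact (AnalyticAt.harmonicAt_log_norm (han.inv (h0 n z hz)) (inv_ne_zero (h0 n z hz))).add
      (InnerProductSpace.harmonicAt_const _)
  · intro n z hz
    have hp : 0 < ‖F n z‖ := norm_pos_iff.2 (h0 n z hz)
    have : 0 ≤ Real.log ‖(F n z)⁻¹‖ := by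
      apply Real.log_nonneg
      rw [norm_inv]
      exact (one_le_inv₀ hp).2 (h1 n z hz)
    linarith
  · intro n
    have := hF n
    simp only [norm_inv]
    gcongr
    exact inv_pos.2 (hδ.trans_le this)

lemma E_locallyFinite {a b : ℕ → ℝ} 
    (hdist : Tendsto (fun m => Metric.infDist (0 : ℝ) (Icc (a m) (b m))) atTop atTop) :
    LocallyFinite (fun m => Icc (a m) (b m)) := by
  intro x
  refine ⟨Metric.ball x 1, Metric.ball_mem_nhds _ one_pos, ?_⟩
  obtain ⟨m₀, hm₀⟩ := eventually_atTop.1 (hdist.eventually_gt_atTop (|x| + 1))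
  refine (finite_Iio m₀).subset ?_
  rintro m ⟨y, hy1, hy2⟩
  by_contra hcon
  have h1 := hm₀ m (not_lt.1 hcon)
  have h2 := Metric.infDist_le_dist_of_mem (x := (0:ℝ)) hy1
  rw [Real.dist_eq, zero_sub, abs_neg] at h2
  rw [Metric.mem_ball, Real.dist_eq] at hy2
  have h3 := abs_sub_abs_le_abs_sub y x
  linarith

lemma exists_notMem {a b : ℕ → ℝ} (hab : ∀ m, a m < b m)
    (hdisj : ∀ m n, m ≠ n → Disjoint (Icc (a m) (b m)) (Icc (a n) (b n)))
    (hlf : LocallyFinite (fun m => Icc (a m) (b m))) : ∃ x₀ : ℝ, x₀ ∉ ⋃ m, Icc (a m) (b m) := by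
  by_contra hcon
  push Not at hcon
  have hcl : IsClopen (Icc (a 0) (b 0)) := by
    refine ⟨isClosed_Icc, ?_⟩
    rw [← isClosed_compl_iff]
    have h1 : (Icc (a 0) (b 0))ᶜ = ⋃ m : {m : ℕ // m ≠ 0}, Icc (a m) (b m) := by
      ext x
      constructor
      · intro hx
        obtain ⟨m, hm⟩ := mem_iUnion.1 (hcon x)
        refine mem_iUnion.2 ⟨⟨m, ?_⟩, hm⟩
        rintro rfl
        exact hx hm
      · intro hx h0
        obtain ⟨⟨m, hm0⟩, hm⟩ := mem_iUnion.1 hx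
        exact Set.disjoint_left.1 (hdisj m 0 hm0) hm h0
    rw [h1]
    exact (hlf.comp_injective Subtype.val_injective).isClosed_iUnion (fun _ => isClosed_Icc)
  rcases isClopen_iff.1 hcl with h | h
  · have : a 0 ∈ Icc (a 0) (b 0) := left_mem_Icc.2 (hab 0).le
    rw [h] at this; exact this
  · have : b 0 + 1 ∈ Icc (a 0) (b 0) := by rw [h]; trivial
    have := this.2
    linarith

lemma Omega_preconnected {E : Set ℝ} {x₀ : ℝ} (hx₀ : x₀ ∉ E) : IsPreconnected (cplx E)ᶜ := by
  have hx₀Ω : (x₀:ℂ) ∈ (cplx E)ᶜ := by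
    rintro ⟨x, hx, h⟩
    have : x = x₀ := Complex.ofReal_injective h
    exact hx₀ (this ▸ hx)
  have him : ∀ z : ℂ, z.im ≠ 0 → z ∈ (cplx E)ᶜ := by
    rintro z hz ⟨x, -, rfl⟩
    simp at hz
  have h1 : IsPreconnected ((cplx E)ᶜ ∩ {z : ℂ | 0 ≤ z.im}) := by
    refine (convex_halfSpace_im_gt 0).isPreconnected.subset_closure ?_ ?_
    · intro z hz
      have hz' : 0 < z.im := hz
      exact ⟨him z hz'.ne', hz'.le⟩
    · rw [Complex.closure_setOf_lt_im]
      exact inter_subset_right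
  have h2 : IsPreconnected ((cplx E)ᶜ ∩ {z : ℂ | z.im ≤ 0}) := by
    refine (convex_halfSpace_im_lt 0).isPreconnected.subset_closure ?_ ?_
    · intro z hz
      have hz' : z.im < 0 := hz
      exact ⟨him z hz'.ne, hz'.le⟩
    · rw [Complex.closure_setOf_im_lt]
      exact inter_subset_right
  have m1 : (x₀:ℂ) ∈ (cplx E)ᶜ ∩ {z : ℂ | 0 ≤ z.im} := ⟨hx₀Ω, show 0 ≤ (x₀:ℂ).im by simp⟩
  have m2 : (x₀:ℂ) ∈ (cplx E)ᶜ ∩ {z : ℂ | z.im ≤ 0} := ⟨hx₀Ω, show (x₀:ℂ).im ≤ 0 by simp⟩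
  have h3 := IsPreconnected.union (x₀:ℂ) m1 m2 h1 h2
  convert h3 using 1
  rw [← inter_union_distrib_left]
  refine (inter_eq_left.2 ?_).symm
  intro z _
  exact le_total 0 z.im

lemma seg_exists {a b : ℕ → ℝ} (hab : ∀ m, a m < b m) {c M : ℝ} (hc : 0 < c)
    (hlen : ∀ m, c * (1 + Metric.infDist (0 : ℝ) (Icc (a m) (b m))) ^ (-M) ≤ b m - a m) (x₀ : ℝ) :
    ∃ (k : ℕ) (c' : ℝ), 0 < c' ∧ c' ≤ 1 ∧ ∀ x ∈ ⋃ m, Icc (a m) (b m), ∃ y,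
      uIcc x y ⊆ ⋃ m, Icc (a m) (b m) ∧ |y - x| = c' / (1 + |x - x₀|) ^ k := by
  set k := ⌈max M 0⌉₊ with hk
  have hMk : M ≤ k := (le_max_left _ _).trans (Nat.le_ceil _)
  set c' := min 1 (c / (2 * (1 + |x₀|) ^ k)) with hc'
  have hc'0 : 0 < c' := by positivity
  refine ⟨k, c', hc'0, min_le_left _ _, ?_⟩
  intro x hx
  obtain ⟨m, hm⟩ := mem_iUnion.1 hx
  set s := |x - x₀| with hs
  have hs0 : 0 ≤ s := abs_nonneg _
  set l := c' / (1 + s) ^ k with hl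
  have hl0 : 0 < l := by positivity
  set r := Metric.infDist (0 : ℝ) (Icc (a m) (b m)) with hr
  have hr0 : 0 ≤ r := Metric.infDist_nonneg
  have hrx : r ≤ |x₀| + s := by
    have h2 := Metric.infDist_le_dist_of_mem (x := (0:ℝ)) hm
    rw [Real.dist_eq, zero_sub, abs_neg] at h2
    have h3 := abs_sub_abs_le_abs_sub x x₀
    linarith
  have hl2 : 2 * l ≤ b m - a m := by
    refine le_trans ?_ (hlen m)
    have h1 : ((1 + |x₀|) * (1 + s)) ^ (-(k:ℝ)) ≤ (1 + r) ^ (-M) := by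
      calc ((1 + |x₀|) * (1 + s)) ^ (-(k:ℝ)) ≤ (1 + r) ^ (-(k:ℝ)) := by
            apply Real.rpow_le_rpow_of_nonpos (by positivity)
            · nlinarith [mul_nonneg (abs_nonneg x₀) hs0]
            · simp
        _ ≤ (1 + r) ^ (-M) := by
            apply Real.rpow_le_rpow_of_exponent_le (by linarith)
            linarith
    rw [Real.rpow_neg (by positivity), Real.rpow_natCast] at h1
    have h2 : l ≤ (c / (2 * (1 + |x₀|) ^ k)) / (1 + s) ^ k := by
      rw [hl]; gcongr; exact min_le_right _ _
    calc 2 * l ≤ 2 * ((c / (2 * (1 + |x₀|) ^ k)) / (1 + s) ^ k) := by gcongr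
      _ = c * (((1 + |x₀|) * (1 + s)) ^ k)⁻¹ := by rw [mul_pow]; field_simp
      _ ≤ _ := by gcongr
  have hsub : ∀ y ∈ Icc (a m) (b m), uIcc x y ⊆ ⋃ m, Icc (a m) (b m) := fun y hy =>
    (uIcc_subset_Icc hm hy).trans (subset_iUnion (fun m => Icc (a m) (b m)) m)
  rcases le_total x ((a m + b m) / 2) with h | h
  · refine ⟨x + l, hsub _ ⟨?_, ?_⟩, ?_⟩
    · linarith [hm.1]
    · linarith
    · rw [add_sub_cancel_left, abs_of_pos hl0]
  · refine ⟨x - l, hsub _ ⟨?_, ?_⟩, ?_⟩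
    · linarith
    · linarith [hm.2]
    · rw [sub_sub_cancel_left, abs_neg, abs_of_pos hl0]

lemma forward {a b : ℕ → ℝ} (hab : ∀ m, a m < b m)
    (hdisj : ∀ m n, m ≠ n → Disjoint (Icc (a m) (b m)) (Icc (a n) (b n)))
    (hdist : Tendsto (fun m => Metric.infDist (0 : ℝ) (Icc (a m) (b m))) atTop atTop)
    {E : Set ℝ} (hE : E = ⋃ m, Icc (a m) (b m)) (hEc : IsClosed E) (hΩ : IsOpen (cplx E)ᶜ)
    {c M : ℝ} (hc : 0 < c)
    (hlen : ∀ m, c * (1 + Metric.infDist (0 : ℝ) (Icc (a m) (b m))) ^ (-M) ≤ b m - a m)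
    {W : ℝ → ℝ≥0∞} (hW : IsWeight W) (hWE : ∀ x ∈ Eᶜ, W x = ⊤) (hnd : ¬ PolyDense W) :
      ∃ h : ℂ → ℝ, HarmonicOn h (cplx E)ᶜ ∧ (∀ z ∈ (cplx E)ᶜ, 0 < h z) ∧
        ∀ z ∈ (cplx E)ᶜ, elog (MW W z) ≤ ENNReal.ofReal (h z) := by
  obtain ⟨x₀, hx₀⟩ := exists_notMem hab hdisj (E_locallyFinite hdist)
  rw [← hE] at hx₀
  obtain ⟨d, hd, hEd⟩ : ∃ d : ℝ, 0 < d ∧ ∀ x ∈ E, d ≤ |x - x₀| := by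
    obtain ⟨d, hd, hb⟩ := Metric.isOpen_iff.1 hEc.isOpen_compl x₀ hx₀
    refine ⟨d, hd, fun x hx => ?_⟩
    by_contra hcon
    exact hb (show x ∈ Metric.ball x₀ d by rw [Metric.mem_ball, Real.dist_eq]; linarith) hx
  have hx₀Ω : (x₀:ℂ) ∈ (cplx E)ᶜ := by
    rintro ⟨x, hx, h⟩
    have : x = x₀ := Complex.ofReal_injective h
    exact hx₀ (this ▸ hx)
  obtain ⟨k, c', hc'0, hc'1, hseg⟩ := seg_exists hab hc hlen x₀
  rw [← hE] at hseg
  have hDE : ∀ x, W x ≠ ⊤ → x ∈ E := fun x hx => by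
    by_contra h; exact hx (hWE x h)
  have hW1 := hW.2.1
  have hw1 : ∀ x, W x ≠ ⊤ → 1 ≤ (W x).toReal := by
    intro x hx
    have := ENNReal.toReal_mono hx (hW1 x); simpa using this
  obtain ⟨N, hN⟩ : ∃ N : ℝ, ∀ P ∈ XW W, ‖P.eval (x₀ : ℂ)‖ ≤ N := by
    by_contra hcon
    push Not at hcon
    exact hnd (step2 hW hd (fun x hx => hEd x (hDE x hx)) hcon)
  have h1X : (1 : Polynomial ℂ) ∈ XW W := by
    intro x
    simpa using hW1 x
  have hN1 : 1 ≤ N := by simpa using hN 1 h1X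
  let D : Set ℝ := {x | W x ≠ ⊤}
  have hDinf : D.Infinite := by
    obtain ⟨y, hy⟩ := hW.2.2.2
    exact Set.Infinite.of_accPt hy
  have hI : Icc (a 0) (b 0) ⊆ E := by rw [hE]; exact subset_iUnion (fun m => Icc (a m) (b m)) 0
  obtain ⟨C, hC0, hC⟩ := Phi_exists (s := N + 1) hd hEd hc'0 hc'1 hseg (hab 0) hI (by linarith)
  have hPhi : ∀ n : ℕ, ∃ Φ : ℂ → ℂ, DifferentiableOn ℂ Φ (cplx E)ᶜ ∧ (∀ z ∈ (cplx E)ᶜ, Φ z ≠ 0) ∧ ‖Φ x₀‖ ≤ C ∧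
        ∀ P : Polynomial ℂ, P.natDegree ≤ n → P ∈ XW W → ∀ z ∈ (cplx E)ᶜ, ‖P.eval z‖ ≤ ‖Φ z‖ := by
    intro n
    obtain ⟨t, cf, e1, e2, e3⟩ := duality_exact (D := D) hDinf (w := fun x => (W x).toReal) (x₀ := x₀) (N := N) (s := N+1)
      (fun x hx => hw1 x hx) (by linarith) (by linarith) n (by
        intro p hp
        have hev : ∀ x : ℝ, (p.map Complex.ofRealHom).eval (x:ℂ) = ((p.eval x : ℝ) : ℂ) := by
          intro x
          have := Polynomial.eval_map_apply (f := Complex.ofRealHom) (p := p) x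
          simpa using this
        have := hN (p.map Complex.ofRealHom) (by
          intro x
          rcases eq_or_ne (W x) ⊤ with h | h
          · rw [h]; exact le_top
          · rw [ENNReal.ofReal_le_iff_le_toReal h, hev, Complex.norm_real]
            exact hp x h)
        rw [hev, Complex.norm_real] at this
        exact this)
    obtain ⟨t, cf, e0, e1, e2, e3⟩ := reduce_support (fun x hx => hw1 x hx) n t.card t cf le_rfl e1 e2 e3
    obtain ⟨Φ, g1, g2, g3, g4⟩ := hC n t cf (fun x => (W x).toReal) e0 (fun x hx => hDE x (e1 hx))
      (fun x hx => hw1 x (e1 hx)) e2 e3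
    refine ⟨Φ, g1, g2, g3, fun P hP hPX => g4 P hP fun x hx => ?_⟩
    exact (ENNReal.ofReal_le_iff_le_toReal (e1 hx)).1 (hPX x)
  choose Φ g1 g2 g3 g4 using hPhi
  obtain ⟨f, hf, hf0, hflim⟩ := limit_fn (F := fun n z => (Φ n z)⁻¹) hΩ (Omega_preconnected hx₀)
    (fun n => (g1 n).inv (g2 n)) (by
      intro n z hz
      have := g4 n 1 (by simp) h1X z hz
      simp at this
      rw [norm_inv]
      exact inv_le_one_of_one_le₀ this) (fun n z hz => inv_ne_zero (g2 n z hz)) hx₀Ω (inv_pos.2 hC0) (by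
      intro n
      rw [norm_inv]
      have := norm_pos_iff.2 (g2 n x₀ hx₀Ω)
      have := g3 n
      gcongr)
  have hPf : ∀ P ∈ XW W, ∀ z ∈ (cplx E)ᶜ, ‖P.eval z‖ ≤ ‖(f z)⁻¹‖ := by
    intro P hP z hz
    have h1 : ‖P.eval z * f z‖ ≤ 1 := by
      refine le_of_tendsto ((hflim z hz).const_mul (P.eval z)).norm ?_
      have : ∀ᶠ n : ℕ in (hyperfilter ℕ : Filter ℕ), P.natDegree ≤ n :=
        Nat.hyperfilter_le_atTop (eventually_ge_atTop _)
      filter_upwards [this] with n hn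
      have h2 := g4 n P hn hP z hz
      rw [norm_mul, norm_inv, ← div_eq_mul_inv]
      exact div_le_one_of_le₀ h2 (norm_nonneg _)
    rw [norm_inv, ← one_div, le_div_iff₀ (norm_pos_iff.2 (hf0 z hz)), ← norm_mul]
    exact h1
  have hlog0 : ∀ z ∈ (cplx E)ᶜ, 0 ≤ Real.log ‖(f z)⁻¹‖ := by
    intro z hz
    apply Real.log_nonneg
    simpa using hPf 1 h1X z hz
  refine ⟨fun z => Real.log ‖(f z)⁻¹‖ + 1, ?_, ?_, ?_⟩
  · rw [harmonicOn_iff hΩ]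
    intro z hz
    have han : AnalyticAt ℂ f z := hf.analyticAt (hΩ.mem_nhds hz)
    exact (AnalyticAt.harmonicAt_log_norm (han.inv (hf0 z hz)) (inv_ne_zero (hf0 z hz))).add
      (InnerProductSpace.harmonicAt_const _)
  · intro z hz
    have := hlog0 z hz
    linarith
  · intro z hz
    have hMle : MW W z ≤ ENNReal.ofReal ‖(f z)⁻¹‖ :=
      iSup₂_le fun P hP => ENNReal.ofReal_le_ofReal (hPf P hP z hz)
    have hMt : MW W z ≠ ⊤ := ne_top_of_le_ne_top ENNReal.ofReal_ne_top hMle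
    have hM1 : 1 ≤ MW W z := by
      have : ENNReal.ofReal ‖(1 : Polynomial ℂ).eval z‖ ≤ MW W z :=
        le_iSup₂ (f := fun (P : Polynomial ℂ) (_ : P ∈ XW W) => ENNReal.ofReal ‖P.eval z‖) 1 h1X
      simpa using this
    have hM1' : 1 ≤ (MW W z).toReal := by
      have := ENNReal.toReal_mono hMt hM1; simpa using this
    have hM2 : (MW W z).toReal ≤ ‖(f z)⁻¹‖ := ENNReal.toReal_le_of_le_ofReal (norm_nonneg _) hMle
    unfold elog
    rw [if_neg hMt]
    apply ENNReal.ofReal_le_ofReal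
    have : Real.log (MW W z).toReal ≤ Real.log ‖(f z)⁻¹‖ := Real.log_le_log (by linarith) hM2
    linarith


theorem stmt16 (a b : ℕ → ℝ) (hab : ∀ m, a m < b m)
    (hdisj : ∀ m n, m ≠ n → Disjoint (Icc (a m) (b m)) (Icc (a n) (b n)))
    (hdist : Tendsto (fun m => Metric.infDist (0 : ℝ) (Icc (a m) (b m))) atTop atTop)
    (E : Set ℝ) (hE : E = ⋃ m, Icc (a m) (b m))
    (c M : ℝ) (hc : 0 < c)
    (hlen : ∀ m, c * (1 + Metric.infDist (0 : ℝ) (Icc (a m) (b m))) ^ (-M) ≤ b m - a m)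
    (W : ℝ → ℝ≥0∞) (hW : IsWeight W) (hWE : ∀ x ∈ Eᶜ, W x = ⊤) :
    ¬ PolyDense W ↔
      ∃ h : ℂ → ℝ, HarmonicOn h (cplx E)ᶜ ∧ (∀ z ∈ (cplx E)ᶜ, 0 < h z) ∧
        ∀ z ∈ (cplx E)ᶜ, elog (MW W z) ≤ ENNReal.ofReal (h z) := by
  have hEc : IsClosed E := by
    rw [hE]
    exact (E_locallyFinite hdist).isClosed_iUnion (fun _ => isClosed_Icc)
  have hΩ : IsOpen (cplx E)ᶜ :=
    (Complex.isometry_ofReal.isClosedEmbedding.isClosedMap E hEc).isOpen_compl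
  constructor
  · exact forward hab hdisj hdist hE hEc hΩ hc hlen hW hWE
  · rintro ⟨h, h1, h2, h3⟩
    exact back hW hΩ h1 h2 h3
end
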